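/- Let Λ be the Leech lattice and let φ ∈ O(Λ) be an involution (φ² = id, φ ≠ id). Then the coinvariant lattice S_φ(Λ) has rank 8, 12, 16, or 24. Moreover, if the rank is 8 then S_φ(Λ) is isometric to E8(−2); if the rank is 12 then S_φ(Λ) is isometric to D12^+(−2); and if the rank is 24 then S_φ(Λ) = Λ. -/

import Mathlib

open Matrix Module

/-- The orthogonal complement of a submodule with respect to a bilinear form. -/
def orthSub {M : Type*} [AddCommGroup M] (b : M →ₗ[ℤ] M →ₗ[ℤ] ℤ)
    (T : Submodule ℤ M) : Submodule ℤ M where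
  carrier := {x | ∀ y ∈ T, b x y = 0}
  add_mem' := by
    intro a c ha hc y hy
    simp only [Set.mem_setOf_eq] at *
    rw [map_add, LinearMap.add_apply, ha y hy, hc y hy, add_zero]
  zero_mem' := by intro y hy; simp
  smul_mem' := by
    intro k x hx y hy
    simp only [Set.mem_setOf_eq] at hx
    rw [_root_.map_smul, LinearMap.smul_apply, hx y hy, smul_zero]

/-- The invariant lattice `T_φ` of an isometry. -/
def fixSub {M : Type*} [AddCommGroup M] (φ : M ≃ₗ[ℤ] M) : Submodule ℤ M :=
  LinearMap.ker (φ.toLinearMap - LinearMap.id)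

/-- The E8 Cartan matrix (Bourbaki numbering). -/
def E8M : Matrix (Fin 8) (Fin 8) ℤ :=
  !![2,0,-1,0,0,0,0,0;
     0,2,0,-1,0,0,0,0;
     -1,0,2,-1,0,0,0,0;
     0,-1,-1,2,-1,0,0,0;
     0,0,0,-1,2,-1,0,0;
     0,0,0,0,-1,2,-1,0;
     0,0,0,0,0,-1,2,-1;
     0,0,0,0,0,0,-1,2]

/-- The lattice `D12`, realised inside `ℚ^12`: integral vectors with even
coordinate sum. -/
def D12set : Set (Fin 12 → ℚ) :=
  {x | (∀ i, ∃ k : ℤ, x i = k) ∧ (∃ m : ℤ, ∑ i, x i = 2 * m)}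

/-- The odd unimodular overlattice `D12^+ = D12 + ℤ·(1/2,…,1/2)` of `D12`. -/
def D12plus : Submodule ℤ (Fin 12 → ℚ) :=
  Submodule.span ℤ (D12set ∪ {fun _ => (1 : ℚ) / 2})


open MeasureTheory UnitAddTorus in
theorem poissonGen {n : ℕ} (g : (Fin n → ℝ) → ℂ) (hc : Continuous g) (hi : Integrable g)
    (hb : ∀ R : ℝ, ∃ u : (Fin n → ℤ) → ℝ, Summable u ∧
      ∀ k x, ‖x‖ ≤ R → ‖g (x + fun i => (k i : ℝ))‖ ≤ u k)
    (gh : (Fin n → ℤ) → ℂ) (hs : Summable gh)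
    (hgh : ∀ m : Fin n → ℤ,
      ∫ x, Complex.exp (-(2 * Real.pi * Complex.I * ∑ i, (m i : ℂ) * (x i : ℂ))) * g x = gh m)
    (x : Fin n → ℝ) :
    ∑' k : Fin n → ℤ, g (x + fun i => (k i : ℝ)) =
      ∑' m : Fin n → ℤ, gh m * Complex.exp (2 * Real.pi * Complex.I * ∑ i, (m i : ℂ) * (x i : ℂ)) := by
  have hcont : Continuous fun x : Fin n → ℝ => ∑' k : Fin n → ℤ, g (x + fun i => (k i : ℝ)) := by
    rw [continuous_iff_continuousAt]
    intro x
    obtain ⟨u, hu, hub⟩ := hb (‖x‖ + 1)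
    have : ContinuousOn (fun x : Fin n → ℝ => ∑' k : Fin n → ℤ, g (x + fun i => (k i : ℝ)))
        (Metric.ball x 1) := by
      refine continuousOn_tsum (u := u) (fun k => ?_) hu (fun k y hy => hub k y ?_)
      · exact (hc.comp (by fun_prop)).continuousOn
      · have := norm_sub_norm_le y x
        rw [mem_ball_iff_norm] at hy
        linarith
    exact this.continuousAt (Metric.ball_mem_nhds x one_pos)
  let π : C(Fin n → ℝ, UnitAddTorus (Fin n)) :=
    ⟨fun x i => (x i : UnitAddCircle), by
      refine continuous_pi fun i => ?_
      exact (AddCircle.continuous_mk' (1:ℝ)).comp (continuous_apply i)⟩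
  have hπ : Topology.IsQuotientMap π := by
    have : IsOpenQuotientMap (Pi.map (fun (i : Fin n) (x : ℝ) => (x : UnitAddCircle))) :=
      IsOpenQuotientMap.piMap fun i => QuotientAddGroup.isOpenQuotientMap_mk
    exact this.isQuotientMap
  have hfac : Function.FactorsThrough
      (⟨fun x : Fin n → ℝ => ∑' k : Fin n → ℤ, g (x + fun i => (k i : ℝ)), hcont⟩ : C(Fin n → ℝ, ℂ)) π := by
    intro y z hyz
    have h1 : ∀ i, ∃ l : ℤ, (l:ℝ) = z i - y i := by
      intro i
      have := congrFun hyz i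
      have h3 : ((z i - y i : ℝ) : UnitAddCircle) = 0 := by
        rw [AddCircle.coe_sub]; simp only [π, ContinuousMap.coe_mk] at this; rw [this]; simp
      rw [AddCircle.coe_eq_zero_iff] at h3
      obtain ⟨l, hl⟩ := h3
      exact ⟨l, by simpa using hl⟩
    choose l hl using h1
    simp only [ContinuousMap.coe_mk]
    rw [← (Equiv.addRight l).tsum_eq]
    refine tsum_congr fun k => ?_
    congr 1
    ext i
    simp [hl]; ring
  let f : C(UnitAddTorus (Fin n), ℂ) := hπ.lift _ hfac
  have hf : ∀ y : Fin n → ℝ, f (fun i => (y i : UnitAddCircle)) = ∑' k : Fin n → ℤ, g (y + fun i => (k i : ℝ)) := by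
    intro y
    have := Topology.IsQuotientMap.lift_comp hπ _ hfac
    exact DFunLike.congr_fun this y
  have hF : ∀ (m : Fin n → ℤ) (y : Fin n → ℝ), mFourier m (fun i => (y i : UnitAddCircle)) =
      Complex.exp (2 * Real.pi * Complex.I * ∑ i, (m i : ℂ) * (y i : ℂ)) := by
    intro m y
    simp only [mFourier, ContinuousMap.coe_mk, fourier_coe_apply]
    rw [← Complex.exp_sum, Finset.mul_sum]
    congr 1
    refine Finset.sum_congr rfl fun i _ => ?_
    push_cast; ring
  -- the boxes
  let s : (Fin n → ℤ) → Set (Fin n → ℝ) := fun k => {x | ∀ i, x i ∈ Set.Ioc (k i : ℝ) (k i + 1)}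
  have hsm : ∀ k, MeasurableSet (s k) := fun k => by
    have : s k = Set.univ.pi fun i => Set.Ioc (k i : ℝ) (k i + 1) := by ext; simp [s]
    rw [this]; exact MeasurableSet.univ_pi fun i => measurableSet_Ioc
  have hmemk : ∀ k y, y ∈ s k ↔ ∀ i, k i = ⌈y i⌉ - 1 := by
    intro k y
    refine forall_congr' fun i => ?_
    rw [eq_sub_iff_add_eq, eq_comm, Int.ceil_eq_iff]
    simp [Set.mem_Ioc]
  have hdisj : Pairwise (Function.onFun Disjoint s) := by
    intro k l hkl
    rw [Function.onFun, Set.disjoint_left]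
    intro y hy hy'
    rw [hmemk] at hy hy'
    exact hkl (funext fun i => (hy i).trans (hy' i).symm)
  have hU : (⋃ k, s k) = Set.univ := by
    refine Set.eq_univ_of_forall fun y => Set.mem_iUnion.2 ⟨fun i => ⌈y i⌉ - 1, ?_⟩
    rw [hmemk]; intro i; rfl
  have hcoef : ∀ m, mFourierCoeff f m = gh m := by
    intro m
    rw [mFourierCoeff_eq_integral f m 0]
    have hset : {x : Fin n → ℝ | ∀ i, x i ∈ Set.Ioc ((0 : Fin n → ℝ) i) ((0 : Fin n → ℝ) i + 1)} = s 0 := by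
      ext; simp [s]
    rw [hset]
    let E : (Fin n → ℝ) → ℂ := fun x => Complex.exp (-(2 * Real.pi * Complex.I * ∑ i, (m i : ℂ) * (x i : ℂ)))
    have hEc : Continuous E := by
      simp only [E]; fun_prop
    have hEn : ∀ x, ‖E x‖ = 1 := by
      intro x
      have : -(2 * Real.pi * Complex.I * ∑ i, (m i : ℂ) * (x i : ℂ)) =
        ((-(2 * Real.pi * ∑ i, (m i : ℝ) * x i) : ℝ) : ℂ) * Complex.I := by push_cast; ring
      simp only [E]
      rw [this, Complex.norm_exp_ofReal_mul_I]
    have hEp : ∀ (x : Fin n → ℝ) (k : Fin n → ℤ), E (x + fun i => (k i : ℝ)) = E x := by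
      intro x k
      simp only [E]
      have : -(2 * Real.pi * Complex.I * ∑ i, (m i : ℂ) * (((x + fun i => (k i : ℝ)) i : ℝ) : ℂ)) =
        -(2 * Real.pi * Complex.I * ∑ i, (m i : ℂ) * (x i : ℂ)) + ((-∑ i, m i * k i : ℤ) : ℂ) * (2 * Real.pi * Complex.I) := by
        push_cast
        simp only [Pi.add_apply, Complex.ofReal_add, mul_add, Finset.sum_add_distrib, Complex.ofReal_intCast]
        ring
      rw [this, Complex.exp_periodic.int_mul]
    have hEi : Integrable (fun x => E x * g x) := by
      refine hi.bdd_mul (c := 1) hEc.aestronglyMeasurable (Filter.Eventually.of_forall fun x => (hEn x).le)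
    have hsum := hasSum_integral_iUnion (f := fun x => E x * g x) (μ := volume) hsm hdisj (by
      rw [hU]; exact hEi.integrableOn)
    rw [hU, Measure.restrict_univ, hgh m] at hsum
    have hshift : ∀ k, ∫ y in s k, E y * g y = ∫ y in s 0, E y * g (y + fun i => (k i : ℝ)) := by
      intro k
      have := (measurePreserving_add_right (volume : Measure (Fin n → ℝ)) (fun i => (k i : ℝ))).setIntegral_preimage_emb
        (measurableEmbedding_addRight _) (fun y => E y * g y) (s k)
      rw [← this]
      have h0 : (fun x : Fin n → ℝ => x + fun i => (k i : ℝ)) ⁻¹' s k = s 0 := by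
        ext y; simp only [s, Set.mem_preimage, Set.mem_ofPred_eq, Set.mem_Ioc, Pi.add_apply, Pi.zero_apply]
        refine forall_congr' fun i => ?_
        push_cast
        constructor <;> rintro ⟨h1, h2⟩ <;> constructor <;> linarith
      rw [h0]
      refine integral_congr_ae (Filter.Eventually.of_forall fun y => ?_)
      simp only [hEp]
    simp only [hshift] at hsum
    obtain ⟨u, hu, hub⟩ := hb 1
    have hs0 : volume (s 0) < ⊤ := by
      have : s 0 = Set.univ.pi fun i => Set.Ioc (0 : ℝ) (1) := by ext; simp [s]
      rw [this, volume_pi_pi]; simp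
    have hs1 : ∀ y ∈ s 0, ‖y‖ ≤ 1 := by
      intro y hy
      rw [pi_norm_le_iff_of_nonneg zero_le_one]
      intro i
      have := hy i
      simp only [Pi.zero_apply, Int.cast_zero, Set.mem_Ioc] at this
      rw [Real.norm_eq_abs, abs_le]; constructor <;> linarith
    have hsum2 := hasSum_integral_of_dominated_convergence (μ := volume.restrict (s 0))
      (F := fun k y => E y * g (y + fun i => (k i : ℝ))) (f := fun y => E y * ∑' k : Fin n → ℤ, g (y + fun i => (k i : ℝ)))
      (fun k _ => u k) (fun k => ((hEc.mul (hc.comp (by fun_prop))).aestronglyMeasurable))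
      (fun k => (ae_restrict_iff' (hsm 0)).2 (Filter.Eventually.of_forall fun y hy => by
        rw [norm_mul, hEn, one_mul]; exact hub k y (hs1 y hy)))
      (Filter.Eventually.of_forall fun _ => hu)
      (by
        have : IsFiniteMeasure (volume.restrict (s 0)) := ⟨by simpa using hs0⟩
        exact integrable_const _)
      ((ae_restrict_iff' (hsm 0)).2 (Filter.Eventually.of_forall fun y hy => by
        refine HasSum.mul_left _ (Summable.hasSum ?_)
        exact Summable.of_norm_bounded hu (fun k => hub k y (hs1 y hy))))
    have := hsum2.unique hsum
    rw [← this]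
    refine integral_congr_ae (Filter.Eventually.of_forall fun y => ?_)
    simp only [hf, hF, E, smul_eq_mul, Pi.neg_apply, Int.cast_neg, neg_mul, Finset.sum_neg_distrib, mul_neg]
  have hfin := hasSum_mFourier_series_apply_of_summable (f := f)
    (by rw [show mFourierCoeff f = gh from funext hcoef]; exact hs) (fun i => (x i : UnitAddCircle))
  rw [hf] at hfin
  rw [← hfin.tsum_eq]
  refine tsum_congr fun m => ?_
  rw [hcoef, hF, smul_eq_mul]


theorem summable_prod_pi_aux (f : ℤ → ℝ) (h0 : ∀ k, 0 ≤ f k) (hf : Summable f) (n : ℕ) :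
    Summable fun k : Fin n → ℤ => ∏ i, f (k i) := by
  induction n with
  | zero => exact Summable.of_finite
  | succ n ih =>
    rw [← (Fin.consEquiv (fun _ : Fin (n+1) => ℤ)).summable_iff]
    have := Summable.mul_of_nonneg hf ih h0 (fun k => Finset.prod_nonneg fun i _ => h0 _)
    refine this.congr fun p => ?_
    simp [Fin.prod_univ_succ, Fin.consEquiv]

theorem summable_exp_neg_abs : Summable fun k : ℤ => Real.exp (-|(k:ℝ)|) := by
  refine Summable.of_nat_of_neg ?_ ?_
  · simpa using Real.summable_exp_neg_nat
  · simpa using Real.summable_exp_neg_nat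

theorem summable_gauss (n : ℕ) (c C : ℝ) (hc : 0 < c) :
    Summable fun k : Fin n → ℤ => Real.exp (-c * ‖(fun i => (k i : ℝ))‖ ^ 2 + C * ‖(fun i => (k i : ℝ))‖) := by
  have h := (summable_prod_pi_aux _ (fun k => (Real.exp_pos _).le) summable_exp_neg_abs n).mul_left
    (Real.exp ((C + n) ^ 2 / (4 * c)))
  refine Summable.of_nonneg_of_le (fun k => (Real.exp_pos _).le) (fun k => ?_) h
  rw [← Real.exp_sum, ← Real.exp_add, Real.exp_le_exp]
  set v : Fin n → ℝ := fun i => (k i : ℝ) with hv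
  have h1 : ∑ i, |v i| ≤ n * ‖v‖ := by
    calc ∑ i, |v i| ≤ ∑ i : Fin n, ‖v‖ := Finset.sum_le_sum fun i _ => norm_le_pi_norm v i
      _ = n * ‖v‖ := by simp
  have h2 : -c * ‖v‖ ^ 2 + C * ‖v‖ + n * ‖v‖ ≤ (C + n) ^ 2 / (4 * c) := by
    rw [le_div_iff₀ (by positivity)]
    nlinarith [sq_nonneg (2 * c * ‖v‖ - (C + n))]
  have h3 : ∑ i, -|v i| = -∑ i, |v i| := by simp
  simp only [hv] at h3 h1 h2 ⊢
  rw [h3]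
  linarith

structure EUM {n : ℕ} (G : Matrix (Fin n) (Fin n) ℤ) : Prop where
  symm : Gᵀ = G
  pos : ∀ x : Fin n → ℤ, x ≠ 0 → 0 < x ⬝ᵥ (G *ᵥ x)
  even : ∀ x : Fin n → ℤ, Even (x ⬝ᵥ (G *ᵥ x))
  unit : IsUnit G.det

theorem EUM.posDef {n : ℕ} {G : Matrix (Fin n) (Fin n) ℤ} (h : EUM G) :
    (G.map (Int.cast : ℤ → ℝ)).PosDef := by
  have hps : (G.map (Int.cast : ℤ → ℝ)).PosSemidef := by
    refine PosSemidef.of_dotProduct_mulVec_nonneg ?_ ?_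
    · rw [IsHermitian, conjTranspose_eq_transpose_of_trivial, ← transpose_map, h.symm]
    · intro x
      have hcl : IsClosed {x : Fin n → ℝ | 0 ≤ star x ⬝ᵥ ((G.map (Int.cast : ℤ → ℝ)) *ᵥ x)} := by
        refine isClosed_le continuous_const ?_
        simp only [star_trivial, dotProduct, mulVec]
        fun_prop
      have hd : DenseRange (Pi.map (fun (_ : Fin n) (r : ℚ) => (r : ℝ))) :=
        DenseRange.piMap fun _ => Rat.denseRange_cast
      refine hd.induction_on x hcl (fun r => ?_)
      -- clear denominators
      let d : ℤ := ∏ i, ((r i).den : ℤ)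
      have hdpos : (0:ℤ) < d := Finset.prod_pos fun i _ => by exact_mod_cast (r i).pos
      have hz : ∀ i, ∃ z : ℤ, (z : ℝ) = d * (r i : ℝ) := by
        intro i
        refine ⟨(∏ j ∈ Finset.univ.erase i, ((r j).den : ℤ)) * (r i).num, ?_⟩
        have h1 : d = (∏ j ∈ Finset.univ.erase i, ((r j).den : ℤ)) * (r i).den := by
          rw [mul_comm]; exact (Finset.mul_prod_erase _ _ (Finset.mem_univ i)).symm
        have h2 : ((r i).num : ℝ) = (r i).den * (r i : ℝ) := by
          have := Rat.mul_den_eq_num (r i)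
          rw [mul_comm]
          exact_mod_cast this.symm
        rw [h1]
        push_cast
        rw [h2]; ring
      choose z hz using hz
      have hq : ((z ⬝ᵥ (G *ᵥ z) : ℤ) : ℝ) = d ^ 2 * (star (Pi.map (fun (_ : Fin n) (r : ℚ) => (r : ℝ)) r) ⬝ᵥ ((G.map (Int.cast : ℤ → ℝ)) *ᵥ (Pi.map (fun (_ : Fin n) (r : ℚ) => (r : ℝ)) r))) := by
        simp only [star_trivial, dotProduct, mulVec, Int.cast_sum, Int.cast_mul, Finset.mul_sum, hz, map_apply, Pi.map_apply]
        refine Finset.sum_congr rfl fun i _ => Finset.sum_congr rfl fun j _ => ?_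
        ring
      have hge : (0:ℝ) ≤ ((z ⬝ᵥ (G *ᵥ z) : ℤ) : ℝ) := by
        by_cases hz0 : z = 0
        · simp [hz0]
        · exact_mod_cast (h.pos z hz0).le
      rw [hq] at hge
      have hd2 : (0:ℝ) < (d:ℝ) ^ 2 := by positivity
      exact nonneg_of_mul_nonneg_right hge hd2
  rw [hps.posDef_iff_det_ne_zero]
  have : (G.map (Int.cast : ℤ → ℝ)).det = ((G.det : ℤ) : ℝ) := (Int.cast_det G).symm
  rw [this]
  exact_mod_cast h.unit.ne_zero

open scoped MatrixOrder in
theorem EUM.factor {n : ℕ} {G : Matrix (Fin n) (Fin n) ℤ} (h : EUM G) :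
    ∃ B : Matrix (Fin n) (Fin n) ℝ, G.map (Int.cast : ℤ → ℝ) = Bᵀ * B ∧ |B.det| = 1 := by
  obtain ⟨B, hB⟩ := CStarAlgebra.nonneg_iff_eq_star_mul_self.mp h.posDef.posSemidef.nonneg
  rw [star_eq_conjTranspose, conjTranspose_eq_transpose_of_trivial] at hB
  refine ⟨B, hB, ?_⟩
  have h1 : (G.map (Int.cast : ℤ → ℝ)).det = ((G.det : ℤ) : ℝ) := (Int.cast_det G).symm
  have h2 := congrArg det hB
  rw [h1, det_mul, det_transpose] at h2
  have h3 : |((G.det : ℤ) : ℝ)| = 1 := by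
    have := Int.isUnit_iff_abs_eq.1 h.unit
    exact_mod_cast this
  rw [h2, abs_mul_self] at h3
  have : |B.det| ^ 2 = 1 := by rw [sq_abs, sq, h3]
  nlinarith [abs_nonneg B.det]

section
variable {n : ℕ}
/-- real quadratic form -/
noncomputable def QB (B : Matrix (Fin n) (Fin n) ℝ) (x : Fin n → ℝ) : ℝ := ∑ i, (B *ᵥ x) i ^ 2

theorem QB_lower (B : Matrix (Fin n) (Fin n) ℝ) (hB : |B.det| = 1) :
    ∃ δ > 0, ∀ x, δ * ‖x‖ ^ 2 ≤ QB B x := by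
  have hu : IsUnit B.det := by
    rw [isUnit_iff_ne_zero]; intro h; rw [h] at hB; simp at hB
  let L := (Matrix.toLin' B⁻¹).toContinuousLinearMap
  have h1 : ∀ x : Fin n → ℝ, ‖x‖ ≤ (‖L‖ + 1) * ‖B *ᵥ x‖ := by
    intro x
    have h2 := L.le_opNorm (B *ᵥ x)
    have h3 : L (B *ᵥ x) = x := by
      simp [L, Matrix.toLin'_apply, mulVec_mulVec, nonsing_inv_mul _ hu]
    rw [h3] at h2
    nlinarith [norm_nonneg (B *ᵥ x)]
  have h2 : ∀ y : Fin n → ℝ, ‖y‖ ^ 2 ≤ ∑ i, y i ^ 2 := by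
    intro y
    have : ‖y‖ ≤ Real.sqrt (∑ i, y i ^ 2) := by
      rw [pi_norm_le_iff_of_nonneg (Real.sqrt_nonneg _)]
      intro i
      refine Real.le_sqrt_of_sq_le ?_
      rw [Real.norm_eq_abs, sq_abs]
      exact Finset.single_le_sum (f := fun i => y i ^ 2) (fun i _ => sq_nonneg _) (Finset.mem_univ i)
    calc ‖y‖ ^ 2 ≤ (Real.sqrt (∑ i, y i ^ 2)) ^ 2 := by gcongr
      _ = _ := Real.sq_sqrt (Finset.sum_nonneg fun i _ => sq_nonneg _)
  refine ⟨((‖L‖ + 1) ^ 2)⁻¹, by positivity, fun x => ?_⟩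
  rw [inv_mul_le_iff₀ (by positivity)]
  calc ‖x‖ ^ 2 ≤ ((‖L‖ + 1) * ‖B *ᵥ x‖) ^ 2 := by gcongr; exact h1 x
    _ = (‖L‖ + 1) ^ 2 * ‖B *ᵥ x‖ ^ 2 := by ring
    _ ≤ _ := by gcongr; exact h2 _

open MeasureTheory in
theorem poissonTheta {G : Matrix (Fin n) (Fin n) ℤ} (hG : EUM G) (B : Matrix (Fin n) (Fin n) ℝ)
    (hGB : G.map (Int.cast : ℤ → ℝ) = Bᵀ * B) (hB : |B.det| = 1) (t : ℂ) (ht : 0 < t.re)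
    (x : Fin n → ℝ) :
    ∑' k : Fin n → ℤ, Complex.exp (-(Real.pi * t * (QB B (x + fun i => (k i : ℝ)) : ℂ))) =
      (1 / t) ^ ((n : ℂ) / 2) * ∑' k : Fin n → ℤ,
        Complex.exp (-(Real.pi / t * (QB B (fun i => (k i : ℝ)) : ℂ)) +
          2 * Real.pi * Complex.I * (((B *ᵥ fun i => (k i : ℝ)) ⬝ᵥ (B *ᵥ x) : ℝ) : ℂ)) := by
  have hu : IsUnit B.det := by
    rw [isUnit_iff_ne_zero]; intro h; rw [h] at hB; simp at hB
  have ht0 : t ≠ 0 := by rintro rfl; simp at ht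
  have hpi : (Real.pi : ℂ) ≠ 0 := by exact_mod_cast Real.pi_ne_zero
  obtain ⟨δ, hδ, hδ'⟩ := QB_lower B hB
  have htinv : 0 < (1 / t).re := by
    rw [one_div, Complex.inv_re]; exact div_pos ht (Complex.normSq_pos.2 ht0)
  have hmp : MeasurePreserving (Matrix.toLin' B) (volume : Measure (Fin n → ℝ)) volume := by
    refine ⟨(LinearMap.continuous_of_finiteDimensional _).measurable, ?_⟩
    rw [Real.map_matrix_volume_pi_eq_smul_volume_pi hu.ne_zero, abs_inv, hB]; simp
  have hemb : MeasurableEmbedding (Matrix.toLin' B) := by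
    have hinj : Function.Injective (Matrix.toLin' B) := by
      rw [Matrix.toLin'_apply']; exact mulVec_injective_of_isUnit ((isUnit_iff_isUnit_det _).2 hu)
    exact (LinearMap.continuous_of_finiteDimensional _).measurableEmbedding hinj
  let g : (Fin n → ℝ) → ℂ := fun x => Complex.exp (-(Real.pi * t * (QB B x : ℂ)))
  let gh : (Fin n → ℤ) → ℂ := fun m => (1 / t) ^ ((n : ℂ) / 2) *
    Complex.exp (-(Real.pi / t * ((∑ i, (B⁻¹ᵀ *ᵥ fun i => (m i : ℝ)) i ^ 2 : ℝ) : ℂ)))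
  have hQc : Continuous (QB B) := by
    unfold QB; simp only [mulVec, dotProduct]; fun_prop
  have hgc : Continuous g := by simp only [g]; fun_prop
  have hpt : 0 < (Real.pi * t : ℂ).re := by
    rw [Complex.re_ofReal_mul]; exact mul_pos Real.pi_pos ht
  have hgeq : ∀ (c : Fin n → ℂ) (y : Fin n → ℝ), Complex.exp (∑ i, c i * ((B *ᵥ y) i : ℂ)) * g y =
     Complex.exp (-(Real.pi * t) * ∑ i, (((Matrix.toLin' B y) i : ℝ) : ℂ) ^ 2 + ∑ i, c i * (((Matrix.toLin' B y) i : ℝ) : ℂ)) := by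
    intro c y
    simp only [g, QB, Matrix.toLin'_apply]
    rw [← Complex.exp_add]
    congr 1
    push_cast
    ring
  have hgi : Integrable g := by
    have h1 := GaussianFourier.integrable_cexp_neg_mul_sum_add (ι := Fin n) hpt 0
    have h2 := (hmp.integrable_comp_emb hemb).2 h1
    refine h2.congr (Filter.Eventually.of_forall fun y => ?_)
    have := hgeq 0 y
    simp only [Pi.zero_apply, zero_mul, Finset.sum_const_zero, Complex.exp_zero, one_mul] at this
    rw [this]
    simp
  have hgn : ∀ y, ‖g y‖ = Real.exp (-(Real.pi * t.re * QB B y)) := by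
    intro y; simp only [g, Complex.norm_exp]
    congr 1
    rw [Complex.neg_re, Complex.re_mul_ofReal, Complex.re_ofReal_mul]
  have hbij : Function.Bijective (fun k : Fin n → ℤ => G *ᵥ k) :=
    (Matrix.toLinearEquiv' G (invertibleOfIsUnitDet G hG.unit)).bijective
  let eG : (Fin n → ℤ) ≃ (Fin n → ℤ) := Equiv.ofBijective _ hbij
  have heG : ∀ k : Fin n → ℤ, (fun i => ((eG k i : ℤ) : ℝ)) = Bᵀ *ᵥ (B *ᵥ fun i => (k i : ℝ)) := by
    intro k
    rw [mulVec_mulVec, ← hGB]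
    ext i
    simp [eG, mulVec, dotProduct]
  have hBB : ∀ k : Fin n → ℤ, B⁻¹ᵀ *ᵥ (fun i => ((eG k i : ℤ) : ℝ)) = B *ᵥ fun i => (k i : ℝ) := by
    intro k
    rw [heG, mulVec_mulVec, ← transpose_mul, mul_nonsing_inv _ hu, transpose_one, one_mulVec]
  have hghk : ∀ k, gh (eG k) = (1 / t) ^ ((n : ℂ) / 2) *
      Complex.exp (-(Real.pi / t * (QB B (fun i => (k i : ℝ)) : ℂ))) := by
    intro k
    simp only [gh]
    rw [hBB]; rfl
  have hgs : Summable gh := by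
    rw [← eG.summable_iff]
    have : (gh ∘ eG) = fun k => (1 / t) ^ ((n : ℂ) / 2) *
      Complex.exp (-(Real.pi / t * (QB B (fun i => (k i : ℝ)) : ℂ))) := funext hghk
    rw [this]
    refine Summable.mul_left _ ?_
    refine Summable.of_norm_bounded (summable_gauss n (Real.pi * (1/t).re * δ) 0 (by positivity)) (fun k => ?_)
    rw [Complex.norm_exp, Real.exp_le_exp, Complex.neg_re, Complex.re_mul_ofReal,
      div_eq_mul_one_div, Complex.re_ofReal_mul]
    have := hδ' (fun i => (k i : ℝ))
    have h3 : 0 < Real.pi * (1/t).re := by positivity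
    nlinarith
  have main := poissonGen g hgc hgi (fun R => ?_) gh hgs (fun m => ?_) x
  · rw [main, ← eG.tsum_eq, ← tsum_mul_left]
    refine tsum_congr fun k => ?_
    rw [hghk, mul_assoc, ← Complex.exp_add]
    congr 4
    have h5 : (fun i => ((eG k i : ℤ) : ℝ)) ⬝ᵥ x = (B *ᵥ fun i => (k i : ℝ)) ⬝ᵥ (B *ᵥ x) := by
      rw [heG, mulVec_transpose, ← dotProduct_mulVec]
    rw [← h5]
    simp [dotProduct]
  · refine ⟨fun k => Real.exp (Real.pi * t.re * δ * |R| ^ 2) * Real.exp (-(Real.pi * t.re * δ / 2) * ‖(fun i => (k i : ℝ))‖ ^ 2 + 0 * ‖(fun i => (k i : ℝ))‖),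
      (summable_gauss n _ 0 (by positivity)).mul_left _, fun k y hy => ?_⟩
    beta_reduce
    rw [hgn, ← Real.exp_add, Real.exp_le_exp]
    have h1 := hδ' (y + fun i => (k i : ℝ))
    have h2 : ‖(fun i => (k i : ℝ))‖ ≤ ‖y + (fun i => (k i : ℝ))‖ + ‖y‖ := by
      have := norm_sub_le (y + (fun i => (k i : ℝ))) y
      simpa using this
    have h3 : ‖(fun i => (k i : ℝ))‖ ^ 2 ≤ 2 * ‖y + (fun i => (k i : ℝ))‖ ^ 2 + 2 * |R| ^ 2 := by
      have h4 : ‖y‖ ^ 2 ≤ |R| ^ 2 := by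
        gcongr; exact hy.trans (le_abs_self R)
      have h5 := norm_nonneg (fun i => (k i : ℝ))
      nlinarith [sq_nonneg (‖y + (fun i => (k i : ℝ))‖ - ‖y‖)]
    have h6 : 0 < Real.pi * t.re := by positivity
    have h7 : δ / 2 * ‖(fun i => (k i : ℝ))‖ ^ 2 - δ * |R| ^ 2 ≤ QB B (y + fun i => (k i : ℝ)) := by
      nlinarith
    nlinarith [mul_le_mul_of_nonneg_left h7 h6.le]
  · let c : Fin n → ℂ := fun i => -(2 * Real.pi * Complex.I) * ((B⁻¹ᵀ *ᵥ fun i => (m i : ℝ)) i : ℂ)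
    have h1 : ∀ y : Fin n → ℝ, Complex.exp (-(2 * Real.pi * Complex.I * ∑ i, (m i : ℂ) * (y i : ℂ))) * g y =
      Complex.exp (-(Real.pi * t) * ∑ i, (((Matrix.toLin' B y) i : ℝ) : ℂ) ^ 2 + ∑ i, c i * (((Matrix.toLin' B y) i : ℝ) : ℂ)) := by
      intro y
      rw [← hgeq]
      congr 2
      have h5 : (fun i => (m i : ℝ)) ⬝ᵥ y = (B⁻¹ᵀ *ᵥ fun i => (m i : ℝ)) ⬝ᵥ (B *ᵥ y) := by
        rw [mulVec_transpose, ← dotProduct_mulVec, mulVec_mulVec, nonsing_inv_mul _ hu, one_mulVec]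
      have h6 := congrArg (fun r : ℝ => (r : ℂ)) h5
      simp only [dotProduct, Complex.ofReal_sum, Complex.ofReal_mul, Complex.ofReal_intCast] at h6
      rw [h6]
      simp only [c]
      rw [← neg_mul, Finset.mul_sum]
      refine Finset.sum_congr rfl fun i _ => by ring
    simp only [h1]
    rw [hmp.integral_comp hemb (fun y : Fin n → ℝ => Complex.exp (-(Real.pi * t) * ∑ i, ((y i : ℝ) : ℂ) ^ 2 + ∑ i, c i * ((y i : ℝ) : ℂ)))]
    rw [GaussianFourier.integral_cexp_neg_mul_sum_add hpt]
    simp only [gh, c]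
    have h7 : (Real.pi / (Real.pi * t) : ℂ) = 1 / t := by field_simp
    rw [h7, Fintype.card_fin]
    congr 2
    push_cast
    simp only [mul_pow, neg_sq, Complex.I_sq]
    rw [← Finset.mul_sum]
    field_simp
    ring
end


section MF
open UpperHalfPlane hiding I
open ModularForm MatrixGroups SlashInvariantForm Complex

theorem mkMF (k : ℤ) (f : ℂ → ℂ) (hd : DifferentiableOn ℂ f {z | 0 < z.im}) (c : ℕ → ℂ)
    (hsum : ∀ τ : ℍ, HasSum (fun m => c m * cexp (2 * Real.pi * I * τ) ^ m) (f τ))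
    (hS : ∀ τ : ℍ, f (-1 / (τ : ℂ)) = (τ : ℂ) ^ k * f τ) :
    ∃ F : ModularForm 𝒮ℒ k, ∀ m, (qExpansion 1 F).coeff m = c m := by
  let g : ℍ → ℂ := fun τ => f τ
  have hS' : g ∣[k] ModularGroup.S = g := by
    ext z
    rw [SL_slash_apply, UpperHalfPlane.modular_S_smul]
    have h := hS z
    have hz := z.ne_zero
    have h2 : f (-(z:ℂ)⁻¹) = (z : ℂ) ^ k * f z := by rw [← h]; congr 1; field_simp
    have hden : denom (ModularGroup.S : GL (Fin 2) ℝ) z = z := by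
      rw [ModularGroup.denom_S]
    change f _ * denom (ModularGroup.S : GL (Fin 2) ℝ) z ^ (-k) = f z
    rw [hden]
    have h3 : ((UpperHalfPlane.mk (-(z:ℂ))⁻¹ z.im_inv_neg_coe_pos : ℍ) : ℂ) = -(z:ℂ)⁻¹ := by
      simp [inv_neg]
    rw [h3, h2, _root_.zpow_neg]
    field_simp
  have hT' : g ∣[k] ModularGroup.T = g := by
    ext z
    rw [SL_slash_apply, UpperHalfPlane.modular_T_smul]
    have h1 := hsum ((1 : ℝ) +ᵥ z)
    have h2 : cexp (2 * Real.pi * I * (((1:ℝ) +ᵥ z : ℍ) : ℂ)) = cexp (2 * Real.pi * I * z) := by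
      rw [UpperHalfPlane.coe_vadd, mul_add, Complex.exp_add]
      simp [Complex.exp_two_pi_mul_I]
    rw [h2] at h1
    have h3 := h1.unique (hsum z)
    have h4 : g ((1:ℝ) +ᵥ z) = g z := h3
    have hden : denom (ModularGroup.T : GL (Fin 2) ℝ) z = 1 := by
      simp [denom, ModularGroup.coe_T]
    rw [h4]
    change g z * denom (ModularGroup.T : GL (Fin 2) ℝ) z ^ (-k) = g z
    rw [hden, _root_.one_zpow, mul_one]
  have hsum' : ∀ τ : ℍ, HasSum (fun m => c m • (Function.Periodic.qParam (1:ℝ) τ) ^ m) (g τ) := by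
    intro τ
    simpa [Function.Periodic.qParam, smul_eq_mul] using hsum τ
  let F : ModularForm 𝒮ℒ k :=
  { toFun := g
    slash_action_eq' := fun A hA => by
      obtain ⟨A, rfl⟩ := hA
      exact slash_action_generators_SL2Z hS' hT' A
    holo' := by
      rw [UpperHalfPlane.mdifferentiable_iff]
      refine hd.congr fun z hz => ?_
      simp [g, ofComplex_apply_of_im_pos hz]
    bdd_at_cusps' := fun {c} hc => by
      rw [Subgroup.IsArithmetic.isCusp_iff_isCusp_SL2Z] at hc
      rw [OnePoint.isBoundedAt_iff_forall_SL2Z hc]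
      intro γ _
      simp only [slash_action_generators_SL2Z hS' hT']
      exact isBoundedAtImInfty_of_hasSum_qExpansion one_pos hsum' }
  refine ⟨F, fun m => (ModularFormClass.qExpansion_coeff_unique (f := F) one_pos one_mem_strictPeriods_SL hsum' m).symm⟩

theorem mf_unique {k : ℕ} (F H : ModularForm 𝒮ℒ (k : ℤ))
    (h : ∀ m ≤ k / 12, (qExpansion 1 F).coeff m = (qExpansion 1 H).coeff m) : F = H := by
  rw [← sub_eq_zero]
  apply sturm_bound_levelOne_nat
  refine lt_of_lt_of_le (b := ((k/12 + 1 : ℕ) : ℕ∞)) (by exact_mod_cast Nat.lt_succ_self _) ?_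
  refine PowerSeries.nat_le_order _ _ fun i hi => ?_
  rw [FunLike.coe_sub, ModularForm.qExpansion_sub one_pos one_mem_strictPeriods_SL, map_sub, h i (by omega), sub_self]

open EisensteinSeries
theorem bern4 : bernoulli 4 = -1/30 := by
  rw [bernoulli_eq_bernoulli'_of_ne_one (by norm_num), bernoulli'_four]
theorem bern6 : bernoulli 6 = 1/42 := by
  rw [bernoulli_eq_bernoulli'_of_ne_one (by norm_num)]
  rw [bernoulli'_def]
  have h5 : bernoulli' 5 = 0 := bernoulli'_eq_zero_of_odd (by decide) (by norm_num)
  norm_num [Finset.sum_range_succ, bernoulli'_zero, bernoulli'_one, bernoulli'_two, bernoulli'_three, bernoulli'_four, h5, Nat.choose]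

theorem wt4_coeff (F : ModularForm 𝒮ℒ (4 : ℤ)) (h0 : (qExpansion 1 F).coeff 0 = 1) :
    (qExpansion 1 F).coeff 1 = 240 ∧ (qExpansion 1 F).coeff 2 = 2160 := by
  have hF : F = E (k := 4) (by norm_num) := by
    refine mf_unique (k := 4) F (E (k := 4) (by norm_num)) fun m hm => ?_
    obtain rfl : m = 0 := by omega
    rw [h0, E_qExpansion_coeff_zero _ ⟨2, rfl⟩]
  rw [hF]
  have e := E_qExpansion_coeff (k := 4) (by norm_num) ⟨2, rfl⟩
  have s1 : ArithmeticFunction.sigma 3 1 = 1 := by decide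
  have s2 : ArithmeticFunction.sigma 3 2 = 9 := by decide
  constructor
  · refine (e 1).trans ?_; norm_num [bern4, s1]
  · refine (e 2).trans ?_; norm_num [bern4, s2]

theorem e4_coeffs : let f := qExpansion 1 (E (k := 4) (by norm_num)); f.coeff 0 = 1 ∧ f.coeff 1 = 240
    ∧ f.coeff 2 = 2160 ∧ f.coeff 3 = 6720 ∧ f.coeff 4 = 17520 := by
  have e := E_qExpansion_coeff (k := 4) (by norm_num) ⟨2, rfl⟩
  have s1 : ArithmeticFunction.sigma 3 1 = 1 := by decide
  have s2 : ArithmeticFunction.sigma 3 2 = 9 := by decide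
  have s3 : ArithmeticFunction.sigma 3 3 = 28 := by decide
  have s4 : ArithmeticFunction.sigma 3 4 = 73 := by decide
  refine ⟨(e 0).trans (by simp), (e 1).trans ?_, (e 2).trans ?_, (e 3).trans ?_, (e 4).trans ?_⟩
  · norm_num [bern4, s1]
  · norm_num [bern4, s2]
  · norm_num [bern4, s3]
  · norm_num [bern4, s4]

theorem e6_coeffs : let f := qExpansion 1 (E (k := 6) (by norm_num)); f.coeff 0 = 1 ∧ f.coeff 1 = -504
    ∧ f.coeff 2 = -16632 ∧ f.coeff 3 = -122976 ∧ f.coeff 4 = -532728 := by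
  have e := E_qExpansion_coeff (k := 6) (by norm_num) ⟨3, rfl⟩
  have s1 : ArithmeticFunction.sigma 5 1 = 1 := by decide
  have s2 : ArithmeticFunction.sigma 5 2 = 33 := by decide
  have s3 : ArithmeticFunction.sigma 5 3 = 244 := by decide
  have s4 : ArithmeticFunction.sigma 5 4 = 1057 := by decide
  refine ⟨(e 0).trans (by simp), (e 1).trans ?_, (e 2).trans ?_, (e 3).trans ?_, (e 4).trans ?_⟩
  · norm_num [bern6, s1]
  · norm_num [bern6, s2]
  · norm_num [bern6, s3]
  · norm_num [bern6, s4]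

theorem wt8_coeff (F : ModularForm 𝒮ℒ (8 : ℤ)) (h0 : (qExpansion 1 F).coeff 0 = 1) :
    (qExpansion 1 F).coeff 1 = 480 := by
  obtain ⟨a0, a1, -⟩ := e4_coeffs
  let H : ModularForm 𝒮ℒ (8 : ℤ) := ModularForm.mcast (by decide) ((E (k := 4) (by norm_num)).pow 2)
  have hq : qExpansion 1 H = qExpansion 1 (E (k := 4) (by norm_num)) ^ 2 := by
    simp only [H, coe_mcast, ModularForm.qExpansion_pow one_pos one_mem_strictPeriods_SL]
  have hF : F = H := by
    refine mf_unique (k := 8) F H fun m hm => ?_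
    obtain rfl : m = 0 := by omega
    rw [h0, hq, pow_two, PowerSeries.coeff_mul]
    simp [Finset.Nat.antidiagonal_succ, a0, -PowerSeries.coeff_zero_eq_constantCoeff]
  rw [hF, hq, pow_two, PowerSeries.coeff_mul]
  norm_num [Finset.Nat.antidiagonal_succ, a0, a1, -PowerSeries.coeff_zero_eq_constantCoeff]

theorem wt10_coeff (F : ModularForm 𝒮ℒ (10 : ℤ)) (h0 : (qExpansion 1 F).coeff 0 = 0) :
    (qExpansion 1 F).coeff 1 = 0 := by
  have hF : F = 0 := by
    refine mf_unique (k := 10) F 0 fun m hm => ?_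
    obtain rfl : m = 0 := by omega
    rw [h0]; simp [qExpansion_zero]
  rw [hF]; simp [qExpansion_zero]

theorem wt12_coeff (F : ModularForm 𝒮ℒ (12 : ℤ)) (h0 : (qExpansion 1 F).coeff 0 = 1)
    (h1 : (qExpansion 1 F).coeff 1 = 0) :
    (qExpansion 1 F).coeff 2 = 196560 ∧ (qExpansion 1 F).coeff 3 = 16773120 ∧
    (qExpansion 1 F).coeff 4 = 398034000 := by
  obtain ⟨a0, a1, a2, a3, a4⟩ := e4_coeffs
  obtain ⟨b0, b1, b2, b3, b4⟩ := e6_coeffs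
  let E4 := E (k := 4) (by norm_num)
  let E6 := E (k := 6) (by norm_num)
  let H : ModularForm 𝒮ℒ (12 : ℤ) := (7/12 : ℂ) • ModularForm.mcast (by decide) (E4.pow 3) +
    (5/12 : ℂ) • ModularForm.mcast (by decide) (E6.pow 2)
  have hq : qExpansion 1 H = (7/12 : ℂ) • (qExpansion 1 E4 * (qExpansion 1 E4 * qExpansion 1 E4)) +
      (5/12 : ℂ) • (qExpansion 1 E6 * qExpansion 1 E6) := by
    have hc : (H : ℍ → ℂ) = ⇑((7/12 : ℂ) • (ModularForm.mcast (by decide) (E4.pow 3) : ModularForm 𝒮ℒ (12 : ℤ))) +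
      ⇑((5/12 : ℂ) • (ModularForm.mcast (by decide) (E6.pow 2) : ModularForm 𝒮ℒ (12 : ℤ))) := rfl
    rw [hc, ModularForm.qExpansion_add one_pos one_mem_strictPeriods_SL]
    rw [FunLike.coe_smul, FunLike.coe_smul, ModularForm.qExpansion_smul one_pos one_mem_strictPeriods_SL, ModularForm.qExpansion_smul one_pos one_mem_strictPeriods_SL]
    simp only [coe_mcast, ModularForm.qExpansion_pow one_pos one_mem_strictPeriods_SL]
    rw [pow_two, pow_succ, pow_two, mul_assoc]
  have hF : F = H := by
    refine mf_unique (k := 12) F H fun m hm => ?_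
    have : m = 0 ∨ m = 1 := by omega
    rcases this with rfl | rfl
    · rw [h0, hq]
      simp only [map_add, PowerSeries.coeff_smul, PowerSeries.coeff_mul]
      norm_num [Finset.Nat.antidiagonal_succ, E4, E6, a0, b0, -PowerSeries.coeff_zero_eq_constantCoeff]
    · rw [h1, hq]
      simp only [map_add, PowerSeries.coeff_smul, PowerSeries.coeff_mul]
      norm_num [Finset.Nat.antidiagonal_succ, E4, E6, a0, b0, a1, b1, PowerSeries.coeff_mul, -PowerSeries.coeff_zero_eq_constantCoeff]
  rw [hF, hq]
  simp only [map_add, PowerSeries.coeff_smul, PowerSeries.coeff_mul]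
  norm_num [Finset.Nat.antidiagonal_succ, E4, E6, a0, b0, a1, b1, a2, b2, a3, b3, a4, b4, PowerSeries.coeff_mul, -PowerSeries.coeff_zero_eq_constantCoeff]
end MF


section Theta
open Complex

noncomputable def nz {n : ℕ} (k : Fin n → ℤ) : ℝ := ‖(fun i => (k i : ℝ))‖

theorem QB_int {n : ℕ} {G : Matrix (Fin n) (Fin n) ℤ} {B : Matrix (Fin n) (Fin n) ℝ}
    (hGB : G.map (Int.cast : ℤ → ℝ) = Bᵀ * B) (k : Fin n → ℤ) :
    QB B (fun i => (k i : ℝ)) = ((k ⬝ᵥ (G *ᵥ k) : ℤ) : ℝ) := by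
  have h1 : QB B (fun i => (k i : ℝ)) = (B *ᵥ (fun i => (k i : ℝ))) ⬝ᵥ (B *ᵥ (fun i => (k i : ℝ))) := by
    simp only [QB, dotProduct, pow_two]
  rw [h1, Matrix.dotProduct_mulVec, ← Matrix.mulVec_transpose, Matrix.mulVec_mulVec, ← hGB]
  simp [dotProduct, mulVec, Finset.sum_mul, Finset.mul_sum]
  refine Finset.sum_congr rfl fun i _ => Finset.sum_congr rfl fun j _ => ?_
  ring

theorem q_lower {n : ℕ} {G : Matrix (Fin n) (Fin n) ℤ} (hG : EUM G) :
    ∃ δ > 0, ∀ k : Fin n → ℤ, δ * nz k ^ 2 ≤ ((k ⬝ᵥ (G *ᵥ k) : ℤ) : ℝ) := by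
  obtain ⟨B, hGB, hB⟩ := hG.factor
  obtain ⟨δ, hδ, h⟩ := QB_lower B hB
  exact ⟨δ, hδ, fun k => by rw [← QB_int hGB]; exact h _⟩

noncomputable def th {n : ℕ} (G : Matrix (Fin n) (Fin n) ℤ) (p : (Fin n → ℤ) → ℂ) (z : ℂ) : ℂ :=
  ∑' k : Fin n → ℤ, p k * cexp (Real.pi * I * z * ((k ⬝ᵥ (G *ᵥ k) : ℤ) : ℂ))

theorem th_norm {n : ℕ} (G : Matrix (Fin n) (Fin n) ℤ) (z : ℂ) (k : Fin n → ℤ) :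
    ‖cexp (Real.pi * I * z * ((k ⬝ᵥ (G *ᵥ k) : ℤ) : ℂ))‖ =
      Real.exp (-(Real.pi * z.im) * ((k ⬝ᵥ (G *ᵥ k) : ℤ) : ℝ)) := by
  rw [Complex.norm_exp]
  congr 1
  simp

theorem th_bound {n : ℕ} {G : Matrix (Fin n) (Fin n) ℤ} {p : (Fin n → ℤ) → ℂ} {K C δ ε : ℝ}
    (hp : ∀ k, ‖p k‖ ≤ K * Real.exp (C * nz k)) (hδ : 0 < δ)
    (hq : ∀ k : Fin n → ℤ, δ * nz k ^ 2 ≤ ((k ⬝ᵥ (G *ᵥ k) : ℤ) : ℝ))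
    (hε : 0 < ε) (z : ℂ) (hz : ε ≤ z.im) (k : Fin n → ℤ) :
    ‖p k * cexp (Real.pi * I * z * ((k ⬝ᵥ (G *ᵥ k) : ℤ) : ℂ))‖ ≤
      K * Real.exp (-(Real.pi * ε * δ) * nz k ^ 2 + C * nz k) := by
  rw [norm_mul, th_norm, add_comm, Real.exp_add, ← mul_assoc]
  refine mul_le_mul (hp k) ?_ (Real.exp_nonneg _) (le_trans (norm_nonneg _) (hp k))
  rw [Real.exp_le_exp]
  have h0 : 0 ≤ nz k ^ 2 := by positivity
  have h1 : ε * (δ * nz k ^ 2) ≤ z.im * ((k ⬝ᵥ (G *ᵥ k) : ℤ) : ℝ) := by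
    refine mul_le_mul hz (hq k) (by positivity) (by linarith)
  nlinarith [Real.pi_pos]

theorem th_summable {n : ℕ} {G : Matrix (Fin n) (Fin n) ℤ} (hG : EUM G) {p : (Fin n → ℤ) → ℂ} {K C : ℝ}
    (hp : ∀ k, ‖p k‖ ≤ K * Real.exp (C * nz k)) (z : ℂ) (hz : 0 < z.im) :
    Summable fun k : Fin n → ℤ => p k * cexp (Real.pi * I * z * ((k ⬝ᵥ (G *ᵥ k) : ℤ) : ℂ)) := by
  obtain ⟨δ, hδ, hq⟩ := q_lower hG
  refine Summable.of_norm_bounded ((summable_gauss n (Real.pi * z.im * δ) C (by positivity)).mul_left K) fun k => ?_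
  exact th_bound hp hδ hq hz z le_rfl k

theorem th_diff {n : ℕ} {G : Matrix (Fin n) (Fin n) ℤ} (hG : EUM G) {p : (Fin n → ℤ) → ℂ} {K C : ℝ}
    (hp : ∀ k, ‖p k‖ ≤ K * Real.exp (C * nz k)) : DifferentiableOn ℂ (th G p) {z | 0 < z.im} := by
  obtain ⟨δ, hδ, hq⟩ := q_lower hG
  intro z hz
  have hz' : 0 < z.im := hz
  have ho : IsOpen {w : ℂ | z.im / 2 < w.im} := isOpen_lt continuous_const Complex.continuous_im
  have hd : DifferentiableOn ℂ (th G p) {w : ℂ | z.im / 2 < w.im} := by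
    refine differentiableOn_tsum_of_summable_norm
      ((summable_gauss n (Real.pi * (z.im/2) * δ) C (by positivity)).mul_left K) ?_ ho ?_
    · intro k
      fun_prop
    · intro k w hw
      exact th_bound hp hδ hq (half_pos hz') w (le_of_lt hw) k
  exact (hd.differentiableAt (ho.mem_nhds (by change z.im / 2 < z.im; linarith))).differentiableWithinAt

theorem th_hasSum {n : ℕ} {G : Matrix (Fin n) (Fin n) ℤ} (hG : EUM G) {p : (Fin n → ℤ) → ℂ} {K C : ℝ}
    (hp : ∀ k, ‖p k‖ ≤ K * Real.exp (C * nz k)) (z : ℂ) (hz : 0 < z.im) :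
    HasSum (fun m : ℕ => (∑' x : {x : Fin n → ℤ // x ⬝ᵥ (G *ᵥ x) = 2 * (m : ℤ)}, p x) *
      cexp (2 * Real.pi * I * z) ^ m) (th G p z) := by
  have h1 := (th_summable hG hp z hz).hasSum.tsum_fiberwise
    (fun k : Fin n → ℤ => ((k ⬝ᵥ (G *ᵥ k)) / 2).toNat)
  have h2 : ∀ k : Fin n → ℤ, 0 ≤ k ⬝ᵥ (G *ᵥ k) := by
    intro k
    by_cases hk : k = 0
    · simp [hk]
    · exact (hG.pos k hk).le
  have hs : ∀ m : ℕ, ((fun k : Fin n → ℤ => ((k ⬝ᵥ (G *ᵥ k)) / 2).toNat) ⁻¹' {m}) =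
      {x : Fin n → ℤ | x ⬝ᵥ (G *ᵥ x) = 2 * (m : ℤ)} := by
    intro m; ext k
    have := h2 k
    obtain ⟨a, ha⟩ := hG.even k
    simp only [Set.mem_preimage, Set.mem_singleton_iff]
    change _ ↔ k ⬝ᵥ (G *ᵥ k) = 2 * (m : ℤ)
    omega
  have h3 : (fun m : ℕ => (∑' x : {x : Fin n → ℤ // x ⬝ᵥ (G *ᵥ x) = 2 * (m : ℤ)}, p x) *
      cexp (2 * Real.pi * I * z) ^ m) = fun m : ℕ => ∑' (b : ((fun k : Fin n → ℤ => ((k ⬝ᵥ (G *ᵥ k)) / 2).toNat) ⁻¹' {m})),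
      p b * cexp (Real.pi * I * z * (((b : Fin n → ℤ) ⬝ᵥ (G *ᵥ (b : Fin n → ℤ)) : ℤ) : ℂ)) := by
    funext m
    rw [hs m, ← tsum_mul_right]
    refine tsum_congr fun b => ?_
    have hb : (b : Fin n → ℤ) ⬝ᵥ (G *ᵥ (b : Fin n → ℤ)) = 2 * (m : ℤ) := b.2
    rw [hb, ← Complex.exp_nat_mul]
    congr 2
    push_cast; ring
  rw [h3]
  exact h1

theorem th_MF {n : ℕ} {G : Matrix (Fin n) (Fin n) ℤ} (hG : EUM G) {p : (Fin n → ℤ) → ℂ} {K C : ℝ}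
    (hp : ∀ k, ‖p k‖ ≤ K * Real.exp (C * nz k)) (k : ℤ)
    (hS : ∀ z : ℂ, 0 < z.im → th G p (-1 / z) = z ^ k * th G p z) :
    ∃ F : ModularForm (Matrix.SpecialLinearGroup.mapGL (R := ℤ) (n := Fin 2) ℝ).range k, ∀ m, (UpperHalfPlane.qExpansion 1 F).coeff m =
      ∑' x : {x : Fin n → ℤ // x ⬝ᵥ (G *ᵥ x) = 2 * (m : ℤ)}, p x :=
  mkMF k (th G p) (th_diff hG hp) _ (fun τ => th_hasSum hG hp τ τ.im_pos) (fun τ => hS τ τ.im_pos)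

theorem th_one_bound {n : ℕ} (k : Fin n → ℤ) : ‖(1:ℂ)‖ ≤ 1 * Real.exp (0 * nz k) := by simp

theorem th_one_S {n : ℕ} {G : Matrix (Fin n) (Fin n) ℤ} (hG : EUM G) (z : ℂ) (hz : 0 < z.im) :
    th G (fun _ => 1) z = (1 / (-I * z)) ^ ((n : ℂ) / 2) * th G (fun _ => 1) (-1 / z) := by
  obtain ⟨B, hGB, hB⟩ := hG.factor
  have h := poissonTheta hG B hGB hB (-I * z) (by simpa using hz) 0
  have hz0 : z ≠ 0 := by rintro rfl; simp at hz
  simp only [zero_add, Matrix.mulVec_zero, dotProduct_zero, Complex.ofReal_zero, mul_zero, add_zero] at h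
  unfold th
  convert h using 2
  · funext k
    rw [one_mul, QB_int hGB]
    congr 1; push_cast; ring
  · refine tsum_congr fun k => ?_
    rw [one_mul, QB_int hGB]
    congr 1; push_cast; field_simp; simp [mul_comm]

theorem th_one_T {n : ℕ} {G : Matrix (Fin n) (Fin n) ℤ} (hG : EUM G) (z : ℂ) :
    th G (fun _ => 1) (z + 1) = th G (fun _ => 1) z := by
  unfold th
  refine tsum_congr fun k => ?_
  obtain ⟨a, ha⟩ := hG.even k
  rw [ha, one_mul, one_mul, Complex.exp_eq_exp_iff_exists_int]
  exact ⟨a, by push_cast; ring⟩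

theorem th_one_I {n : ℕ} {G : Matrix (Fin n) (Fin n) ℤ} (hG : EUM G) : th G (fun _ => 1) I ≠ 0 := by
  have hs := th_summable hG (p := fun _ => 1) th_one_bound I (by simp)
  have h1 : ∀ k : Fin n → ℤ, 1 * cexp (Real.pi * I * I * ((k ⬝ᵥ (G *ᵥ k) : ℤ) : ℂ)) =
    ((Real.exp (-(Real.pi * ((k ⬝ᵥ (G *ᵥ k) : ℤ) : ℝ))) : ℝ) : ℂ) := by
    intro k
    push_cast
    rw [one_mul]; congr 1
    rw [mul_assoc (Real.pi : ℂ), I_mul_I]; ring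
  simp only [h1] at hs
  unfold th
  simp only [h1]
  rw [← Complex.ofReal_tsum]
  have := (Complex.summable_ofReal.1 hs).tsum_pos (fun _ => (Real.exp_pos _).le) 0 (Real.exp_pos _)
  exact_mod_cast this.ne'

theorem EUM.eight_dvd {n : ℕ} {G : Matrix (Fin n) (Fin n) ℤ} (hG : EUM G) : 8 ∣ n := by
  have hI2 := I_mul_I
  have h1 := th_one_S hG (I + 1) (by simp)
  have h2 := th_one_S hG ((1 + I)/2) (by simp)
  have hne : (1 + I : ℂ) ≠ 0 := by intro h; have := congrArg re h; simp at this
  have hne' : (1 - I : ℂ) ≠ 0 := by intro h; have := congrArg re h; simp at this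
  have e1 : -1 / ((1 + I)/2) + 1 = I := by
    rw [div_add_one (by simpa using hne), div_eq_iff (by simpa using hne)]; linear_combination (-1/2) * hI2
  have e2 : -1 / (I + 1) + 1 = (1 + I)/2 := by
    have hne2 : (I + 1 : ℂ) ≠ 0 := by rwa [add_comm]
    rw [div_add_one hne2, div_eq_iff hne2]; linear_combination (-1/2) * hI2
  rw [th_one_T hG, ← th_one_T hG (-1 / (I + 1)), e2, h2, ← th_one_T hG (-1 / ((1 + I)/2)), e1, ← mul_assoc] at h1
  have h3 : (1 / (-I * (I + 1))) ^ ((n : ℂ) / 2) * (1 / (-I * ((1 + I)/2))) ^ ((n : ℂ) / 2) = 1 := by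
    have := th_one_I hG
    exact mul_right_cancel₀ this (by rw [one_mul]; exact h1.symm)
  have a1 : 1 / (-I * (I + 1)) = (1 + I) / 2 := by
    have : -I * (I + 1) = 1 - I := by linear_combination (-1) * hI2
    rw [this, div_eq_div_iff hne' two_ne_zero]; linear_combination hI2
  have a2 : 1 / (-I * ((1 + I)/2)) = 1 + I := by
    have : -I * ((1 + I)/2) = (1 - I)/2 := by linear_combination (-1/2) * hI2
    rw [this, one_div, inv_div, div_eq_iff hne']; linear_combination hI2
  rw [a1, a2, Complex.cpow_def_of_ne_zero (by simpa using hne), Complex.cpow_def_of_ne_zero hne, ← Complex.exp_add, ← add_mul] at h3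
  have hl : log ((1 + I)/2) + log (1 + I) = Real.pi / 2 * I := by
    rw [← Complex.log_mul (by simpa using hne) hne]
    · rw [← Complex.log_I]; congr 1; linear_combination (1/2) * hI2
    · have b1 : |arg ((1+I)/2)| < Real.pi / 2 := Complex.abs_arg_lt_pi_div_two_iff.2 (Or.inl (by simp))
      have b2 : |arg (1+I)| < Real.pi / 2 := Complex.abs_arg_lt_pi_div_two_iff.2 (Or.inl (by simp))
      rw [abs_lt] at b1 b2
      constructor <;> linarith
  rw [hl, Complex.exp_eq_one_iff] at h3
  obtain ⟨a, ha⟩ := h3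
  have hpi : (Real.pi : ℂ) ≠ 0 := by exact_mod_cast Real.pi_ne_zero
  have h5 : (n : ℂ) = 8 * a := by
    have : (Real.pi * I) * (n : ℂ) = (Real.pi * I) * (8 * a) := by linear_combination 4 * ha
    exact mul_left_cancel₀ (mul_ne_zero hpi I_ne_zero) this
  have h6 : (n : ℤ) = 8 * a := by exact_mod_cast h5
  omega

theorem th_one_S' {n j : ℕ} {G : Matrix (Fin n) (Fin n) ℤ} (hG : EUM G) (hn : n = 8 * j) (z : ℂ) (hz : 0 < z.im) :
    th G (fun _ => 1) (-1 / z) = z ^ ((4 * j : ℕ) : ℤ) * th G (fun _ => 1) z := by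
  have hz0 : z ≠ 0 := by rintro rfl; simp at hz
  have h := th_one_S hG z hz
  have e : ((n : ℂ) / 2) = ((4 * j : ℕ) : ℂ) := by rw [hn]; push_cast; ring
  have hI4 : (-I) ^ 4 = 1 := by rw [neg_pow, I_pow_four]; norm_num
  rw [e, Complex.cpow_natCast, one_div, inv_pow, mul_pow, pow_mul (-I), hI4, one_pow, one_mul] at h
  rw [h, zpow_natCast, mul_inv_cancel_left₀ (pow_ne_zero _ hz0)]

theorem EUM.finite {n : ℕ} {G : Matrix (Fin n) (Fin n) ℤ} (hG : EUM G) (m : ℤ) :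
    Finite {x : Fin n → ℤ // x ⬝ᵥ (G *ᵥ x) = m} := by
  obtain ⟨δ, hδ, hq⟩ := q_lower hG
  obtain ⟨R, hR⟩ := exists_nat_ge (m / δ)
  refine Set.Finite.subset (Set.finite_Icc (fun _ : Fin n => -(R + 1 : ℤ)) (fun _ => (R + 1 : ℤ))) ?_
  intro x hx
  have hx' : x ⬝ᵥ (G *ᵥ x) = m := hx
  have h1 := hq x
  rw [hx'] at h1
  have h2 : nz x ^ 2 ≤ R := by
    refine le_trans ?_ hR
    rw [le_div_iff₀ hδ]; linarith
  have h3 : nz x ≤ R + 1 := by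
    have : (0:ℝ) ≤ R := Nat.cast_nonneg _
    nlinarith
  have h4 : ∀ i, |(x i : ℝ)| ≤ R + 1 := fun i => le_trans (norm_le_pi_norm (fun i => (x i : ℝ)) i) h3
  constructor
  · intro i; have := (abs_le.1 (h4 i)).1; exact_mod_cast this
  · intro i; have := (abs_le.1 (h4 i)).2; exact_mod_cast this

theorem EUM.fib_sum {n : ℕ} {G : Matrix (Fin n) (Fin n) ℤ} (hG : EUM G) (m : ℤ) :
    ∑' _x : {x : Fin n → ℤ // x ⬝ᵥ (G *ᵥ x) = m}, (1 : ℂ) =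
    (Nat.card {x : Fin n → ℤ // x ⬝ᵥ (G *ᵥ x) = m} : ℂ) := by
  have := hG.finite m
  have := Fintype.ofFinite {x : Fin n → ℤ // x ⬝ᵥ (G *ᵥ x) = m}
  rw [tsum_fintype]; simp

theorem EUM.card_zero {n : ℕ} {G : Matrix (Fin n) (Fin n) ℤ} (hG : EUM G) :
    Nat.card {x : Fin n → ℤ // x ⬝ᵥ (G *ᵥ x) = 0} = 1 := by
  rw [Nat.card_eq_one_iff_unique]
  refine ⟨⟨fun a b => ?_⟩, ⟨⟨0, by simp⟩⟩⟩
  have key : ∀ c : {x : Fin n → ℤ // x ⬝ᵥ (G *ᵥ x) = 0}, (c : Fin n → ℤ) = 0 := by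
    intro c; by_contra h; have := hG.pos c h; have := c.2; omega
  exact Subtype.ext ((key a).trans (key b).symm)

theorem EUM.count8 {G : Matrix (Fin 8) (Fin 8) ℤ} (hG : EUM G) :
    Nat.card {x : Fin 8 → ℤ // x ⬝ᵥ (G *ᵥ x) = 2} = 240 ∧
    Nat.card {x : Fin 8 → ℤ // x ⬝ᵥ (G *ᵥ x) = 4} = 2160 := by
  obtain ⟨F, hF⟩ := th_MF hG th_one_bound 4 (th_one_S' (j := 1) hG rfl)
  simp only [hG.fib_sum] at hF
  obtain ⟨h1, h2⟩ := wt4_coeff F (by rw [hF 0]; simp [hG.card_zero])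
  rw [hF 1] at h1; rw [hF 2] at h2
  norm_num at h1 h2
  exact ⟨by exact_mod_cast h1, by exact_mod_cast h2⟩

theorem EUM.count16 {G : Matrix (Fin 16) (Fin 16) ℤ} (hG : EUM G) :
    Nat.card {x : Fin 16 → ℤ // x ⬝ᵥ (G *ᵥ x) = 2} = 480 := by
  obtain ⟨F, hF⟩ := th_MF hG th_one_bound 8 (th_one_S' (j := 2) hG rfl)
  simp only [hG.fib_sum] at hF
  have h1 := wt8_coeff F (by rw [hF 0]; simp [hG.card_zero])
  rw [hF 1] at h1
  norm_num at h1
  exact_mod_cast h1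

theorem EUM.count24 {G : Matrix (Fin 24) (Fin 24) ℤ} (hG : EUM G)
    (hr : ∀ x : Fin 24 → ℤ, x ⬝ᵥ (G *ᵥ x) ≠ 2) :
    Nat.card {x : Fin 24 → ℤ // x ⬝ᵥ (G *ᵥ x) = 4} = 196560 ∧
    Nat.card {x : Fin 24 → ℤ // x ⬝ᵥ (G *ᵥ x) = 6} = 16773120 ∧
    Nat.card {x : Fin 24 → ℤ // x ⬝ᵥ (G *ᵥ x) = 8} = 398034000 := by
  obtain ⟨F, hF⟩ := th_MF hG th_one_bound 12 (th_one_S' (j := 3) hG rfl)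
  simp only [hG.fib_sum] at hF
  have : IsEmpty {x : Fin 24 → ℤ // x ⬝ᵥ (G *ᵥ x) = 2} := ⟨fun x => hr x x.2⟩
  obtain ⟨h1, h2, h3⟩ := wt12_coeff F (by rw [hF 0]; simp [hG.card_zero]) (by rw [hF 1]; simp)
  rw [hF 2] at h1; rw [hF 3] at h2; rw [hF 4] at h3
  norm_num at h1 h2 h3
  exact ⟨by exact_mod_cast h1, by exact_mod_cast h2, by exact_mod_cast h3⟩

end Theta


section Harm
open Complex Filter Topology

theorem cos_taylor (z : ℂ) : ‖cos z - 1 + z^2/2‖ ≤ ‖z‖^3 * Real.exp ‖z‖ := by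
  have h1 := Complex.norm_exp_sub_sum_le_norm_mul_exp (z * I) 3
  have h2 := Complex.norm_exp_sub_sum_le_norm_mul_exp (-z * I) 3
  have e : cos z - 1 + z^2/2 = ((cexp (z * I) - ∑ m ∈ Finset.range 3, (z * I)^m / m.factorial) +
     (cexp (-z * I) - ∑ m ∈ Finset.range 3, (-z * I)^m / m.factorial)) / 2 := by
    rw [Complex.cos]
    simp [Finset.sum_range_succ, Nat.factorial]
    linear_combination (z^2/2) * I_sq
  rw [e, norm_div]
  have h3 := norm_add_le (cexp (z * I) - ∑ m ∈ Finset.range 3, (z * I)^m / m.factorial)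
     (cexp (-z * I) - ∑ m ∈ Finset.range 3, (-z * I)^m / m.factorial)
  simp only [norm_mul, norm_neg, norm_I, mul_one] at h1 h2
  rw [Complex.norm_two]
  linarith

theorem cube_exp (x : ℝ) (hx : 0 ≤ x) : x^3 ≤ 6 * Real.exp x := by
  have := Real.pow_div_factorial_le_exp x hx 3
  norm_num [Nat.factorial] at this
  linarith

theorem sq_exp (x : ℝ) (hx : 0 ≤ x) : x^2 ≤ 2 * Real.exp x := by
  have := Real.pow_div_factorial_le_exp x hx 2
  norm_num [Nat.factorial] at this
  linarith

theorem cos_lim {κ : Type*} (e y : κ → ℂ) (hs : Summable fun k => ‖e k‖ * Real.exp (2 * ‖y k‖)) :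
    Tendsto (fun s : ℝ => ((∑' k, e k * cos (s * y k)) - ∑' k, e k) / (s:ℂ)^2) (𝓝[>] 0)
      (𝓝 (-(1/2) * ∑' k, e k * y k ^ 2)) := by
  have hexp : ∀ k, 1 ≤ Real.exp (2 * ‖y k‖) := fun k => Real.one_le_exp (by positivity)
  have hse : Summable e := Summable.of_norm_bounded hs fun k => le_mul_of_one_le_right (norm_nonneg _) (hexp k)
  have hy2 : Summable fun k => e k * y k ^ 2 := by
    refine Summable.of_norm_bounded (hs.mul_left 2) fun k => ?_
    rw [norm_mul, norm_pow, mul_left_comm]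
    refine mul_le_mul_of_nonneg_left ?_ (norm_nonneg _)
    refine (sq_exp _ (norm_nonneg _)).trans ?_
    gcongr; linarith [norm_nonneg (y k)]
  have h3 : Summable fun k => ‖e k‖ * (‖y k‖^3 * Real.exp ‖y k‖) := by
    refine Summable.of_nonneg_of_le (fun k => by positivity) (fun k => ?_) (hs.mul_left 6)
    rw [mul_left_comm 6]
    refine mul_le_mul_of_nonneg_left ?_ (norm_nonneg _)
    rw [two_mul, Real.exp_add, ← mul_assoc]
    gcongr
    exact cube_exp _ (norm_nonneg _)
  rw [tendsto_iff_norm_sub_tendsto_zero]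
  have hlim : Tendsto (fun s : ℝ => s * ∑' k, ‖e k‖ * (‖y k‖^3 * Real.exp ‖y k‖)) (𝓝[>] 0) (𝓝 0) := by
    have : Tendsto (fun s : ℝ => s * ∑' k, ‖e k‖ * (‖y k‖^3 * Real.exp ‖y k‖)) (𝓝 0) (𝓝 (0 * ∑' k, ‖e k‖ * (‖y k‖^3 * Real.exp ‖y k‖))) :=
      tendsto_id.mul_const _
    rw [zero_mul] at this
    exact this.mono_left nhdsWithin_le_nhds
  refine squeeze_zero' (Eventually.of_forall fun s => norm_nonneg _) ?_ hlim
  filter_upwards [Ioo_mem_nhdsGT (show (0:ℝ) < 1 by norm_num)] with s hs'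
  have hs0 : 0 < s := hs'.1
  have hs1 : s < 1 := hs'.2
  have hsc : (s : ℂ) ≠ 0 := by exact_mod_cast hs0.ne'
  have hb : ∀ k, ‖e k * (cos (s * y k) - 1 + (s * y k)^2/2)‖ ≤ s^3 * (‖e k‖ * (‖y k‖^3 * Real.exp ‖y k‖)) := by
    intro k
    rw [norm_mul]
    have := cos_taylor (s * y k)
    rw [norm_mul, Complex.norm_real, Real.norm_of_nonneg hs0.le] at this
    calc _ ≤ ‖e k‖ * ((s * ‖y k‖)^3 * Real.exp (s * ‖y k‖)) := by gcongr
      _ ≤ ‖e k‖ * ((s * ‖y k‖)^3 * Real.exp (‖y k‖)) := by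
        gcongr
        nlinarith [norm_nonneg (y k)]
      _ = _ := by ring
  have hsum1 : Summable fun k => e k * (cos (s * y k) - 1 + (s * y k)^2/2) :=
    Summable.of_norm_bounded (h3.mul_left _) hb
  have hsc2 : Summable fun k => e k * cos (s * y k) := by
    have := (hsum1.add hse).sub (hy2.mul_left ((s:ℂ)^2/2))
    refine this.congr fun k => ?_
    ring
  have heq : (∑' k, e k * cos (s * y k) - ∑' k, e k) / (s:ℂ)^2 - -(1/2) * ∑' k, e k * y k ^ 2 =
     (∑' k, e k * (cos (s * y k) - 1 + (s * y k)^2/2)) / (s:ℂ)^2 := by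
    have : ∑' k, e k * (cos (s * y k) - 1 + (s * y k)^2/2) =
        ∑' k, e k * cos (s * y k) - ∑' k, e k + (s:ℂ)^2/2 * ∑' k, e k * y k ^ 2 := by
      rw [← hsc2.tsum_sub hse, ← tsum_mul_left, ← (hsc2.sub hse).tsum_add (hy2.mul_left _)]
      refine tsum_congr fun k => ?_
      ring
    rw [this]; field_simp; ring
  rw [heq, norm_div, norm_pow, Complex.norm_real, Real.norm_of_nonneg hs0.le, div_le_iff₀ (by positivity)]
  calc _ ≤ ∑' k, s^3 * (‖e k‖ * (‖y k‖^3 * Real.exp ‖y k‖)) := tsum_of_norm_bounded (h3.mul_left _).hasSum hb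
    _ = s * (∑' k, ‖e k‖ * (‖y k‖^3 * Real.exp ‖y k‖)) * s^2 := by rw [tsum_mul_left]; ring

theorem symm_cos {κ : Type*} [AddCommGroup κ] (e y : κ → ℂ) (he : ∀ k, e (-k) = e k) (hy : ∀ k, y (-k) = - y k)
    (hs : Summable fun k => ‖e k‖ * Real.exp (2 * ‖y k‖)) (s : ℝ) (hs0 : 0 < s) (hs1 : s < 1) :
    ∑' k, e k * cexp (s * y k * I) = ∑' k, e k * cos (s * y k) := by
  have h1 : Summable fun k => e k * cexp (s * y k * I) := by
    refine Summable.of_norm_bounded hs fun k => ?_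
    rw [norm_mul]
    gcongr
    refine (Complex.norm_exp_le_exp_norm _).trans ?_
    rw [Real.exp_le_exp, norm_mul, norm_mul, Complex.norm_real, Real.norm_of_nonneg hs0.le, norm_I]
    nlinarith [norm_nonneg (y k)]
  have h2 : Summable fun k => e k * cexp (-(s * y k) * I) := by
    have := (Equiv.neg κ).summable_iff.2 h1
    refine this.congr fun k => ?_
    simp [he, hy]
  have h3 : ∑' k, e k * cexp (-(s * y k) * I) = ∑' k, e k * cexp (s * y k * I) := by
    rw [← (Equiv.neg κ).tsum_eq]
    refine tsum_congr fun k => ?_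
    simp [he, hy]
  have h4 : ∑' k, e k * cos (s * y k) = (∑' k, e k * cexp (s * y k * I) + ∑' k, e k * cexp (-(s * y k) * I)) / 2 := by
    rw [← h1.tsum_add h2, ← tsum_div_const]
    refine tsum_congr fun k => ?_
    rw [Complex.cos]; ring
  rw [h4, h3]; ring

end Harm


section Harm2
open Complex Filter Topology

noncomputable def bet {n : ℕ} (B : Matrix (Fin n) (Fin n) ℝ) (a : Fin n → ℝ) (k : Fin n → ℤ) : ℝ :=
  (B *ᵥ fun i => (k i : ℝ)) ⬝ᵥ (B *ᵥ a)

theorem bet_bound {n : ℕ} (B : Matrix (Fin n) (Fin n) ℝ) (a : Fin n → ℝ) :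
    ∃ C, 0 ≤ C ∧ ∀ k, |bet B a k| ≤ C * nz k := by
  refine ⟨∑ i, |((B *ᵥ a) ᵥ* B) i|, Finset.sum_nonneg fun i _ => abs_nonneg _, fun k => ?_⟩
  have : bet B a k = ∑ i, ((B *ᵥ a) ᵥ* B) i * (k i : ℝ) := by
    unfold bet
    rw [dotProduct_comm, Matrix.dotProduct_mulVec]; rfl
  rw [this, Finset.sum_mul]
  refine (Finset.abs_sum_le_sum_abs _ _).trans (Finset.sum_le_sum fun i _ => ?_)
  rw [abs_mul]
  gcongr
  exact norm_le_pi_norm (fun i => (k i : ℝ)) i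

theorem gauss_y {n : ℕ} (B : Matrix (Fin n) (Fin n) ℝ) (hB : |B.det| = 1) (a : Fin n → ℝ) (t : ℂ) (ht : 0 < t.re) (μ : ℂ) :
    Summable fun k : Fin n → ℤ => ‖cexp (-(Real.pi * t * (QB B (fun i => (k i : ℝ)) : ℂ)))‖ *
      Real.exp (2 * ‖μ * (bet B a k : ℂ)‖) := by
  obtain ⟨δ, hδ, hq⟩ := QB_lower B hB
  obtain ⟨C, hC, hb⟩ := bet_bound B a
  refine Summable.of_nonneg_of_le (fun k => by positivity) (fun k => ?_)
    (summable_gauss n (Real.pi * t.re * δ) (2 * ‖μ‖ * C) (by have := Real.pi_pos; positivity))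
  rw [Complex.norm_exp, ← Real.exp_add, Real.exp_le_exp]
  have h1 : (-(Real.pi * t * (QB B (fun i => (k i : ℝ)) : ℂ))).re = -(Real.pi * t.re * QB B (fun i => (k i : ℝ))) := by
    simp
  rw [h1, norm_mul, Complex.norm_real]
  have h2 : Real.pi * t.re * (δ * ‖fun i => (k i : ℝ)‖^2) ≤ Real.pi * t.re * QB B (fun i => (k i : ℝ)) :=
    mul_le_mul_of_nonneg_left (hq _) (by have := Real.pi_pos; positivity)
  have h3 : ‖μ‖ * ‖bet B a k‖ ≤ ‖μ‖ * (C * nz k) := mul_le_mul_of_nonneg_left (hb k) (norm_nonneg _)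
  unfold nz at h3
  linarith

theorem QB_expand {n : ℕ} (B : Matrix (Fin n) (Fin n) ℝ) (a : Fin n → ℝ) (s : ℝ) (k : Fin n → ℤ) :
    QB B (s • a + fun i => (k i : ℝ)) = s^2 * QB B a + 2 * s * bet B a k + QB B (fun i => (k i : ℝ)) := by
  unfold QB bet
  simp only [Matrix.mulVec_add, Matrix.mulVec_smul, dotProduct, Finset.mul_sum, ← Finset.sum_add_distrib]
  refine Finset.sum_congr rfl fun i _ => ?_
  simp; ring

theorem QB_neg {n : ℕ} (B : Matrix (Fin n) (Fin n) ℝ) (k : Fin n → ℤ) :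
    QB B (fun i => ((-k) i : ℝ)) = QB B (fun i => (k i : ℝ)) := by
  unfold QB
  have : (fun i => (((-k) i : ℤ) : ℝ)) = -(fun i => (k i : ℝ)) := by ext i; simp
  rw [this]; simp [Matrix.mulVec_neg]

theorem bet_neg {n : ℕ} (B : Matrix (Fin n) (Fin n) ℝ) (a : Fin n → ℝ) (k : Fin n → ℤ) :
    bet B a (-k) = - bet B a k := by
  unfold bet
  have : (fun i => (((-k) i : ℤ) : ℝ)) = -(fun i => (k i : ℝ)) := by ext i; simp
  rw [this]; simp [Matrix.mulVec_neg]

theorem harm_one {n : ℕ} {G : Matrix (Fin n) (Fin n) ℤ} (hG : EUM G) (B : Matrix (Fin n) (Fin n) ℝ)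
    (hGB : G.map (Int.cast : ℤ → ℝ) = Bᵀ * B) (hB : |B.det| = 1) (t : ℂ) (ht : 0 < t.re)
    (a : Fin n → ℝ) (s : ℝ) (hs0 : 0 < s) (hs1 : s < 1) :
    cexp (-(Real.pi * t * s^2 * (QB B a : ℂ))) * ∑' k : Fin n → ℤ, cexp (-(Real.pi * t * (QB B (fun i => (k i : ℝ)) : ℂ))) *
      cos (s * (2 * Real.pi * t * I * (bet B a k : ℂ))) =
    (1 / t) ^ ((n : ℂ) / 2) * ∑' k : Fin n → ℤ, cexp (-(Real.pi * (1/t) * (QB B (fun i => (k i : ℝ)) : ℂ))) *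
      cos (s * (2 * Real.pi * (bet B a k : ℂ))) := by
  have ht' : 0 < (1/t).re := by
    rw [one_div, Complex.inv_re]
    exact div_pos ht (Complex.normSq_pos.2 (by rintro rfl; simp at ht))
  have h := poissonTheta hG B hGB hB t ht (s • a)
  rw [← symm_cos _ _ _ _ (gauss_y B hB a t ht _) s hs0 hs1, ← symm_cos _ _ _ _ (gauss_y B hB a (1/t) ht' _) s hs0 hs1]
  · rw [← tsum_mul_left]
    refine Eq.trans ?_ (h.trans (congrArg (fun X => (1 / t) ^ ((n : ℂ) / 2) * X) ?_))
    · refine tsum_congr fun k => ?_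
      rw [QB_expand, ← Complex.exp_add, ← Complex.exp_add]
      congr 1; push_cast
      linear_combination (2 * s * Real.pi * t * (bet B a k : ℂ)) * I_mul_I
    · refine tsum_congr fun k => ?_
      rw [← Complex.exp_add]
      congr 1
      have : (B *ᵥ fun i => (k i : ℝ)) ⬝ᵥ (B *ᵥ (s • a)) = s * bet B a k := by
        simp [bet, Matrix.mulVec_smul]
      rw [this]; push_cast; ring
  all_goals intro k
  · simp only [QB_neg]
  · rw [bet_neg]; push_cast; ring
  · simp only [QB_neg]
  · rw [bet_neg]; push_cast; ring

theorem harm_S {n : ℕ} {G : Matrix (Fin n) (Fin n) ℤ} (hG : EUM G) (B : Matrix (Fin n) (Fin n) ℝ)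
    (hGB : G.map (Int.cast : ℤ → ℝ) = Bᵀ * B) (hB : |B.det| = 1) (t : ℂ) (ht : 0 < t.re)
    (a c : Fin n → ℝ) (hac : QB B a = QB B c) :
    t^2 * ∑' k : Fin n → ℤ, (((bet B a k)^2 - (bet B c k)^2 : ℝ) : ℂ) * cexp (-(Real.pi * t * (QB B (fun i => (k i : ℝ)) : ℂ))) =
    -((1 / t) ^ ((n : ℂ) / 2) * ∑' k : Fin n → ℤ, (((bet B a k)^2 - (bet B c k)^2 : ℝ) : ℂ) *
      cexp (-(Real.pi * (1/t) * (QB B (fun i => (k i : ℝ)) : ℂ)))) := by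
  have ht' : 0 < (1/t).re := by
    rw [one_div, Complex.inv_re]
    exact div_pos ht (Complex.normSq_pos.2 (by rintro rfl; simp at ht))
  let e1 : (Fin n → ℤ) → ℂ := fun k => cexp (-(Real.pi * t * (QB B (fun i => (k i : ℝ)) : ℂ)))
  let e2 : (Fin n → ℤ) → ℂ := fun k => cexp (-(Real.pi * (1/t) * (QB B (fun i => (k i : ℝ)) : ℂ)))
  have la := cos_lim e1 (fun k => 2 * Real.pi * t * I * (bet B a k : ℂ)) (gauss_y B hB a t ht _)
  have lc := cos_lim e1 (fun k => 2 * Real.pi * t * I * (bet B c k : ℂ)) (gauss_y B hB c t ht _)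
  have ra := cos_lim e2 (fun k => 2 * Real.pi * (bet B a k : ℂ)) (gauss_y B hB a (1/t) ht' _)
  have rc := cos_lim e2 (fun k => 2 * Real.pi * (bet B c k : ℂ)) (gauss_y B hB c (1/t) ht' _)
  have l := la.sub lc
  have r := (ra.sub rc).const_mul ((1 / t) ^ ((n : ℂ) / 2))
  have u : Tendsto (fun s : ℝ => cexp (-(Real.pi * t * s^2 * (QB B a : ℂ)))) (𝓝[>] 0) (𝓝 1) := by
    have hc : Continuous (fun s : ℝ => cexp (-(Real.pi * t * s^2 * (QB B a : ℂ)))) := by fun_prop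
    have := hc.tendsto 0
    simp at this
    exact this.mono_left nhdsWithin_le_nhds
  have ul := u.mul l
  have key := tendsto_nhds_unique (ul.congr' ?_) r
  · have sq : ∀ (e : (Fin n → ℤ) → ℂ) (μ : ℂ) (d : Fin n → ℝ), ∑' k, e k * (μ * (bet B d k : ℂ))^2 = μ^2 * ∑' k, e k * (bet B d k : ℂ)^2 := by
      intro e μ d
      rw [← tsum_mul_left]; refine tsum_congr fun k => ?_; ring
    have sm : ∀ (t : ℂ) (_ : 0 < t.re) (d : Fin n → ℝ), Summable fun k : Fin n → ℤ => cexp (-(Real.pi * t * (QB B (fun i => (k i : ℝ)) : ℂ))) * (bet B d k : ℂ)^2 := by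
      intro t ht d
      refine Summable.of_norm_bounded ((gauss_y B hB d t ht 1).mul_left 2) fun k => ?_
      rw [norm_mul, mul_left_comm, one_mul, norm_pow]
      gcongr
      refine (sq_exp _ (norm_nonneg _)).trans ?_
      gcongr
      linarith [norm_nonneg (bet B d k : ℂ)]
    have df : ∀ (t : ℂ) (_ : 0 < t.re), ∑' k : Fin n → ℤ, (((bet B a k)^2 - (bet B c k)^2 : ℝ) : ℂ) * cexp (-(Real.pi * t * (QB B (fun i => (k i : ℝ)) : ℂ)))
       = ∑' k : Fin n → ℤ, cexp (-(Real.pi * t * (QB B (fun i => (k i : ℝ)) : ℂ))) * (bet B a k : ℂ)^2 - ∑' k : Fin n → ℤ, cexp (-(Real.pi * t * (QB B (fun i => (k i : ℝ)) : ℂ))) * (bet B c k : ℂ)^2 := by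
      intro t ht
      rw [← (sm t ht a).tsum_sub (sm t ht c)]
      refine tsum_congr fun k => ?_
      push_cast; ring
    rw [df t ht, df _ ht']
    simp only [sq] at key
    have hpi : (Real.pi : ℂ) ≠ 0 := by exact_mod_cast Real.pi_ne_zero
    have hp2 : (2 * (Real.pi : ℂ)^2) ≠ 0 := by simp
    apply mul_left_cancel₀ hp2
    simp only [e1, e2] at key
    linear_combination key + (2 * (Real.pi : ℂ)^2 * t^2 * (∑' k : Fin n → ℤ, cexp (-(Real.pi * t * (QB B (fun i => (k i : ℝ)) : ℂ))) * (bet B a k : ℂ)^2 - ∑' k : Fin n → ℤ, cexp (-(Real.pi * t * (QB B (fun i => (k i : ℝ)) : ℂ))) * (bet B c k : ℂ)^2)) * I_sq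
  · filter_upwards [Ioo_mem_nhdsGT (show (0:ℝ) < 1 by norm_num)] with s hs
    have h1 := harm_one hG B hGB hB t ht a s hs.1 hs.2
    have h2 := harm_one hG B hGB hB t ht c s hs.1 hs.2
    rw [← hac] at h2
    simp only [e1, e2]
    linear_combination (h1 - h2) / (s:ℂ)^2

theorem bet_int {n : ℕ} {G : Matrix (Fin n) (Fin n) ℤ} {B : Matrix (Fin n) (Fin n) ℝ}
    (hGB : G.map (Int.cast : ℤ → ℝ) = Bᵀ * B) (r : ℝ) (v k : Fin n → ℤ) :
    bet B (r • fun i => (v i : ℝ)) k = r * ((k ⬝ᵥ (G *ᵥ v) : ℤ) : ℝ) := by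
  unfold bet
  have h1 : (B *ᵥ fun i => (k i : ℝ)) ⬝ᵥ (B *ᵥ fun i => (v i : ℝ)) =
      (fun i => (k i : ℝ)) ⬝ᵥ ((Bᵀ * B) *ᵥ fun i => (v i : ℝ)) := by
    rw [← Matrix.mulVec_mulVec, Matrix.dotProduct_mulVec (fun i => (k i : ℝ)), Matrix.vecMul_transpose]
  rw [Matrix.mulVec_smul, dotProduct_smul, smul_eq_mul, h1, ← hGB]
  congr 1
  simp [dotProduct, mulVec]

theorem EUM.harm16 {G : Matrix (Fin 16) (Fin 16) ℤ} (hG : EUM G) (v w : Fin 16 → ℤ) :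
    ∑' x : {x : Fin 16 → ℤ // x ⬝ᵥ (G *ᵥ x) = 2},
      (((w ⬝ᵥ (G *ᵥ w)) * (x.1 ⬝ᵥ (G *ᵥ v))^2 - (v ⬝ᵥ (G *ᵥ v)) * (x.1 ⬝ᵥ (G *ᵥ w))^2 : ℤ) : ℂ) = 0 := by
  obtain ⟨B, hGB, hB⟩ := hG.factor
  have hnn : ∀ k : Fin 16 → ℤ, (0:ℝ) ≤ ((k ⬝ᵥ (G *ᵥ k) : ℤ) : ℝ) := by
    intro k; rw [← QB_int hGB]; exact Finset.sum_nonneg fun i _ => sq_nonneg _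
  let a : Fin 16 → ℝ := Real.sqrt ((w ⬝ᵥ (G *ᵥ w) : ℤ) : ℝ) • fun i => (v i : ℝ)
  let c : Fin 16 → ℝ := Real.sqrt ((v ⬝ᵥ (G *ᵥ v) : ℤ) : ℝ) • fun i => (w i : ℝ)
  have hQs : ∀ (r : ℝ) (x : Fin 16 → ℝ), QB B (r • x) = r^2 * QB B x := by
    intro r x; simp [QB, Matrix.mulVec_smul, Finset.mul_sum, mul_pow]
  have hac : QB B a = QB B c := by
    simp only [a, c]
    rw [hQs, hQs, QB_int hGB, QB_int hGB, Real.sq_sqrt (hnn _), Real.sq_sqrt (hnn _), mul_comm]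
  let p : (Fin 16 → ℤ) → ℂ := fun k => (((bet B a k)^2 - (bet B c k)^2 : ℝ) : ℂ)
  have hpk : ∀ k, p k = (((w ⬝ᵥ (G *ᵥ w)) * (k ⬝ᵥ (G *ᵥ v))^2 - (v ⬝ᵥ (G *ᵥ v)) * (k ⬝ᵥ (G *ᵥ w))^2 : ℤ) : ℂ) := by
    intro k
    simp only [p, a, c]
    rw [bet_int hGB, bet_int hGB, mul_pow, mul_pow, Real.sq_sqrt (hnn _), Real.sq_sqrt (hnn _)]
    push_cast; rfl
  obtain ⟨C1, hC1, hb1⟩ := bet_bound B a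
  obtain ⟨C2, hC2, hb2⟩ := bet_bound B c
  have hp : ∀ k, ‖p k‖ ≤ 2 * Real.exp ((C1 + C2) * nz k) := by
    intro k
    have hnz : 0 ≤ nz k := norm_nonneg _
    have e1 := hb1 k
    have e2 := hb2 k
    simp only [p]
    rw [Complex.norm_real, Real.norm_eq_abs]
    refine le_trans ?_ (sq_exp ((C1 + C2) * nz k) (by positivity))
    rw [abs_le] at e1 e2
    have f1 : (bet B a k)^2 ≤ (C1 * nz k)^2 := sq_le_sq' e1.1 e1.2
    have f2 : (bet B c k)^2 ≤ (C2 * nz k)^2 := sq_le_sq' e2.1 e2.2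
    have f3 : 0 ≤ (C1 * nz k) * (C2 * nz k) := by positivity
    rw [abs_le]
    constructor <;> nlinarith [sq_nonneg (bet B a k), sq_nonneg (bet B c k), sq_nonneg (C1 * nz k), sq_nonneg (C2 * nz k)]
  obtain ⟨F, hF⟩ := th_MF hG hp 10 (by
    intro z hz
    have hz0 : z ≠ 0 := by rintro rfl; simp at hz
    have h := harm_S hG B hGB hB (-I * z) (by simpa using hz) a c hac
    have e : (((16:ℕ) : ℂ) / 2) = ((8 : ℕ) : ℂ) := by norm_num
    have t1 : th G p z = ∑' k : Fin 16 → ℤ, (((bet B a k)^2 - (bet B c k)^2 : ℝ) : ℂ) * cexp (-(Real.pi * (-I * z) * (QB B (fun i => (k i : ℝ)) : ℂ))) := by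
      unfold th
      refine tsum_congr fun k => ?_
      rw [QB_int hGB]
      congr 2; push_cast; ring
    have t2 : th G p (-1 / z) = ∑' k : Fin 16 → ℤ, (((bet B a k)^2 - (bet B c k)^2 : ℝ) : ℂ) * cexp (-(Real.pi * (1 / (-I * z)) * (QB B (fun i => (k i : ℝ)) : ℂ))) := by
      unfold th
      refine tsum_congr fun k => ?_
      rw [QB_int hGB]
      congr 2; push_cast; field_simp; simp
    rw [← t1, ← t2, e, Complex.cpow_natCast, one_div, inv_pow] at h
    have i2 : (-I * z)^2 = - z^2 := by rw [mul_pow, neg_sq, I_sq]; ring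
    have i8 : (-I * z)^8 = z^8 := by rw [show (8:ℕ) = 2 * 4 from rfl, pow_mul, i2]; ring
    rw [i2, i8] at h
    have hz8 : z^8 ≠ 0 := pow_ne_zero _ hz0
    have h' : z^8 * (-z^2 * th G p z) = -(th G p (-1/z)) := by rw [h]; field_simp
    have : z ^ (10:ℤ) = z^10 := by norm_cast
    rw [this]
    linear_combination h')
  have h1 := wt10_coeff F (by
    rw [hF 0]
    refine (tsum_congr fun x => ?_).trans tsum_zero
    have hx : (x : Fin 16 → ℤ) = 0 := by
      by_contra h; have := hG.pos x h; have := x.2; simp at this; omega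
    rw [hpk, hx]; simp)
  rw [hF 1] at h1
  simp only [hpk] at h1
  norm_num at h1 ⊢
  exact h1
end Harm2


section Lat
variable {N : Type*} [AddCommGroup N]

structure UM (b : N →ₗ[ℤ] N →ₗ[ℤ] ℤ) : Prop where
  symm : ∀ x y, b x y = b y x
  pos : ∀ x, x ≠ 0 → 0 < b x x
  unim : ∀ f : N →ₗ[ℤ] ℤ, ∃ y, ∀ x, b y x = f x

def EvenL (b : N →ₗ[ℤ] N →ₗ[ℤ] ℤ) : Prop := ∀ x, Even (b x x)

variable [Module.Free ℤ N] [Module.Finite ℤ N] {b : N →ₗ[ℤ] N →ₗ[ℤ] ℤ}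

theorem UM.toEUM (h : UM b) (he : EvenL b) {n : ℕ} (hn : finrank ℤ N = n) :
    ∃ (e : N ≃ₗ[ℤ] (Fin n → ℤ)) (G : Matrix (Fin n) (Fin n) ℤ), EUM G ∧ ∀ x y, b x y = e x ⬝ᵥ (G *ᵥ e y) := by
  let B : Basis (Fin n) ℤ N := (Module.finBasis ℤ N).reindex (finCongr hn)
  let e : N ≃ₗ[ℤ] (Fin n → ℤ) := B.equivFun
  let G : Matrix (Fin n) (Fin n) ℤ := Matrix.of fun i j => b (B i) (B j)
  have hb : ∀ x y, b x y = e x ⬝ᵥ (G *ᵥ e y) := by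
    intro x y
    conv_lhs => rw [← B.sum_equivFun x, ← B.sum_equivFun y]
    simp only [map_sum, LinearMap.sum_apply, map_smul, LinearMap.smul_apply, dotProduct, mulVec, smul_eq_mul, e, G, Matrix.of_apply, Finset.mul_sum]
    rw [Finset.sum_comm]
    refine Finset.sum_congr rfl fun i _ => Finset.sum_congr rfl fun j _ => ?_
    ring
  refine ⟨e, G, ⟨?_, ?_, ?_, ?_⟩, hb⟩
  · ext i j; simp [G, h.symm (B i) (B j)]
  · intro x hx
    have := h.pos (e.symm x) (by simpa using hx)
    rwa [hb, e.apply_symm_apply] at this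
  · intro x
    have := he (e.symm x)
    rwa [hb, e.apply_symm_apply] at this
  · choose y hy using fun j => h.unim (B.coord j)
    refine Matrix.isUnit_det_of_left_inverse (B := Matrix.of fun j i => B.equivFun (y j) i) ?_
    ext j k
    have h1 := hy j (B k)
    rw [hb] at h1
    simp only [Basis.coord_apply, Basis.repr_self] at h1
    have h2 : e (B k) = Pi.single k 1 := by
      simp only [e, Basis.equivFun_apply, Basis.repr_self]; exact Finsupp.single_eq_pi_single _ _
    rw [h2, Matrix.mulVec_single_one] at h1
    rw [Matrix.mul_apply, Matrix.one_apply]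
    simp only [dotProduct, Matrix.col_apply] at h1
    simp only [Matrix.of_apply]
    rw [show (∑ x, B.equivFun (y j) x * G x k) = _ from h1, Finsupp.single_apply]
    simp [eq_comm]

theorem UM.eight_dvd (h : UM b) (he : EvenL b) : 8 ∣ finrank ℤ N := by
  obtain ⟨e, G, hG, -⟩ := h.toEUM he rfl
  exact hG.eight_dvd

theorem UM.finite (h : UM b) (he : EvenL b) (m : ℤ) : {x : N | b x x = m}.Finite := by
  obtain ⟨e, G, hG, hb⟩ := h.toEUM he rfl
  have := hG.finite m
  have h2 : {x | x ⬝ᵥ (G *ᵥ x) = m}.Finite := this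
  refine (h2.preimage (e.injective.injOn)).subset ?_
  intro x hx
  change e x ⬝ᵥ (G *ᵥ e x) = m
  rw [← hb]; exact hx

theorem card_transfer {n : ℕ} (e : N ≃ₗ[ℤ] (Fin n → ℤ)) (G : Matrix (Fin n) (Fin n) ℤ)
    (hb : ∀ x y, b x y = e x ⬝ᵥ (G *ᵥ e y)) (m : ℤ) (R : Finset N) (hR : ∀ x, x ∈ R ↔ b x x = m) :
    R.card = Nat.card {x : Fin n → ℤ // x ⬝ᵥ (G *ᵥ x) = m} := by
  rw [← Nat.card_eq_finsetCard]
  refine Nat.card_congr (e.toEquiv.subtypeEquiv fun x => ?_)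
  rw [hR, hb]; rfl

theorem UM.count8 (h : UM b) (he : EvenL b) (hn : finrank ℤ N = 8) (R X : Finset N)
    (hR : ∀ x, x ∈ R ↔ b x x = 2) (hX : ∀ x, x ∈ X ↔ b x x = 4) : R.card = 240 ∧ X.card = 2160 := by
  obtain ⟨e, G, hG, hb⟩ := h.toEUM he hn
  rw [card_transfer e G hb 2 R hR, card_transfer e G hb 4 X hX]
  exact hG.count8

theorem UM.count24 (h : UM b) (he : EvenL b) (hn : finrank ℤ N = 24) (hr : ∀ x, b x x ≠ 2) (R S X : Finset N)
    (hR : ∀ x, x ∈ R ↔ b x x = 4) (hS : ∀ x, x ∈ S ↔ b x x = 6) (hX : ∀ x, x ∈ X ↔ b x x = 8) :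
    R.card = 196560 ∧ S.card = 16773120 ∧ X.card = 398034000 := by
  obtain ⟨e, G, hG, hb⟩ := h.toEUM he hn
  rw [card_transfer e G hb 4 R hR, card_transfer e G hb 6 S hS, card_transfer e G hb 8 X hX]
  refine hG.count24 fun x hx => hr (e.symm x) ?_
  rw [hb, e.apply_symm_apply, hx]

theorem UM.sixty (h : UM b) (he : EvenL b) (hn : finrank ℤ N = 16) (R : Finset N)
    (hR : ∀ x, x ∈ R ↔ b x x = 2) (v : N) : ∑ x ∈ R, b x v ^ 2 = 60 * b v v := by
  obtain ⟨e, G, hG, hb⟩ := h.toEUM he hn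
  have hc : R.card = 480 := by rw [card_transfer e G hb 2 R hR]; exact hG.count16
  have key : ∀ v w, b w w * ∑ x ∈ R, b x v ^ 2 = b v v * ∑ x ∈ R, b x w ^ 2 := by
    intro v w
    have h1 := hG.harm16 (e v) (e w)
    have := hG.finite 2
    have := Fintype.ofFinite {x : Fin 16 → ℤ // x ⬝ᵥ (G *ᵥ x) = 2}
    rw [tsum_fintype] at h1
    have h2 : ∑ x : {x : Fin 16 → ℤ // x ⬝ᵥ (G *ᵥ x) = 2},
      ((e w ⬝ᵥ (G *ᵥ e w)) * (x.1 ⬝ᵥ (G *ᵥ e v))^2 - (e v ⬝ᵥ (G *ᵥ e v)) * (x.1 ⬝ᵥ (G *ᵥ e w))^2 : ℤ) = 0 := by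
      exact_mod_cast h1
    have h3 : ∑ x ∈ R, (b w w * b x v ^ 2 - b v v * b x w ^ 2) = 0 := by
      rw [← h2]
      refine Finset.sum_bij' (fun x hx => ⟨e x, by rw [← hb]; exact (hR x).1 hx⟩) (fun x _ => e.symm x.1) ?_ ?_ ?_ ?_ ?_
      · intros; simp
      · intro x _; rw [hR, hb, e.apply_symm_apply]; exact x.2
      · intros; simp
      · intros; simp
      · intros; simp [hb]
    rw [Finset.sum_sub_distrib, ← Finset.mul_sum, ← Finset.mul_sum] at h3
    linarith
  let B : Basis (Fin 16) ℤ N := (Module.finBasis ℤ N).reindex (finCongr hn)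
  choose y hy using fun j => h.unim (B.coord j)
  have hexp : ∀ x, b x x = ∑ i, b x (B i) * b x (y i) := by
    intro x
    have h1 : ∀ i, b x (y i) = B.repr x i := fun i => by rw [h.symm]; exact hy i x
    conv_lhs => rw [← B.sum_repr x]
    rw [map_sum, B.sum_repr]
    refine Finset.sum_congr rfl fun i _ => ?_
    rw [map_smul, smul_eq_mul, h1, mul_comm]
  let w := B 0
  have hw : 0 < b w w := h.pos _ (B.ne_zero 0)
  have pol : ∀ u v, b w w * ∑ x ∈ R, b x u * b x v = b u v * ∑ x ∈ R, b x w ^ 2 := by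
    intro u v
    have h1 := key (u + v) w
    have h2 := key u w
    have h3 := key v w
    have h4 : ∑ x ∈ R, b x (u + v) ^ 2 = ∑ x ∈ R, b x u ^ 2 + ∑ x ∈ R, b x v ^ 2 + 2 * ∑ x ∈ R, b x u * b x v := by
      rw [Finset.mul_sum, ← Finset.sum_add_distrib, ← Finset.sum_add_distrib]
      refine Finset.sum_congr rfl fun x _ => ?_
      rw [map_add]; ring
    have h5 : b (u + v) (u + v) = b u u + b v v + 2 * b u v := by
      simp only [map_add, LinearMap.add_apply]; rw [h.symm v u]; ring
    rw [h4, h5] at h1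
    linarith
  have tr : b w w * (2 * 480) = 16 * ∑ x ∈ R, b x w ^ 2 := by
    have h1 : ∑ i, b w w * ∑ x ∈ R, b x (B i) * b x (y i) = ∑ i, b (B i) (y i) * ∑ x ∈ R, b x w ^ 2 :=
      Finset.sum_congr rfl fun i _ => pol _ _
    rw [← Finset.mul_sum, Finset.sum_comm] at h1
    have h2 : ∑ x ∈ R, ∑ i, b x (B i) * b x (y i) = 2 * 480 := by
      rw [Finset.sum_congr rfl fun x hx => (hexp x).symm.trans ((hR x).1 hx)]
      simp [hc]
    rw [h2, ← Finset.sum_mul] at h1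
    have h3 : ∑ i, b (B i) (y i) = 16 := by
      have : ∀ i, b (B i) (y i) = 1 := fun i => by rw [h.symm, hy]; simp
      simp [this]
    rw [h3] at h1
    exact h1
  have hv := key v w
  have : b w w * ∑ x ∈ R, b x v ^ 2 = b w w * (60 * b v v) := by
    have : 16 * (b w w * ∑ x ∈ R, b x v ^ 2) = 16 * (b w w * (60 * b v v)) := by
      rw [hv]; linear_combination (-(b v v)) * tr
    linarith
  exact mul_left_cancel₀ hw.ne' this
end Lat


section Lat2
variable {N : Type*} [AddCommGroup N]

theorem half_system [DecidableEq N] (Y : Finset N) (hneg : ∀ y ∈ Y, -y ∈ Y) (hne : ∀ y ∈ Y, y ≠ -y) :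
    ∃ H : Finset N, H ⊆ Y ∧ (∀ y ∈ Y, y ∈ H ∨ -y ∈ H) ∧ (∀ y ∈ H, -y ∉ H) ∧ Y.card = 2 * H.card := by
  induction Y using Finset.strongInduction with
  | H Y ih =>
    rcases Y.eq_empty_or_nonempty with rfl | ⟨y, hy⟩
    · exact ⟨∅, by simp⟩
    · have hy2 : -y ∈ Y.erase y := Finset.mem_erase.2 ⟨(hne y hy).symm, hneg y hy⟩
      let Y' := (Y.erase y).erase (-y)
      have hY' : ∀ z, z ∈ Y' ↔ z ≠ -y ∧ z ≠ y ∧ z ∈ Y := by intro z; simp [Y']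
      have hss : Y' ⊂ Y := by
        refine Finset.ssubset_iff_subset_ne.2 ⟨fun z hz => ((hY' z).1 hz).2.2, fun h => ?_⟩
        rw [← h] at hy
        exact ((hY' y).1 hy).2.1 rfl
      obtain ⟨H, h1, h2, h3, h4⟩ := ih Y' hss
        (fun z hz => by
          rw [hY'] at hz ⊢
          exact ⟨fun h => hz.2.1 (neg_injective h), fun h => hz.1 (by rw [← h, neg_neg]), hneg z hz.2.2⟩)
        (fun z hz => hne z ((hY' z).1 hz).2.2)
      have hyH : y ∉ H := fun h => ((hY' y).1 (h1 h)).2.1 rfl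
      have hyH' : -y ∉ H := fun h => ((hY' _).1 (h1 h)).1 rfl
      refine ⟨insert y H, ?_, ?_, ?_, ?_⟩
      · exact Finset.insert_subset hy (h1.trans hss.subset)
      · intro z hz
        by_cases e1 : z = y
        · left; simp [e1]
        by_cases e2 : z = -y
        · right; simp [e2]
        rcases h2 z ((hY' z).2 ⟨e2, e1, hz⟩) with h | h
        · left; simp [h]
        · right; simp [h]
      · intro z hz
        rcases Finset.mem_insert.1 hz with rfl | hz
        · rw [Finset.mem_insert]; rintro (h | h)
          · exact hne _ hy h.symm
          · exact hyH' h
        · rw [Finset.mem_insert]; rintro (h | h)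
          · exact hyH' (by rw [← h, neg_neg]; exact hz)
          · exact h3 z hz h
      · rw [Finset.card_insert_of_notMem hyH]
        have c1 : Y'.card = (Y.erase y).card - 1 := Finset.card_erase_of_mem hy2
        have c2 : (Y.erase y).card = Y.card - 1 := Finset.card_erase_of_mem hy
        have c3 : 0 < (Y.erase y).card := Finset.card_pos.2 ⟨_, hy2⟩
        omega

variable [Module.Free ℤ N] [Module.Finite ℤ N] {b : N →ₗ[ℤ] N →ₗ[ℤ] ℤ}

theorem UM.nonneg (h : UM b) (x : N) : 0 ≤ b x x := by
  by_cases hx : x = 0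
  · simp [hx]
  · exact (h.pos x hx).le

theorem UM.orth_card_le (h : UM b) (H : Finset N) (h0 : ∀ x ∈ H, x ≠ 0)
    (ho : ∀ x ∈ H, ∀ y ∈ H, x ≠ y → b x y = 0) : H.card ≤ finrank ℤ N := by
  have hl : LinearIndependent ℤ (fun x : H => (x : N)) := by
    rw [Fintype.linearIndependent_iff]
    intro g hg i
    have h1 : b (∑ j, g j • (j : N)) i = 0 := by rw [hg]; simp
    rw [map_sum, LinearMap.sum_apply, Finset.sum_eq_single i] at h1
    · simp only [map_smul, LinearMap.smul_apply, smul_eq_mul] at h1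
      rcases mul_eq_zero.1 h1 with h2 | h2
      · exact h2
      · exact absurd h2 (h.pos _ (h0 i i.2)).ne'
    · intro j _ hj
      rw [map_smul, LinearMap.smul_apply, ho j j.2 i i.2 (fun e => hj (Subtype.ext e)), smul_zero]
    · intro hi; exact absurd (Finset.mem_univ i) hi
  have := hl.fintype_card_le_finrank
  simpa using this

theorem UM.frame_zero (h : UM b) [DecidableEq N] (H : Finset N) (h0 : ∀ x ∈ H, x ≠ 0)
    (ho : ∀ x ∈ H, ∀ y ∈ H, x ≠ y → b x y = 0) (hc : H.card = finrank ℤ N) (z : N) (hz : ∀ x ∈ H, b z x = 0) : z = 0 := by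
  by_contra hne
  have hzH : z ∉ H := fun hh => (h.pos z hne).ne' (hz z hh)
  have := h.orth_card_le (insert z H) ?_ ?_
  · rw [Finset.card_insert_of_notMem hzH] at this; omega
  · intro x hx
    rcases Finset.mem_insert.1 hx with rfl | hx
    · exact hne
    · exact h0 x hx
  · intro x hx y hy hxy
    rcases Finset.mem_insert.1 hx with rfl | hx' <;> rcases Finset.mem_insert.1 hy with rfl | hy'
    · exact absurd rfl hxy
    · exact hz y hy'
    · rw [h.symm]; exact hz x hx'
    · exact ho x hx' y hy' hxy

theorem UM.frame_exp (h : UM b) [DecidableEq N] (H : Finset N) (m : ℤ) (hm : 0 < m) (hq : ∀ x ∈ H, b x x = m)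
    (ho : ∀ x ∈ H, ∀ y ∈ H, x ≠ y → b x y = 0) (hc : H.card = finrank ℤ N) (x : N) :
    m • x = ∑ g ∈ H, b x g • g := by
  rw [← sub_eq_zero]
  refine h.frame_zero H (fun x hx e => ?_) ho hc _ fun y hy => ?_
  · have := hq x hx; rw [e] at this; simp at this; omega
  · rw [map_sub, LinearMap.sub_apply, map_smul, LinearMap.smul_apply, map_sum, LinearMap.sum_apply,
      Finset.sum_eq_single y]
    · rw [map_smul, LinearMap.smul_apply, hq y hy, smul_eq_mul, smul_eq_mul]; ring
    · intro g hg hgy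
      rw [map_smul, LinearMap.smul_apply, ho g hg y hy hgy, smul_zero]
    · intro hn; exact absurd hy hn

theorem UM.parseval (h : UM b) [DecidableEq N] (H : Finset N) (m : ℤ) (hm : 0 < m) (hq : ∀ x ∈ H, b x x = m)
    (ho : ∀ x ∈ H, ∀ y ∈ H, x ≠ y → b x y = 0) (hc : H.card = finrank ℤ N) (x y : N) :
    m * b x y = ∑ g ∈ H, b x g * b y g := by
  have h1 := congrArg (fun z => b z y) (h.frame_exp H m hm hq ho hc x)
  simp only [map_smul, LinearMap.smul_apply, map_sum, LinearMap.sum_apply, smul_eq_mul] at h1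
  rw [h1]
  refine Finset.sum_congr rfl fun g _ => ?_
  rw [h.symm g y]

theorem UM.short_pair (h : UM b) (μ : ℤ) (hmin : ∀ x, x ≠ 0 → μ ≤ b x x) (y y' z : N) (hz : y - y' = (2:ℤ) • z)
    (h1 : b y y ≤ 2 * μ) (h2 : b y' y' ≤ 2 * μ) (hne : y ≠ y') (hne' : y ≠ -y') :
    b y y = 2 * μ ∧ b y' y' = 2 * μ ∧ b y y' = 0 := by
  have hz' : y + y' = (2:ℤ) • (z + y') := by
    have : y + y' = (y - y') + (2:ℤ) • y' := by rw [two_smul]; abel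
    rw [this, hz, smul_add]
  have z0 : z ≠ 0 := by rintro rfl; rw [smul_zero, sub_eq_zero] at hz; exact hne hz
  have z1 : z + y' ≠ 0 := by intro e; rw [e, smul_zero] at hz'; exact hne' (eq_neg_of_add_eq_zero_left hz')
  have e1 : b (y - y') (y - y') = 4 * b z z := by
    rw [hz]; simp only [map_smul, LinearMap.smul_apply, smul_eq_mul]; ring
  have e2 : b (y + y') (y + y') = 4 * b (z + y') (z + y') := by
    rw [hz']; simp only [map_smul, LinearMap.smul_apply, smul_eq_mul]; ring
  have m1 := hmin _ z0
  have m2 := hmin _ z1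
  simp only [map_sub, LinearMap.sub_apply] at e1
  rw [map_add b y y', LinearMap.add_apply, map_add (b y), map_add (b y')] at e2
  have := h.symm y y'
  refine ⟨?_, ?_, ?_⟩ <;> linarith

theorem mod2_map {n : ℕ} (hn : finrank ℤ N = n) : ∃ π : N → (Fin n → ZMod 2),
    ∀ x y, π x = π y ↔ ∃ z, x - y = (2:ℤ) • z := by
  let B : Basis (Fin n) ℤ N := (Module.finBasis ℤ N).reindex (finCongr hn)
  refine ⟨fun x i => (B.repr x i : ZMod 2), fun x y => ⟨fun hxy => ?_, ?_⟩⟩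
  · have h1 : ∀ i, ∃ c : ℤ, B.repr (x - y) i = 2 * c := by
      intro i
      have := congrFun hxy i
      rw [ZMod.intCast_eq_intCast_iff_dvd_sub] at this
      obtain ⟨c, hc⟩ := this
      refine ⟨-c, ?_⟩
      rw [map_sub, Finsupp.sub_apply]; push_cast at hc; linarith
    choose c hc using h1
    refine ⟨∑ i, c i • B i, ?_⟩
    conv_lhs => rw [← B.sum_repr (x - y)]
    rw [Finset.smul_sum]
    refine Finset.sum_congr rfl fun i _ => ?_
    rw [hc, mul_smul]
  · rintro ⟨z, hz⟩
    funext i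
    rw [ZMod.intCast_eq_intCast_iff_dvd_sub]
    refine ⟨-(B.repr z i), ?_⟩
    have : B.repr (x - y) i = 2 * B.repr z i := by rw [hz]; simp
    rw [map_sub, Finsupp.sub_apply] at this
    push_cast; linarith

theorem UM.short_rep (h : UM b) [DecidableEq N] {n : ℕ} (hn : finrank ℤ N = n) (μ : ℤ) (hμ : 0 < μ) (hmin : ∀ x, x ≠ 0 → μ ≤ b x x)
    (A X : Finset N) (hA : ∀ x, x ∈ A ↔ 0 < b x x ∧ b x x < 2 * μ) (hX : ∀ x, x ∈ X ↔ b x x = 2 * μ)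
    (hcount : 2 * n + n * A.card + X.card = 2 * n * 2 ^ n) (x : N) :
    (∃ z, x = (2:ℤ) • z) ∨ (∃ y, 0 < b y y ∧ b y y < 2 * μ ∧ ∃ z, x - y = (2:ℤ) • z) ∨
    ∃ H : Finset N, H.card = n ∧ (∀ g ∈ H, b g g = 2 * μ ∧ ∃ z, x - g = (2:ℤ) • z) ∧
      (∀ g ∈ H, ∀ g' ∈ H, g ≠ g' → b g g' = 0) ∧
      (∀ y, b y y = 2 * μ → (∃ z, x - y = (2:ℤ) • z) → y ∈ H ∨ -y ∈ H) := by
  obtain ⟨π, hπ⟩ := mod2_map hn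
  have hnegq : ∀ y, b (-y) (-y) = b y y := by intro y; simp
  have hπneg : ∀ y, π (-y) = π y := fun y => (hπ _ _).2 ⟨-y, by rw [two_smul]; abel⟩
  have hself : ∀ y : N, y ≠ 0 → y ≠ -y := by
    intro y hy e
    have : (2:ℤ) • y = 0 := by rw [two_smul]; nth_rewrite 1 [e]; simp
    exact hy ((smul_eq_zero.1 this).resolve_left (by norm_num))
  have hq0 : ∀ y, 0 < b y y → y ≠ 0 := by rintro y hy rfl; simp at hy
  -- structure of the X part of a class
  have hXc : ∀ c, ∃ H : Finset N, H ⊆ X.filter (fun y => π y = c) ∧ (∀ y ∈ X.filter (fun y => π y = c), y ∈ H ∨ -y ∈ H) ∧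
      (X.filter (fun y => π y = c)).card = 2 * H.card ∧ (∀ g ∈ H, ∀ g' ∈ H, g ≠ g' → b g g' = 0) ∧ H.card ≤ n := by
    intro c
    obtain ⟨H, h1, h2, h3, h4⟩ := half_system (X.filter (fun y => π y = c))
      (by intro y hy; rw [Finset.mem_filter, hX] at hy ⊢; rw [hnegq, hπneg]; exact hy)
      (by intro y hy; rw [Finset.mem_filter, hX] at hy; exact hself y (hq0 y (by omega)))
    have ho : ∀ g ∈ H, ∀ g' ∈ H, g ≠ g' → b g g' = 0 := by
      intro g hg g' hg' hne
      have a1 := Finset.mem_filter.1 (h1 hg)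
      have a2 := Finset.mem_filter.1 (h1 hg')
      obtain ⟨z, hz⟩ := (hπ g g').1 (a1.2.trans a2.2.symm)
      refine (h.short_pair μ hmin g g' z hz ((hX g).1 a1.1).le ((hX g').1 a2.1).le hne ?_).2.2
      rintro rfl
      exact h3 _ hg' hg
    refine ⟨H, h1, h2, h4, ho, ?_⟩
    rw [← hn]
    refine h.orth_card_le H (fun y hy => ?_) ho
    have a1 := Finset.mem_filter.1 (h1 hy)
    exact hq0 y (by rw [(hX y).1 a1.1]; omega)
  let wt : (Fin n → ZMod 2) → ℕ := fun c => (if π 0 = c then 2 * n else 0) + n * (A.filter (fun y => π y = c)).card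
    + (X.filter (fun y => π y = c)).card
  have hsum : ∑ c, wt c = 2 * n * 2 ^ n := by
    simp only [wt, Finset.sum_add_distrib]
    rw [← Finset.mul_sum, ← Finset.card_eq_sum_card_fiberwise (fun _ _ => Finset.mem_univ _),
      ← Finset.card_eq_sum_card_fiberwise (fun _ _ => Finset.mem_univ _), ← hcount]
    simp
  have hAcase : ∀ c y, y ∈ A → π y = c → π 0 ≠ c ∧ A.filter (fun y => π y = c) ⊆ {y, -y} ∧ X.filter (fun y => π y = c) = ∅ := by
    intro c y hy hyc
    have hy' := (hA y).1 hy
    have gen : ∀ y', b y' y' ≤ 2 * μ → π y' = c → y' = y ∨ y' = -y := by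
      intro y' hq' hc'
      by_contra hcon
      push Not at hcon
      obtain ⟨z, hz⟩ := (hπ y' y).1 (hc'.trans hyc.symm)
      have := h.short_pair μ hmin y' y z hz hq' hy'.2.le hcon.1 hcon.2
      omega
    refine ⟨fun h0 => ?_, fun y' hy2 => ?_, ?_⟩
    · have hy0 := hq0 y hy'.1
      rcases gen 0 (by simp; omega) h0 with e | e
      · exact hy0 e.symm
      · exact hy0 (by rw [← neg_neg y, ← e, neg_zero])
    · have a := Finset.mem_filter.1 hy2
      have := gen y' ((hA y').1 a.1).2.le a.2
      simpa using this
    · rw [Finset.eq_empty_iff_forall_notMem]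
      intro y' hy2
      have a := Finset.mem_filter.1 hy2
      have a1 := (hX y').1 a.1
      rcases gen y' a1.le a.2 with e | e
      · rw [e] at a1; omega
      · rw [e, hnegq] at a1; omega
  have hle : ∀ c, wt c ≤ 2 * n := by
    intro c
    by_cases hAe : ∃ y ∈ A, π y = c
    · obtain ⟨y, hy, hyc⟩ := hAe
      obtain ⟨h1, h2, h3⟩ := hAcase c y hy hyc
      simp only [wt, if_neg h1, h3, Finset.card_empty, zero_add, add_zero]
      have := (Finset.card_le_card h2).trans (Finset.card_le_two)
      rw [mul_comm 2 n]
      exact Nat.mul_le_mul_left _ this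
    · have hAe' : A.filter (fun y => π y = c) = ∅ := by
        rw [Finset.filter_eq_empty_iff]; intro y hy e; exact hAe ⟨y, hy, e⟩
      by_cases h0 : π 0 = c
      · have : X.filter (fun y => π y = c) = ∅ := by
          rw [Finset.filter_eq_empty_iff]; intro y hy e
          have hyq := (hX y).1 hy
          have hy0 := hq0 y (by omega)
          obtain ⟨z, hz⟩ := (hπ y 0).1 (e.trans h0.symm)
          have := h.short_pair μ hmin y 0 z hz hyq.le (by simp; omega) hy0 (by simpa using hy0)
          simp at this; omega
        simp [wt, hAe', this, h0]
      · obtain ⟨H, -, -, h3, -, h5⟩ := hXc c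
        simp only [wt, hAe', if_neg h0, Finset.card_empty, h3]
        omega
  have heq : ∀ c, wt c = 2 * n := by
    have : ∑ c, wt c = ∑ _c : Fin n → ZMod 2, 2 * n := by
      rw [hsum]; simp [ZMod.card]; ring
    intro c
    exact (Finset.sum_eq_sum_iff_of_le (fun c _ => hle c)).1 this c (Finset.mem_univ c)
  by_cases h0 : π 0 = π x
  · left
    obtain ⟨z, hz⟩ := (hπ x 0).1 h0.symm
    exact ⟨z, by simpa using hz⟩
  right
  by_cases hAe : ∃ y ∈ A, π y = π x
  · left
    obtain ⟨y, hy, hyx⟩ := hAe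
    exact ⟨y, ((hA y).1 hy).1, ((hA y).1 hy).2, (hπ x y).1 hyx.symm⟩
  right
  obtain ⟨H, h1, h2, h3, h4, h5⟩ := hXc (π x)
  have hAe' : A.filter (fun y => π y = π x) = ∅ := by
    rw [Finset.filter_eq_empty_iff]; intro y hy e; exact hAe ⟨y, hy, e⟩
  have hw := heq (π x)
  simp only [wt, hAe', if_neg h0, Finset.card_empty, h3] at hw
  refine ⟨H, by omega, fun g hg => ?_, h4, fun y hy hyx => ?_⟩
  · have a := Finset.mem_filter.1 (h1 hg)
    exact ⟨(hX g).1 a.1, (hπ x g).1 a.2.symm⟩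
  · exact h2 y (Finset.mem_filter.2 ⟨(hX y).2 hy, ((hπ x y).2 hyx).symm⟩)

end Lat2


section Nbr
variable {U : Type*} [AddCommGroup U] {b : U →ₗ[ℤ] U →ₗ[ℤ] ℤ}

theorem divForm (b : U →ₗ[ℤ] U →ₗ[ℤ] ℤ) (P : Submodule ℤ U) (m : ℤ) (hm : m ≠ 0) (hd : ∀ x ∈ P, ∀ y ∈ P, m ∣ b x y) :
    ∃ b' : P →ₗ[ℤ] P →ₗ[ℤ] ℤ, ∀ x y : P, m * b' x y = b x y := by
  have key : ∀ x y : P, m * (b x y / m) = b x y := fun x y => Int.mul_ediv_cancel' (hd x x.2 y y.2)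
  refine ⟨LinearMap.mk₂ ℤ (fun x y => b x y / m) ?_ ?_ ?_ ?_, fun x y => key x y⟩
  · intro x x' y
    apply mul_left_cancel₀ hm
    rw [mul_add, key, key, key]; simp
  · intro c x y
    apply mul_left_cancel₀ hm
    rw [smul_eq_mul, mul_left_comm, key, key]; simp
  · intro x y y'
    apply mul_left_cancel₀ hm
    rw [mul_add, key, key, key]; simp
  · intro c x y
    apply mul_left_cancel₀ hm
    rw [smul_eq_mul, mul_left_comm, key, key]; simp

theorem UM.ext (h : UM b) (x y : U) (he : ∀ u, b x u = b y u) : x = y := by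
  by_contra hne
  have := h.pos (x - y) (sub_ne_zero.2 hne)
  rw [map_sub b, LinearMap.sub_apply, he, sub_self] at this
  exact lt_irrefl _ this

theorem UM.div (h : UM b) (m : ℤ) (hm : m ≠ 0) (p : U) (hp : ∀ u, m ∣ b p u) : ∃ v, p = m • v := by
  let f : U →ₗ[ℤ] ℤ :=
    { toFun := fun u => b p u / m
      map_add' := fun x y => by
        rw [map_add, Int.add_ediv_of_dvd_left (hp x)]
      map_smul' := fun c x => by
        simp only [map_smul, smul_eq_mul, RingHom.id_apply]
        rw [Int.mul_ediv_assoc _ (hp x)] }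
  obtain ⟨v, hv⟩ := h.unim f
  refine ⟨v, h.ext _ _ fun u => ?_⟩
  rw [map_smul, LinearMap.smul_apply, hv, smul_eq_mul]
  exact (Int.mul_ediv_cancel' (hp u)).symm

variable [Module.Free ℤ U] [Module.Finite ℤ U]

theorem UM.nbr (h : UM b) (W : U) (hW : ∀ x, Even (b x x + b W x)) (h8 : 8 ∣ b W W) (u1 : U) (hu1 : Odd (b W u1)) :
    ∃ (P : Submodule ℤ U) (b' : P →ₗ[ℤ] P →ₗ[ℤ] ℤ), UM b' ∧ EvenL b' ∧ finrank ℤ P = finrank ℤ U ∧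
      (∀ X, X ∈ P ↔ (∃ (j : ℤ) (u : U), X = j • W + (2:ℤ) • u) ∧ 4 ∣ b W X) ∧ ∀ X Y : P, 4 * b' X Y = b X Y := by
  let P : Submodule ℤ U :=
    { carrier := {X | (∃ (j : ℤ) (u : U), X = j • W + (2:ℤ) • u) ∧ 4 ∣ b W X}
      add_mem' := by
        rintro x y ⟨⟨j, u, rfl⟩, hx⟩ ⟨⟨i, v, rfl⟩, hy⟩
        refine ⟨⟨j + i, u + v, ?_⟩, ?_⟩
        · rw [add_smul, smul_add]; abel
        · rw [map_add]; exact dvd_add hx hy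
      zero_mem' := ⟨⟨0, 0, by simp⟩, by simp⟩
      smul_mem' := by
        rintro c x ⟨⟨j, u, rfl⟩, hx⟩
        refine ⟨⟨c * j, c • u, ?_⟩, ?_⟩
        · rw [smul_add, mul_smul, smul_comm c (2:ℤ)]
        · rw [map_smul, smul_eq_mul]; exact Dvd.dvd.mul_left hx c }
  have hP : ∀ X, X ∈ P ↔ (∃ (j : ℤ) (u : U), X = j • W + (2:ℤ) • u) ∧ 4 ∣ b W X := fun X => Iff.rfl
  have hev : ∀ (j : ℤ) (u : U), j • W + (2:ℤ) • u ∈ P → 2 ∣ b W u := by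
    intro j u hX
    have h1 := ((hP _).1 hX).2
    simp only [map_add, map_smul, smul_eq_mul] at h1
    have h2 : 4 ∣ j * b W W := Dvd.dvd.mul_left (by omega) j
    omega
  have hd : ∀ x ∈ P, ∀ y ∈ P, (4:ℤ) ∣ b x y := by
    intro x hx y hy
    obtain ⟨⟨j, u, rfl⟩, -⟩ := (hP x).1 hx
    obtain ⟨⟨i, v, rfl⟩, hy2⟩ := (hP y).1 hy
    have hu := hev j u hx
    rw [map_add b (j • W) ((2:ℤ) • u), LinearMap.add_apply, map_smul b j W, LinearMap.smul_apply, smul_eq_mul]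
    refine dvd_add (Dvd.dvd.mul_left hy2 _) ?_
    simp only [map_add, map_smul, LinearMap.smul_apply, smul_eq_mul, h.symm u W]
    obtain ⟨c, hc⟩ := hu
    rw [hc]
    exact ⟨i * c + b u v, by ring⟩
  obtain ⟨b', hb'⟩ := divForm b P 4 (by norm_num) hd
  have h4 : ∀ u, (4:ℤ) • u ∈ P := fun u => (hP _).2 ⟨⟨0, (2:ℤ) • u, by rw [zero_smul, zero_add, smul_smul]; norm_num⟩, by simp⟩
  refine ⟨P, b', ⟨?_, ?_, ?_⟩, ?_, ?_, hP, hb'⟩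
  · intro x y
    have h1 := hb' x y
    have h2 := hb' y x
    rw [h.symm] at h1; omega
  · intro x hx
    have h1 := hb' x x
    have h2 := h.pos x (by simpa using hx)
    omega
  · intro g
    let f : U →ₗ[ℤ] ℤ := g.comp (LinearMap.codRestrict P ((4:ℤ) • LinearMap.id) h4)
    have hf : ∀ u, f u = g ⟨(4:ℤ) • u, h4 u⟩ := fun u => rfl
    obtain ⟨p, hp⟩ := h.unim f
    have hg : ∀ X : P, b p X = 4 * g X := by
      intro X
      rw [hp, hf]
      have : (⟨(4:ℤ) • (X:U), h4 X⟩ : P) = (4:ℤ) • X := rfl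
      rw [this, map_smul, smul_eq_mul]
    have hWP : W ∈ P := (hP W).2 ⟨⟨1, 0, by simp⟩, by omega⟩
    have he : ∀ u, 2 ∣ b W u → 2 ∣ b p u := by
      intro u hu
      have hm : (2:ℤ) • u ∈ P := (hP _).2 ⟨⟨0, u, by simp⟩, by rw [map_smul, smul_eq_mul]; omega⟩
      have := hg ⟨_, hm⟩
      simp only [map_smul, smul_eq_mul] at this
      omega
    obtain ⟨v, hv⟩ := h.div 2 (by norm_num) (p - (b p u1) • W) (by
      intro u
      rw [map_sub, LinearMap.sub_apply, map_smul, LinearMap.smul_apply, smul_eq_mul]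
      by_cases hu : 2 ∣ b W u
      · exact dvd_sub (he u hu) (Dvd.dvd.mul_left hu _)
      · have h1 := he (u + u1) (by rw [map_add]; obtain ⟨c, hc⟩ := hu1; omega)
        rw [map_add] at h1
        obtain ⟨c, hc⟩ : Odd (b W u) := by rw [← Int.not_even_iff_odd, even_iff_two_dvd]; exact hu
        rw [hc]
        obtain ⟨d, hd⟩ := h1
        exact ⟨d - b p u1 * (c + 1), by linear_combination hd⟩)
    have hpP : p ∈ P := by
      refine (hP p).2 ⟨⟨b p u1, v, by rw [← hv]; abel⟩, ?_⟩
      rw [h.symm]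
      exact ⟨_, hg ⟨W, hWP⟩⟩
    refine ⟨⟨p, hpP⟩, fun X => ?_⟩
    have h1 := hb' ⟨p, hpP⟩ X
    have h2 := hg X
    simp only at h1
    omega
  · rintro ⟨x, hx⟩
    obtain ⟨⟨j, u, rfl⟩, -⟩ := (hP x).1 hx
    have hu := hev j u hx
    have h1 := hb' ⟨_, hx⟩ ⟨_, hx⟩
    simp only [map_add, LinearMap.add_apply, map_smul, LinearMap.smul_apply, smul_eq_mul, h.symm u W] at h1
    have h2 := hW u
    obtain ⟨c, hc⟩ := hu
    obtain ⟨d, hd⟩ := h2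
    obtain ⟨a, ha⟩ := h8
    have h3 : b u u = 2 * (d - c) := by omega
    rw [hc, ha, h3] at h1
    rw [even_iff_two_dvd]
    refine ⟨j * j * a + j * c + (d - c), ?_⟩
    linarith
  · apply le_antisymm (Submodule.finrank_le P)
    refine LinearMap.finrank_le_finrank_of_injective (f := LinearMap.codRestrict P ((4:ℤ) • LinearMap.id) h4) ?_
    intro x y hxy
    have : (4:ℤ) • x = (4:ℤ) • y := congrArg Subtype.val hxy
    exact smul_right_injective U (by norm_num : (4:ℤ) ≠ 0) this

/-- product with the standard lattice -/
def prodForm (b : U →ₗ[ℤ] U →ₗ[ℤ] ℤ) (k : ℕ) :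
    (U × (Fin k → ℤ)) →ₗ[ℤ] (U × (Fin k → ℤ)) →ₗ[ℤ] ℤ :=
  LinearMap.mk₂ ℤ (fun x y => b x.1 y.1 + x.2 ⬝ᵥ y.2)
    (by intro x x' y; simp [add_dotProduct]; ring)
    (by
      intro c x y
      rw [Prod.smul_fst, Prod.smul_snd, map_smul, LinearMap.smul_apply, smul_dotProduct, smul_add])
    (by intro x y y'; simp [dotProduct_add]; ring)
    (by
      intro c x y
      rw [Prod.smul_fst, Prod.smul_snd, map_smul, dotProduct_smul, smul_add])

theorem prodForm_apply (b : U →ₗ[ℤ] U →ₗ[ℤ] ℤ) (k : ℕ) (x y : U × (Fin k → ℤ)) :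
    prodForm b k x y = b x.1 y.1 + x.2 ⬝ᵥ y.2 := rfl

theorem UM.prod (h : UM b) (k : ℕ) : UM (prodForm b k) := by
  have hs : ∀ f : Fin k → ℤ, 0 ≤ f ⬝ᵥ f := fun f => Finset.sum_nonneg fun i _ => mul_self_nonneg _
  refine ⟨fun x y => ?_, fun x hx => ?_, fun F => ?_⟩
  · rw [prodForm_apply, prodForm_apply, h.symm, dotProduct_comm]
  · rw [prodForm_apply]
    by_cases h1 : x.1 = 0
    · have h2 : x.2 ≠ 0 := fun e => hx (Prod.ext h1 e)
      have h3 : x.2 ⬝ᵥ x.2 ≠ 0 := fun e => h2 (dotProduct_self_eq_zero.1 e)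
      have := hs x.2
      rw [h1]; simp only [map_zero, LinearMap.zero_apply]; omega
    · have := h.pos _ h1
      have := hs x.2
      omega
  · obtain ⟨y, hy⟩ := h.unim (F.comp (LinearMap.inl ℤ U (Fin k → ℤ)))
    refine ⟨(y, fun i => F (0, Pi.single i 1)), fun x => ?_⟩
    rw [prodForm_apply, hy]
    have h1 : x = (x.1, 0) + ∑ i, x.2 i • ((0, Pi.single i 1) : U × (Fin k → ℤ)) := by
      refine Prod.ext (by simp [Prod.fst_sum]) ?_
      simp [Prod.snd_sum, Finset.univ_sum_single, ← Pi.single_smul]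
    conv_rhs => rw [h1]
    simp only [map_add, map_sum, map_smul]
    simp [dotProduct, mul_comm]

theorem UM.exists_char (h : UM b) : ∃ w, ∀ x, Even (b x x + b w x) := by
  let B := Module.finBasis ℤ U
  obtain ⟨w, hw⟩ := h.unim (B.constr ℤ (fun i => b (B i) (B i)))
  refine ⟨w, fun x => ?_⟩
  have hx : x ∈ Submodule.span ℤ (Set.range B) := by rw [B.span_eq]; trivial
  induction hx using Submodule.span_induction with
  | mem x hx =>
    obtain ⟨i, rfl⟩ := hx
    rw [hw, Basis.constr_basis]; exact ⟨_, rfl⟩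
  | zero => simp
  | add x y _ _ hx hy =>
    have : b (x + y) (x + y) + b w (x + y) = (b x x + b w x) + (b y y + b w y) + 2 * b x y := by
      simp only [map_add, LinearMap.add_apply]; rw [h.symm y x]; ring
    rw [this]
    exact (hx.add hy).add (even_two_mul _)
  | smul c x _ hx =>
    have : b (c • x) (c • x) + b w (c • x) = c * (b x x + b w x) + c * (c - 1) * b x x := by
      simp only [map_smul, LinearMap.smul_apply, smul_eq_mul]; ring
    rw [this]
    exact (hx.mul_left c).add ((Int.even_mul_pred_self c).mul_right _)

end Nbr


section MThm
variable {M : Type*} [AddCommGroup M] [Module.Free ℤ M] [Module.Finite ℤ M] {b : M →ₗ[ℤ] M →ₗ[ℤ] ℤ}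

theorem UM.nbrProd (h : UM b) (w : M) (hw : ∀ x, Even (b x x + b w x)) (k' : ℕ) (h8 : 8 ∣ b w w + (k' + 1 : ℕ)) :
    ∃ (P : Submodule ℤ (M × (Fin (k' + 1) → ℤ))) (b' : P →ₗ[ℤ] P →ₗ[ℤ] ℤ), UM b' ∧ EvenL b' ∧
      finrank ℤ P = finrank ℤ M + (k' + 1) ∧
      (∀ (A : M) (B : Fin (k' + 1) → ℤ), (A, B) ∈ P ↔ (∃ (j : ℤ) (a : M) (c : Fin (k' + 1) → ℤ), A = j • w + (2:ℤ) • a ∧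
        ∀ i, B i = j + 2 * c i) ∧ 4 ∣ b w A + ∑ i, B i) ∧
      ∀ X Y : P, 4 * b' X Y = b X.1.1 Y.1.1 + X.1.2 ⬝ᵥ Y.1.2 := by
  obtain ⟨P, b', hu, he, hf, hP, hb⟩ := (h.prod (k' + 1)).nbr (w, fun _ => 1) (by
    intro x
    rw [prodForm_apply, prodForm_apply]
    have : b x.1 x.1 + x.2 ⬝ᵥ x.2 + (b w x.1 + (fun _ => 1) ⬝ᵥ x.2) = (b x.1 x.1 + b w x.1) + ∑ i, x.2 i * (x.2 i + 1) := by
      simp only [dotProduct, mul_add, Finset.sum_add_distrib, one_mul, mul_one]; ring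
    rw [this]
    exact (hw _).add (Finset.even_sum _ fun i _ => Int.even_mul_succ_self _)) (by
    rw [prodForm_apply]; simpa [dotProduct] using h8) (0, Pi.single 0 1) (by
    rw [prodForm_apply]; simp [dotProduct])
  refine ⟨P, b', hu, he, ?_, ?_, hb⟩
  · rw [hf, Module.finrank_prod, Module.finrank_fin_fun]
  · intro A B
    rw [hP, prodForm_apply]
    have e1 : ((fun _ => 1) ⬝ᵥ B : ℤ) = ∑ i, B i := by simp [dotProduct]
    simp only [e1]
    refine and_congr_left fun _ => ⟨?_, ?_⟩
    · rintro ⟨j, u, hu⟩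
      refine ⟨j, u.1, u.2, by simpa using congrArg Prod.fst hu, fun i => by simpa using congrFun (congrArg Prod.snd hu) i⟩
    · rintro ⟨j, a, c, h1, h2⟩
      refine ⟨j, (a, c), Prod.ext (by simpa using h1) (funext fun i => by simpa using h2 i)⟩

theorem UM.vdB (h : UM b) (w : M) (hw : ∀ x, Even (b x x + b w x)) : (8:ℤ) ∣ b w w - finrank ℤ M := by
  obtain ⟨k, hk⟩ : ∃ k : ℕ, (k : ℤ) = (-(b w w) - 1) % 8 := ⟨((-(b w w) - 1) % 8).toNat, by
    rw [Int.toNat_of_nonneg (Int.emod_nonneg _ (by norm_num))]⟩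
  obtain ⟨P, b', hu, he, hf, -⟩ := h.nbrProd w hw k (by push_cast; omega)
  have := hu.eight_dvd he
  rw [hf] at this
  omega

theorem sq_sum_one {k : ℕ} (t : Fin k → ℤ) (h : ∑ i, t i * t i = 1) :
    ∃ i, ∃ s : ℤ, (s = 1 ∨ s = -1) ∧ t = Pi.single i s := by
  have h0 : ∃ i, t i ≠ 0 := by
    by_contra hc
    push Not at hc
    simp [hc] at h
  obtain ⟨i, hi⟩ := h0
  have h1 := Finset.add_sum_erase Finset.univ (fun i => t i * t i) (Finset.mem_univ i)
  have h2 : 0 ≤ ∑ j ∈ Finset.univ.erase i, t j * t j := Finset.sum_nonneg fun j _ => mul_self_nonneg _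
  have h3 : 0 < t i * t i := mul_self_pos.2 hi
  have h4 : t i * t i = 1 := by omega
  have h5 : ∑ j ∈ Finset.univ.erase i, t j * t j = 0 := by omega
  rw [Finset.sum_eq_zero_iff_of_nonneg (fun j _ => mul_self_nonneg _)] at h5
  refine ⟨i, t i, ?_, ?_⟩
  · exact mul_self_eq_one_iff.1 h4
  · funext j
    by_cases hj : j = i
    · subst hj; simp
    · rw [Pi.single_eq_of_ne hj]
      simpa using h5 j (Finset.mem_erase.2 ⟨hj, Finset.mem_univ _⟩)

/-- the even part of the root sum -/
theorem UM.even_part (h : UM b) (hmin : ∀ x, x ≠ 0 → 2 ≤ b x x) (w : M) (k' : ℕ) [DecidableEq M]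
    (E : Finset (M × (Fin (k' + 1) → ℤ)))
    (hE : ∀ A B, (A, B) ∈ E ↔ (∃ a : M, A = (2:ℤ) • a) ∧ (∃ c : Fin (k' + 1) → ℤ, ∀ i, B i = 2 * c i) ∧
       4 ∣ b w A + ∑ i, B i ∧ b A A + B ⬝ᵥ B = 8 ∧ B 0 ≠ 0) : ∑ X ∈ E, (X.2 0) ^ 2 = 16 * k' := by
  let pm : Finset ℤ := {1, -1}
  let f : Fin k' × ℤ × ℤ → M × (Fin (k' + 1) → ℤ) := fun p => (0, Fin.cons (2 * p.2.1) (Pi.single p.1 (2 * p.2.2)))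
  have hpm : ∀ s, s ∈ pm ↔ s = 1 ∨ s = -1 := by intro s; simp [pm]
  have hf : E = ((Finset.univ : Finset (Fin k')) ×ˢ pm ×ˢ pm).image f := by
    ext ⟨A, B⟩
    rw [hE, Finset.mem_image]
    constructor
    · rintro ⟨⟨a, rfl⟩, ⟨c, hc⟩, -, h8, h0⟩
      have hB : B ⬝ᵥ B = 4 * ∑ i, c i * c i := by
        simp only [dotProduct, hc, Finset.mul_sum]; exact Finset.sum_congr rfl fun i _ => by ring
      rw [hB, Fin.sum_univ_succ] at h8
      simp only [map_smul, LinearMap.smul_apply, smul_eq_mul] at h8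
      have hs : 0 ≤ ∑ i : Fin k', c i.succ * c i.succ := Finset.sum_nonneg fun j _ => mul_self_nonneg _
      have hc0 : c 0 ≠ 0 := by intro e; apply h0; rw [hc, e]; rfl
      have hc1 : 0 < c 0 * c 0 := mul_self_pos.2 hc0
      have ha : a = 0 := by
        by_contra hne
        have := hmin a hne
        omega
      subst ha
      simp only [map_zero, mul_zero, zero_add] at h8
      have hc2 : c 0 * c 0 ≠ 2 := by
        intro e
        have : c 0 < 2 := by nlinarith
        have : -2 < c 0 := by nlinarith
        interval_cases c 0 <;> omega
      have hc3 : c 0 * c 0 = 1 := by omega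
      obtain ⟨i, s, hs, ht⟩ := sq_sum_one (fun i : Fin k' => c i.succ) (by omega)
      refine ⟨(i, c 0, s), ?_, ?_⟩
      · simp only [Finset.mem_product, Finset.mem_univ, true_and, hpm]
        exact ⟨mul_self_eq_one_iff.1 hc3, hs⟩
      · refine Prod.ext (by simp [f]) (funext fun j => ?_)
        refine Fin.cases ?_ (fun j => ?_) j
        · simp [f, hc]
        · simp only [f, Fin.cons_succ, hc]
          have := congrFun ht j
          rw [this]
          by_cases hj : j = i
          · subst hj; simp
          · simp [hj]
    · rintro ⟨⟨i, s, t⟩, hp, hX⟩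
      simp only [Finset.mem_product, Finset.mem_univ, true_and, hpm] at hp
      simp only [f, Prod.mk.injEq] at hX
      obtain ⟨rfl, rfl⟩ := hX
      refine ⟨⟨0, by simp⟩, ⟨Fin.cons s (Pi.single i t), fun j => ?_⟩, ?_, ?_, ?_⟩
      · refine Fin.cases (by simp) (fun j => ?_) j
        by_cases hj : j = i
        · subst hj; simp
        · simp [hj]
      · rw [Fin.sum_univ_succ]
        simp only [map_zero, Fin.cons_zero, Fin.cons_succ, Finset.sum_pi_single', Finset.mem_univ, if_true, zero_add]
        rcases hp with ⟨rfl | rfl, rfl | rfl⟩ <;> norm_num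
      · rw [dotProduct, Fin.sum_univ_succ]
        simp only [map_zero, Fin.cons_zero, Fin.cons_succ, zero_add]
        rw [Finset.sum_eq_single i (fun j _ hj => by simp [hj]) (by simp)]
        simp only [Pi.single_eq_same]
        rcases hp with ⟨rfl | rfl, rfl | rfl⟩ <;> norm_num
      · simp only [Fin.cons_zero]; rcases hp.1 with rfl | rfl <;> norm_num
  have hinj : Set.InjOn f ((Finset.univ : Finset (Fin k')) ×ˢ pm ×ˢ pm : Finset _) := by
    rintro ⟨i, s, t⟩ hp ⟨i', s', t'⟩ hp' he
    simp only [Finset.coe_product, Set.mem_prod, Finset.mem_coe, hpm] at hp hp'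
    simp only [f, Prod.mk.injEq, true_and] at he
    have e0 := congrFun he 0
    simp only [Fin.cons_zero] at e0
    have e1 := congrFun he i.succ
    simp only [Fin.cons_succ, Pi.single_eq_same] at e1
    by_cases hi : i = i'
    · subst hi
      simp only [Pi.single_eq_same] at e1
      refine Prod.ext rfl (Prod.ext ?_ ?_) <;> simp only <;> omega
    · rw [Pi.single_eq_of_ne hi] at e1; omega
  rw [hf, Finset.sum_image hinj, Finset.sum_congr rfl (g := fun _ => (4:ℤ))]
  · rw [Finset.sum_const, Finset.card_product, Finset.card_product]
    simp [pm]; ring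
  · rintro ⟨i, s, t⟩ hp
    simp only [Finset.mem_product, hpm] at hp
    simp only [f, Fin.cons_zero]
    rcases hp.2.1 with rfl | rfl <;> norm_num

/-- the odd part of the root sum -/
theorem UM.odd_part (h : UM b) (w : M) (k' : ℕ) [DecidableEq M]
    (O : Finset (M × (Fin (k' + 1) → ℤ)))
    (hO : ∀ A B, (A, B) ∈ O ↔ (∃ a : M, A = w + (2:ℤ) • a) ∧ (∀ i, Odd (B i)) ∧
       4 ∣ b w A + ∑ i, B i ∧ b A A + B ⬝ᵥ B = 8) :
    ∃ K : Finset M, K.card * 2 ^ k' = ∑ X ∈ O, (X.2 0) ^ 2 ∧ (∀ A ∈ K, b A A + (k' + 1) = 8 ∧ ∃ a : M, A = w + (2:ℤ) • a) ∧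
      ∀ A ∈ K, -A ∈ K := by
  have hB : ∀ A B, (A, B) ∈ O → ∀ i, B i = 1 ∨ B i = -1 := by
    intro A B hX i
    obtain ⟨-, ho, -, h8⟩ := (hO A B).1 hX
    have h1 := Finset.single_le_sum (f := fun i => B i * B i) (fun j _ => mul_self_nonneg _) (Finset.mem_univ i)
    have h2 := h.nonneg A
    have h3 : B i * B i ≤ 8 := by simp only [dotProduct] at h8; omega
    have : B i < 3 := by nlinarith
    have : -3 < B i := by nlinarith
    obtain ⟨c, hc⟩ := ho i
    omega
  have hsq : ∀ B : Fin (k' + 1) → ℤ, (∀ i, B i = 1 ∨ B i = -1) → B ⬝ᵥ B = k' + 1 := by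
    intro B hB
    rw [dotProduct, Finset.sum_congr rfl (g := fun _ => (1:ℤ)) (fun i _ => mul_self_eq_one_iff.2 (hB i))]
    simp
  refine ⟨O.image Prod.fst, ?_, ?_, ?_⟩
  · have h1 : ∑ X ∈ O, (X.2 0) ^ 2 = O.card := by
      rw [Finset.sum_congr rfl (g := fun _ => (1:ℤ))]
      · simp
      · rintro ⟨A, B⟩ hX
        rcases hB A B hX 0 with e | e <;> simp [e]
    rw [h1]
    have h2 : O.card = (O.image Prod.fst ×ˢ Fintype.piFinset (fun _ : Fin k' => ({1, -1} : Finset ℤ))).card := by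
      refine Finset.card_bij (fun X _ => (X.1, Fin.tail X.2)) ?_ ?_ ?_
      · rintro ⟨A, B⟩ hX
        simp only [Finset.mem_product, Fintype.mem_piFinset, Finset.mem_insert, Finset.mem_singleton]
        exact ⟨Finset.mem_image.2 ⟨_, hX, rfl⟩, fun i => hB A B hX i.succ⟩
      · rintro ⟨A, B⟩ hX ⟨A', B'⟩ hX' he
        simp only [Prod.mk.injEq] at he
        obtain ⟨rfl, he⟩ := he
        have h3 := ((hO A B).1 hX).2.2.1
        have h4 := ((hO A B').1 hX').2.2.1
        have e1 : ∀ i : Fin k', B i.succ = B' i.succ := fun i => congrFun he i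
        rw [Fin.sum_univ_succ] at h3 h4
        simp only [e1] at h3
        have h5 := hB A B hX 0
        have h6 := hB A B' hX' 0
        refine Prod.ext rfl (funext fun i => Fin.cases ?_ e1 i)
        simp only
        omega
      · rintro ⟨A, s⟩ hs
        simp only [Finset.mem_product, Fintype.mem_piFinset, Finset.mem_insert, Finset.mem_singleton] at hs
        obtain ⟨hA, hs⟩ := hs
        obtain ⟨⟨A', B⟩, hX, rfl⟩ := Finset.mem_image.1 hA
        simp only at *
        obtain ⟨ha, ho, h4, h8⟩ := (hO A' B).1 hX
        have hp : Even (∑ i, (s i - B i.succ)) := Finset.even_sum _ fun i _ => by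
          obtain ⟨c, hc⟩ := ho i.succ
          rcases hs i with e | e <;> rw [e, hc]
          · exact ⟨-c, by ring⟩
          · exact ⟨-c - 1, by ring⟩
        rw [Finset.sum_sub_distrib] at hp
        obtain ⟨d, hd⟩ := hp
        rw [Fin.sum_univ_succ] at h4
        obtain ⟨c0, hc0⟩ := ho 0
        obtain ⟨t, ht, ht4⟩ : ∃ t : ℤ, (t = 1 ∨ t = -1) ∧ 4 ∣ b w A' + (t + ∑ i, s i) := by
          by_cases hh : 4 ∣ b w A' + (1 + ∑ i, s i)
          · exact ⟨1, Or.inl rfl, hh⟩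
          · exact ⟨-1, Or.inr rfl, by omega⟩
        have hpm : ∀ i, (Fin.cons t s : Fin (k' + 1) → ℤ) i = 1 ∨ (Fin.cons t s : Fin (k' + 1) → ℤ) i = -1 := by
          intro i
          refine Fin.cases ?_ (fun i => ?_) i
          · simpa using ht
          · simpa using hs i
        refine ⟨(A', Fin.cons t s), (hO _ _).2 ⟨ha, ?_, ?_, ?_⟩, ?_⟩
        · intro i
          rcases hpm i with e | e <;> rw [e] <;> decide
        · rw [Fin.sum_univ_succ]; simpa using ht4
        · rw [hsq _ hpm, ← hsq _ (hB A' B hX), h8]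
        · simp
    rw [h2, Finset.card_product, Fintype.card_piFinset_const]
    simp
  · intro A hA
    obtain ⟨⟨A', B⟩, hX, rfl⟩ := Finset.mem_image.1 hA
    obtain ⟨ha, ho, h4, h8⟩ := (hO A' B).1 hX
    rw [hsq _ (hB A' B hX)] at h8
    exact ⟨h8, ha⟩
  · intro A hA
    obtain ⟨⟨A', B⟩, hX, rfl⟩ := Finset.mem_image.1 hA
    obtain ⟨⟨a, ha⟩, ho, h4, h8⟩ := (hO A' B).1 hX
    refine Finset.mem_image.2 ⟨(-A', -B), (hO _ _).2 ⟨⟨-a - w, ?_⟩, ?_, ?_, ?_⟩, rfl⟩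
    · rw [ha, smul_sub, smul_neg, two_smul, two_smul]; abel
    · intro i; rw [Pi.neg_apply, odd_neg]; exact ho i
    · simp only [map_neg, Pi.neg_apply, Finset.sum_neg_distrib]; rw [← neg_add]; exact (dvd_neg).2 h4
    · simpa using h8

theorem UM.Mthm (h : UM b) (hmin : ∀ x, x ≠ 0 → 2 ≤ b x x) (h1 : 1 ≤ finrank ℤ M) (h12 : finrank ℤ M ≤ 12) :
    (finrank ℤ M = 8 ∧ EvenL b) ∨ (finrank ℤ M = 12 ∧ ∃ (w : M) (K : Finset M), K.card = 24 ∧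
      (∀ A ∈ K, b A A = 4 ∧ ∃ a : M, A = w + (2:ℤ) • a) ∧ ∀ A ∈ K, -A ∈ K) := by
  classical
  obtain ⟨w, hw⟩ := h.exists_char
  have h8 := h.vdB w hw
  obtain ⟨k', hk⟩ : ∃ k' : ℕ, finrank ℤ M + k' = 15 := ⟨15 - finrank ℤ M, by omega⟩
  obtain ⟨P, b', hu, he, hf, hP, hb⟩ := h.nbrProd w hw k' (by push_cast; omega)
  let R := (hu.finite he 2).toFinset
  have hR : ∀ x, x ∈ R ↔ b' x x = 2 := fun x => by simp [R]
  have hvP : ((0, Pi.single 0 4) : M × (Fin (k' + 1) → ℤ)) ∈ P := by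
    rw [hP]
    refine ⟨⟨0, 0, Pi.single 0 2, by simp, fun i => ?_⟩, by simp⟩
    by_cases hi : i = 0
    · subst hi; simp
    · simp [hi]
  have hv : ∀ X : P, b' X ⟨_, hvP⟩ = X.1.2 0 := by
    intro X
    have := hb X ⟨_, hvP⟩
    simp only [map_zero, dotProduct_single] at this
    omega
  have h60 := hu.sixty he (by omega) R hR ⟨_, hvP⟩
  simp only [hv] at h60
  simp only [Pi.single_eq_same] at h60
  let R' := R.map ⟨Subtype.val, Subtype.val_injective⟩
  have hR' : ∀ A B, (A, B) ∈ R' ↔ (A, B) ∈ P ∧ b A A + B ⬝ᵥ B = 8 := by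
    intro A B
    simp only [R', Finset.mem_map, Function.Embedding.coeFn_mk]
    constructor
    · rintro ⟨X, hX, hXe⟩
      have h2 := hb X X
      rw [(hR X).1 hX, hXe] at h2
      exact ⟨hXe ▸ X.2, by simp only at h2; omega⟩
    · rintro ⟨hp, h2⟩
      refine ⟨⟨_, hp⟩, (hR _).2 ?_, rfl⟩
      have h3 := hb ⟨_, hp⟩ ⟨_, hp⟩
      simp only at h3
      omega
  have hsum : ∑ X ∈ R', (X.2 0) ^ 2 = 240 := by
    rw [Finset.sum_map]; simpa using h60
  rw [← Finset.sum_filter_add_sum_filter_not R' (fun X => Odd (X.2 0)),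
    ← Finset.sum_filter_add_sum_filter_not (R'.filter (fun X => ¬ Odd (X.2 0))) (fun X => X.2 0 ≠ 0)] at hsum
  rw [Finset.sum_eq_zero (s := ((R'.filter (fun X => ¬ Odd (X.2 0))).filter (fun X => ¬ X.2 0 ≠ 0)))
    (fun X hX => by have := (Finset.mem_filter.1 hX).2; push Not at this; rw [this]; rfl)] at hsum
  rw [h.even_part hmin w k' ((R'.filter (fun X => ¬ Odd (X.2 0))).filter (fun X => X.2 0 ≠ 0)) (by
    intro A B
    rw [Finset.mem_filter, Finset.mem_filter, hR', hP]
    simp only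
    constructor
    · rintro ⟨⟨⟨⟨⟨j, a, c, hA, hB⟩, h4⟩, h5⟩, h6⟩, h7⟩
      rw [Int.not_odd_iff_even] at h6
      obtain ⟨d, hd⟩ := h6
      obtain ⟨j', rfl⟩ : ∃ j', j = 2 * j' := ⟨d - c 0, by have := hB 0; omega⟩
      exact ⟨⟨j' • w + a, by rw [hA, smul_add, mul_smul]⟩, ⟨fun i => j' + c i, fun i => by rw [hB]; ring⟩, h4, h5, h7⟩
    · rintro ⟨⟨a, hA⟩, ⟨c, hB⟩, h4, h5, h7⟩
      exact ⟨⟨⟨⟨⟨0, a, c, by simpa using hA, fun i => by simpa using hB i⟩, h4⟩, h5⟩, by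
        rw [hB, Int.not_odd_iff_even]; exact even_two_mul _⟩, h7⟩)] at hsum
  obtain ⟨K, hK, hK4, hKn⟩ := h.odd_part w k' (R'.filter (fun X => Odd (X.2 0))) (by
    intro A B
    rw [Finset.mem_filter, hR', hP]
    simp only
    constructor
    · rintro ⟨⟨⟨⟨j, a, c, hA, hB⟩, h4⟩, h5⟩, h6⟩
      obtain ⟨d, hd⟩ := h6
      obtain ⟨j', rfl⟩ : ∃ j', j = 2 * j' + 1 := ⟨d - c 0, by have := hB 0; omega⟩
      exact ⟨⟨j' • w + a, by rw [hA, smul_add, add_smul, mul_smul, one_smul]; abel⟩, fun i => ⟨j' + c i, by rw [hB]; ring⟩, h4, h5⟩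
    · rintro ⟨⟨a, hA⟩, hB, h4, h5⟩
      choose c hc using hB
      exact ⟨⟨⟨⟨1, a, c, by simpa using hA, fun i => by rw [hc]; ring⟩, h4⟩, h5⟩, hc 0 ▸ ⟨_, rfl⟩⟩)
  rw [← hK] at hsum
  have hKc : K.card * 2 ^ k' = 16 * finrank ℤ M := by
    zify
    have : (finrank ℤ M : ℤ) + k' = 15 := by exact_mod_cast hk
    linarith
  have hKne : K.card ≠ 0 := by intro e; rw [e] at hKc; omega
  obtain ⟨A0, hA0⟩ := Finset.card_ne_zero.1 hKne
  have hA1 := hK4 A0 hA0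
  have hge := h.nonneg A0
  have h2 : 8 ≤ finrank ℤ M := by omega
  have heven : finrank ℤ M ≠ 8 → Even K.card := by
    intro hne
    obtain ⟨H, -, -, -, hc⟩ := half_system K hKn (by
      intro y hy e
      have h3 := (hK4 y hy).1
      have h4 : y = 0 := by
        have : (2:ℤ) • y = 0 := by rw [two_smul]; nth_rewrite 2 [e]; abel
        simpa using this
      rw [h4] at h3
      simp at h3
      omega)
    rw [hc]; exact even_two_mul _
  generalize hr : finrank ℤ M = r at *
  interval_cases r
  · left
    refine ⟨rfl, fun x => ?_⟩
    have hA : A0 = 0 := by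
      by_contra hne
      have := h.pos A0 hne
      omega
    obtain ⟨a, ha⟩ := hA1.2
    have hwa : w = (2:ℤ) • (-a) := by
      rw [hA] at ha; rw [smul_neg]; exact eq_neg_of_add_eq_zero_left ha.symm
    have := hw x
    rw [hwa, map_smul, LinearMap.smul_apply, smul_eq_mul, Int.even_add] at this
    exact this.2 (even_two_mul _)
  · obtain rfl : k' = 6 := by omega
    omega
  · obtain rfl : k' = 5 := by omega
    obtain ⟨c, hc⟩ := heven (by norm_num)
    omega
  · obtain rfl : k' = 4 := by omega
    obtain ⟨c, hc⟩ := heven (by norm_num)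
    omega
  · obtain rfl : k' = 3 := by omega
    right
    exact ⟨rfl, w, K, by omega, fun A hA => ⟨by have := (hK4 A hA).1; push_cast at this; omega, (hK4 A hA).2⟩, hKn⟩

end MThm


section Frames
variable {M : Type*} [AddCommGroup M] [Module.Free ℤ M] [Module.Finite ℤ M] {b : M →ₗ[ℤ] M →ₗ[ℤ] ℤ}

/-- good frames -/
structure GF (b : M →ₗ[ℤ] M →ₗ[ℤ] ℤ) {r : ℕ} (g : Fin r → M) (hh : M) (z : Fin r → Fin r → M) : Prop where
  orth : ∀ i j, b (g i) (g j) = if i = j then 4 else 0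
  half : ∀ i j, g i - g j = (2:ℤ) • z i j
  quart : (4:ℤ) • hh = ∑ i, g i
  exp : ∀ x, (4:ℤ) • x = ∑ i, b x (g i) • g i

theorem UM.goodFrame (h : UM b) (hmin : ∀ x, x ≠ 0 → 2 ≤ b x x) {r : ℕ} (hr : finrank ℤ M = r) (hr0 : 0 < r) (H : Finset M)
    (hc : H.card = r) (hq : ∀ x ∈ H, b x x = 4) (ho : ∀ x ∈ H, ∀ y ∈ H, x ≠ y → b x y = 0)
    (h2 : ∀ x ∈ H, ∀ y ∈ H, ∃ z, x - y = (2:ℤ) • z) : ∃ (g : Fin r → M) (hh : M) (z : Fin r → Fin r → M), GF b g hh z := by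
  classical
  let en := Finset.equivFinOfCardEq hc
  let g0 : Fin r → M := fun i => (en.symm i : M)
  have hg0 : ∀ i, g0 i ∈ H := fun i => (en.symm i).2
  have hinj : ∀ i j, g0 i = g0 j → i = j := fun i j hij => en.symm.injective (Subtype.ext hij)
  have hsum : ∀ f : M → M, ∑ y ∈ H, f y = ∑ i, f (g0 i) := by
    intro f
    rw [← Finset.sum_coe_sort, ← Equiv.sum_comp en.symm]
  have hexp : ∀ x, (4:ℤ) • x = ∑ i, b x (g0 i) • g0 i := by
    intro x
    rw [h.frame_exp H 4 (by norm_num) hq ho (by omega) x, hsum]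
  obtain ⟨x, hx⟩ : ∃ x, Odd (b x (g0 ⟨0, hr0⟩)) := by
    by_contra hcon
    push Not at hcon
    obtain ⟨v, hv⟩ := h.div 2 (by norm_num) (g0 ⟨0, hr0⟩) (fun u => by
      have := hcon u
      rw [h.symm, ← even_iff_two_dvd, ← Int.not_odd_iff_even]; exact this)
    have h4 := hq _ (hg0 ⟨0, hr0⟩)
    rw [hv] at h4
    simp only [map_smul, LinearMap.smul_apply, smul_eq_mul] at h4
    have h5 := hmin v (by rintro rfl; simp at h4)
    omega
  have hxo : ∀ i, Odd (b x (g0 i)) := by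
    intro i
    obtain ⟨z, hz⟩ := h2 _ (hg0 i) _ (hg0 ⟨0, hr0⟩)
    have := congrArg (b x) hz
    simp only [map_sub, map_smul, smul_eq_mul] at this
    obtain ⟨c, hc⟩ := hx
    exact ⟨c + b x z, by omega⟩
  have hm : ∀ i, ∃ s m : ℤ, (s = 1 ∨ s = -1) ∧ b x (s • g0 i) = 1 + 4 * m := by
    intro i
    obtain ⟨c, hc⟩ := hxo i
    rcases Int.even_or_odd' c with ⟨d, hd | hd⟩
    · exact ⟨1, d, Or.inl rfl, by rw [one_smul]; omega⟩
    · exact ⟨-1, -d - 1, Or.inr rfl, by rw [map_smul, smul_eq_mul]; omega⟩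
  choose s m hs hsm using hm
  have hss : ∀ i, s i * s i = 1 := fun i => mul_self_eq_one_iff.2 (hs i)
  have hex : ∀ x, (4:ℤ) • x = ∑ i, b x (s i • g0 i) • (s i • g0 i) := by
    intro x
    rw [hexp]
    refine Finset.sum_congr rfl fun i _ => ?_
    rw [map_smul, smul_eq_mul, smul_smul, mul_right_comm, hss, one_mul]
  have hz : ∀ i j, ∃ z, s i • g0 i - s j • g0 j = (2:ℤ) • z := by
    intro i j
    obtain ⟨z, hz⟩ := h2 _ (hg0 i) _ (hg0 j)
    rcases hs i with e | e <;> rcases hs j with e' | e' <;> rw [e, e']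
    · exact ⟨z, by linear_combination (norm := module) hz⟩
    · exact ⟨z + g0 j, by linear_combination (norm := module) hz⟩
    · exact ⟨-z - g0 j, by linear_combination (norm := module) -hz⟩
    · exact ⟨-z, by linear_combination (norm := module) -hz⟩
  choose z hz using hz
  refine ⟨fun i => s i • g0 i, x - ∑ i, m i • (s i • g0 i), z, ?_, hz, ?_, hex⟩
  · intro i j
    simp only [map_smul, LinearMap.smul_apply, smul_eq_mul]
    split_ifs with hij
    · subst hij
      rw [hq _ (hg0 i), ← mul_assoc, hss]; rfl
    · rw [ho _ (hg0 i) _ (hg0 j) (fun e => hij (hinj _ _ e))]; simp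
  · rw [smul_sub, hex, Finset.smul_sum, ← Finset.sum_sub_distrib]
    refine Finset.sum_congr rfl fun i _ => ?_
    rw [hsm]; module

theorem UM.frame12 (h : UM b) (hmin : ∀ x, x ≠ 0 → 2 ≤ b x x) (hr : finrank ℤ M = 12)
    (w : M) (K : Finset M) (hK : K.card = 24) (hK4 : ∀ A ∈ K, b A A = 4 ∧ ∃ a : M, A = w + (2:ℤ) • a)
    (hKn : ∀ A ∈ K, -A ∈ K) : ∃ (g : Fin 12 → M) (hh : M) (z : Fin 12 → Fin 12 → M), GF b g hh z := by
  classical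
  obtain ⟨H, hHK, hH1, hH2, hc⟩ := half_system K hKn (by
      intro y hy e
      have h3 := (hK4 y hy).1
      have h4 : y = 0 := by
        have : (2:ℤ) • y = 0 := by rw [two_smul]; nth_rewrite 2 [e]; abel
        simpa using this
      rw [h4] at h3
      simp at h3)
  have hcong : ∀ x ∈ H, ∀ y ∈ H, ∃ z, x - y = (2:ℤ) • z := by
    intro x hx y hy
    obtain ⟨a, ha⟩ := (hK4 x (hHK hx)).2
    obtain ⟨c, hc⟩ := (hK4 y (hHK hy)).2
    exact ⟨a - c, by rw [ha, hc, smul_sub]; abel⟩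
  refine h.goodFrame hmin hr (by norm_num) H (by omega) (fun x hx => (hK4 x (hHK hx)).1) ?_ hcong
  intro x hx y hy hne
  obtain ⟨z, hz⟩ := hcong x hx y hy
  refine (h.short_pair 2 hmin x y z hz ?_ ?_ hne ?_).2.2
  · rw [(hK4 x (hHK hx)).1]; norm_num
  · rw [(hK4 y (hHK hy)).1]; norm_num
  · rintro rfl; exact hH2 y hy hx

theorem UM.frame8 (h : UM b) (he : EvenL b) (hr : finrank ℤ M = 8) :
    ∃ (g : Fin 8 → M) (hh : M) (z : Fin 8 → Fin 8 → M), GF b g hh z := by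
  classical
  have hmin : ∀ x, x ≠ 0 → 2 ≤ b x x := by
    intro x hx
    have := h.pos x hx
    obtain ⟨c, hc⟩ := he x
    omega
  let A := (h.finite he 2).toFinset
  let X := (h.finite he 4).toFinset
  have hA : ∀ x, x ∈ A ↔ b x x = 2 := fun x => by simp [A]
  have hX : ∀ x, x ∈ X ↔ b x x = 4 := fun x => by simp [X]
  obtain ⟨c1, c2⟩ := h.count8 he hr A X hA hX
  obtain ⟨x, hx⟩ : X.Nonempty := by rw [← Finset.card_ne_zero, c2]; norm_num
  rw [hX] at hx
  rcases h.short_rep hr 2 (by norm_num) hmin A X (by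
    intro x
    rw [hA]
    obtain ⟨c, hc⟩ := he x
    omega) (by intro x; rw [hX]; norm_num) (by rw [c1, c2]; norm_num) x with ⟨z, rfl⟩ | ⟨y, hy0, hy, z, hz⟩ | ⟨H, hc, hH, ho, -⟩
  · simp only [map_smul, LinearMap.smul_apply, smul_eq_mul] at hx
    have h5 := hmin z (by rintro rfl; simp at hx)
    omega
  · have := (h.short_pair 2 hmin x y z hz (by omega) (by omega) (by rintro rfl; omega) (by
      rintro rfl; simp at hx; omega)).2.1
    omega
  · refine h.goodFrame hmin hr (by norm_num) H hc (fun x hx => by rw [(hH x hx).1]; norm_num) ho ?_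
    intro g hg g' hg'
    obtain ⟨a, ha⟩ := (hH g hg).2
    obtain ⟨c, hc⟩ := (hH g' hg').2
    exact ⟨c - a, by rw [smul_sub, ← ha, ← hc]; abel⟩

end Frames


section Iso
variable {M : Type*} [AddCommGroup M] [Module.Free ℤ M] [Module.Finite ℤ M] {b : M →ₗ[ℤ] M →ₗ[ℤ] ℤ}

def E8Inv : Matrix (Fin 8) (Fin 8) ℤ :=
  !![4,5,7,10,8,6,4,2;
     5,8,10,15,12,9,6,3;
     7,10,14,20,16,12,8,4;
     10,15,20,30,24,18,12,6;
     8,12,16,24,20,15,10,5;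
     6,9,12,18,15,12,8,4;
     4,6,8,12,10,8,6,3;
     2,3,4,6,5,4,3,2]

def E8C : Matrix (Fin 8) (Fin 8) ℤ :=
  !![1,-1,-1,-1,-1,-1,-1,1;
     2,2,0,0,0,0,0,0;
     -2,2,0,0,0,0,0,0;
     0,-2,2,0,0,0,0,0;
     0,0,-2,2,0,0,0,0;
     0,0,0,-2,2,0,0,0;
     0,0,0,0,-2,2,0,0;
     0,0,0,0,0,-2,2,0]

theorem E8C_gram : E8C * E8Cᵀ = (4:ℤ) • E8M := by decide +kernel
theorem E8Inv_mul : E8Inv * E8M = 1 := by decide +kernel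
theorem E8M_symm : E8Mᵀ = E8M := by decide +kernel
theorem E8C_inv : E8Cᵀ * E8Inv * E8C = (4:ℤ) • (1 : Matrix (Fin 8) (Fin 8) ℤ) := by decide +kernel

theorem GF.zero {r : ℕ} {g : Fin r → M} {hh : M} {z : Fin r → Fin r → M} (G : GF b g hh z) (x : M)
    (hx : ∀ i, b x (g i) = 0) : x = 0 := by
  have := G.exp x
  simp only [hx, zero_smul, Finset.sum_const_zero] at this
  simpa using this

theorem UM.isoE8 (h : UM b) (he : EvenL b) (hr : finrank ℤ M = 8) :
    ∃ e : M ≃ₗ[ℤ] (Fin 8 → ℤ), ∀ x y : M, b x y = (e x) ⬝ᵥ (E8M *ᵥ (e y)) := by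
  obtain ⟨g, hh, z, G⟩ := h.frame8 he hr
  obtain ⟨α, hα⟩ : ∃ α : Fin 8 → M, ∀ i, (4:ℤ) • α i = ∑ j, E8C i j • g j := by
    have hq := G.quart
    rw [Fin.sum_univ_eight] at hq
    have hz := G.half
    refine ⟨![hh - (z 1 2 + g 2) - (z 3 4 + g 4) - (z 5 6 + g 6), z 0 1 + g 1, z 1 0, z 2 1, z 3 2, z 4 3, z 5 4, z 6 5], fun i => ?_⟩
    rw [Fin.sum_univ_eight]
    fin_cases i <;> simp [E8C]
    · linear_combination (norm := module) hq + (2:ℤ) • hz 1 2 + (2:ℤ) • hz 3 4 + (2:ℤ) • hz 5 6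
    · linear_combination (norm := module) (-2:ℤ) • hz 0 1
    · linear_combination (norm := module) (-2:ℤ) • hz 1 0
    · linear_combination (norm := module) (-2:ℤ) • hz 2 1
    · linear_combination (norm := module) (-2:ℤ) • hz 3 2
    · linear_combination (norm := module) (-2:ℤ) • hz 4 3
    · linear_combination (norm := module) (-2:ℤ) • hz 5 4
    · linear_combination (norm := module) (-2:ℤ) • hz 6 5
  have hbα : ∀ x i, 4 * b x (α i) = (E8C *ᵥ (fun j => b x (g j))) i := by
    intro x i
    have := congrArg (b x) (hα i)
    simp only [map_smul, map_sum, smul_eq_mul] at this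
    rw [this]; rfl
  have hgram : ∀ i j, b (α i) (α j) = E8M i j := by
    intro i j
    have h1 := hbα (α i) j
    have h2 : ∀ k, 4 * b (α i) (g k) = 4 * E8C i k := by
      intro k
      rw [h.symm, ← smul_eq_mul, ← map_smul, hα]
      simp only [map_sum, map_smul, G.orth, smul_eq_mul]
      rw [Finset.sum_eq_single k (fun j _ hj => by simp [hj.symm]) (by simp)]
      simp; ring
    have h3 : ∀ k, b (α i) (g k) = E8C i k := fun k => by have := h2 k; omega
    simp only [h3] at h1
    have h4 := congrFun (congrFun E8C_gram j) i
    rw [Matrix.mul_apply] at h4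
    have h5 : 4 * b (α i) (α j) = 4 * E8M j i := by rw [h1]; exact h4
    have h6 := congrFun (congrFun E8M_symm i) j
    rw [Matrix.transpose_apply] at h6
    omega
  have hz : ∀ x, (∀ i, b x (α i) = 0) → x = 0 := by
    intro x hx
    refine G.zero x fun i => ?_
    have h1 : E8C *ᵥ (fun j => b x (g j)) = 0 := by
      funext i; rw [← hbα, hx]; rfl
    have h2 := congrArg (fun v => (E8Cᵀ * E8Inv) *ᵥ v) h1
    simp only [Matrix.mulVec_mulVec, Matrix.mulVec_zero, E8C_inv, Matrix.smul_mulVec, Matrix.one_mulVec] at h2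
    have := congrFun h2 i
    simpa using this
  let f : M →ₗ[ℤ] (Fin 8 → ℤ) := (Matrix.toLin' E8Inv).comp (LinearMap.pi fun i => b.flip (α i))
  have hf : ∀ x, f x = E8Inv *ᵥ (fun i => b x (α i)) := fun x => rfl
  let k : (Fin 8 → ℤ) →ₗ[ℤ] M := Fintype.linearCombination ℤ α
  have hk : ∀ y, k y = ∑ i, y i • α i := fun y => rfl
  have hbk : ∀ y, (fun i => b (k y) (α i)) = E8M *ᵥ y := by
    intro y
    funext i
    rw [hk]
    simp only [map_sum, map_smul, LinearMap.sum_apply, LinearMap.smul_apply, smul_eq_mul, Matrix.mulVec, dotProduct]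
    refine Finset.sum_congr rfl fun j _ => ?_
    rw [h.symm, hgram, mul_comm]
  have hfk : ∀ y, f (k y) = y := by
    intro y
    rw [hf, hbk, Matrix.mulVec_mulVec, E8Inv_mul, Matrix.one_mulVec]
  have hEI : E8M * E8Inv = 1 := mul_eq_one_comm.1 E8Inv_mul
  have hkf : ∀ x, k (f x) = x := by
    intro x
    rw [← sub_eq_zero]
    refine hz _ fun i => ?_
    have := congrFun (hbk (f x)) i
    rw [hf, Matrix.mulVec_mulVec, hEI, Matrix.one_mulVec] at this
    rw [map_sub, LinearMap.sub_apply, hf, this, sub_self]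
  refine ⟨LinearEquiv.ofLinear f k (LinearMap.ext hfk) (LinearMap.ext hkf), fun x y => ?_⟩
  change b x y = f x ⬝ᵥ (E8M *ᵥ f y)
  rw [← hbk, hkf]
  conv_lhs => rw [← hkf x, hk]
  simp only [map_sum, map_smul, LinearMap.sum_apply, LinearMap.smul_apply, smul_eq_mul, dotProduct]
  exact Finset.sum_congr rfl fun j _ => by rw [h.symm]

theorem UM.isoD12 (h : UM b) (g : Fin 12 → M) (hh : M) (z : Fin 12 → Fin 12 → M) (G : GF b g hh z) :
    ∃ e : M ≃ₗ[ℤ] D12plus, ∀ x y : M, (b x y : ℚ) = ∑ i, (e x : Fin 12 → ℚ) i * (e y : Fin 12 → ℚ) i := by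
  let f : M →ₗ[ℤ] (Fin 12 → ℚ) :=
    { toFun := fun x i => (b x (g i) : ℚ) / 2
      map_add' := fun x y => by
        funext i; simp only [map_add, LinearMap.add_apply, Pi.add_apply]; push_cast; ring
      map_smul' := fun c x => by
        funext i; simp only [map_smul, LinearMap.smul_apply, Pi.smul_apply, smul_eq_mul, RingHom.id_apply, zsmul_eq_mul]; push_cast; ring }
  have hf : ∀ x i, f x i = (b x (g i) : ℚ) / 2 := fun x i => rfl
  have hhg : ∀ i, b hh (g i) = 1 := by
    intro i
    have := congrArg (fun v => b v (g i)) G.quart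
    simp only [map_smul, LinearMap.smul_apply, map_sum, LinearMap.sum_apply, G.orth, smul_eq_mul] at this
    simp at this
    omega
  have hfh : f hh = fun _ => (1:ℚ) / 2 := by
    funext i; rw [hf, hhg]; norm_num
  have hsum : ∀ x, ∑ i, b x (g i) = 4 * b x hh := by
    intro x
    rw [← map_sum, ← G.quart, map_smul, smul_eq_mul]
  have hev : ∀ x, Even (b x (g 0)) → f x ∈ D12plus := by
    intro x hx
    have : ∀ i, ∃ c, b x (g i) = 2 * c := by
      intro i
      have h1 := congrArg (b x) (G.half i 0)
      simp only [map_sub, map_smul, smul_eq_mul] at h1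
      obtain ⟨d, hd⟩ := hx
      exact ⟨d + b x (z i 0), by omega⟩
    choose c hc using this
    have hfc : ∀ i, f x i = c i := by intro i; rw [hf, hc]; push_cast; ring
    refine Submodule.subset_span (Or.inl ⟨fun i => ⟨c i, hfc i⟩, b x hh, ?_⟩)
    have h2 := hsum x
    simp only [hc, ← Finset.mul_sum] at h2
    have h3 : ∑ i, c i = 2 * b x hh := by omega
    simp only [hfc]
    exact_mod_cast h3
  have hhm : f hh ∈ D12plus := by rw [hfh]; exact Submodule.subset_span (Or.inr rfl)
  have hmem : ∀ x, f x ∈ D12plus := by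
    intro x
    rcases Int.even_or_odd (b x (g 0)) with hx | hx
    · exact hev x hx
    · have : f x = f (x - hh) + f hh := by rw [map_sub]; abel
      rw [this]
      refine Submodule.add_mem _ (hev _ ?_) hhm
      rw [map_sub, LinearMap.sub_apply, hhg]
      exact hx.sub_odd odd_one
  let F : M →ₗ[ℤ] D12plus := f.codRestrict D12plus hmem
  have hle : D12plus ≤ LinearMap.range f := by
    refine Submodule.span_le.2 ?_
    rintro v (⟨hv, m, hm⟩ | hv)
    · choose k hk using hv
      have hkm : ∑ i, k i = 2 * m := by
        simp only [hk] at hm; exact_mod_cast hm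
      have h2 : (2:ℤ) • (∑ i, k i • z i 0 + m • g 0) = ∑ i, k i • g i := by
        rw [smul_add, Finset.smul_sum, smul_smul, ← hkm, Finset.sum_smul, ← Finset.sum_add_distrib]
        refine Finset.sum_congr rfl fun i _ => ?_
        rw [smul_comm, ← G.half, ← smul_add]; congr 1; abel
      refine ⟨∑ i, k i • z i 0 + m • g 0, ?_⟩
      funext j
      have h3 := congrArg (fun v => b v (g j)) h2
      simp only [map_smul b, LinearMap.smul_apply, map_sum b, LinearMap.sum_apply, G.orth, smul_eq_mul] at h3
      simp only [mul_ite, mul_zero, Finset.sum_ite_eq', Finset.mem_univ, if_true] at h3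
      have h4 : b (∑ i, k i • z i 0 + m • g 0) (g j) = 2 * k j := by omega
      rw [hf, h4, hk]; push_cast; ring
    · rw [Set.mem_singleton_iff] at hv
      exact ⟨hh, by rw [hfh, hv]⟩
  have hbij : Function.Bijective F := by
    constructor
    · rw [← LinearMap.ker_eq_bot, LinearMap.ker_eq_bot']
      intro x hx
      refine G.zero x fun i => ?_
      have h1 : f x = 0 := congrArg Subtype.val hx
      have h2 := congrFun h1 i
      rw [hf] at h2
      simpa using h2
    · rintro ⟨v, hv⟩
      obtain ⟨x, hx⟩ := hle hv
      exact ⟨x, Subtype.ext hx⟩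
  refine ⟨LinearEquiv.ofBijective F hbij, fun x y => ?_⟩
  change (b x y : ℚ) = ∑ i, f x i * f y i
  have h1 := congrArg (fun v => b v y) (G.exp x)
  simp only [map_smul b, LinearMap.smul_apply, map_sum b, LinearMap.sum_apply, smul_eq_mul] at h1
  simp only [h.symm _ y] at h1
  rw [h.symm y x] at h1
  have h2 : (4:ℚ) * b x y = ∑ i, (b x (g i) : ℚ) * b y (g i) := by
    rw [← Int.cast_ofNat, ← Int.cast_mul]
    norm_num at h1 ⊢
    rw [← Int.cast_ofNat, ← Int.cast_mul, h1]; push_cast; rfl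
  simp only [hf]
  rw [eq_comm, Finset.sum_congr rfl (g := fun i => (1/4 : ℚ) * ((b x (g i) : ℚ) * b y (g i))) (fun i _ => by ring), ← Finset.mul_sum, ← h2]
  ring

end Iso


section Inv
variable {L : Type*} [AddCommGroup L] [Module.Free ℤ L] [Module.Finite ℤ L] {b : L →ₗ[ℤ] L →ₗ[ℤ] ℤ}

theorem two_cancel {x y : L} (h : (2:ℤ) • x = (2:ℤ) • y) : x = y :=
  smul_right_injective L (by norm_num : (2:ℤ) ≠ 0) h

/-- extension of functionals from the anti-invariant part -/
theorem ext_anti (φ : L →ₗ[ℤ] L) (S : Submodule ℤ L) (hS : ∀ x, x ∈ S ↔ φ x = -x) (g : S →ₗ[ℤ] ℤ) :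
    ∃ F : L →ₗ[ℤ] ℤ, ∀ s : S, F s = g s := by
  let p : L →ₗ[ℤ] L := φ + LinearMap.id
  obtain ⟨σ, hσ⟩ := Module.projective_lifting_property p.rangeRestrict (LinearMap.id : p.range →ₗ[ℤ] p.range) p.surjective_rangeRestrict
  have hm : ∀ x, (LinearMap.id - σ.comp p.rangeRestrict : L →ₗ[ℤ] L) x ∈ S := by
    intro x
    have h1 := congrArg Subtype.val (LinearMap.congr_fun hσ (p.rangeRestrict x))
    have h2 : p (σ (p.rangeRestrict x)) = p x := h1
    rw [hS]
    have h3 : p ((LinearMap.id - σ.comp p.rangeRestrict : L →ₗ[ℤ] L) x) = 0 := by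
      rw [LinearMap.sub_apply, map_sub, LinearMap.comp_apply, h2]; simp
    exact eq_neg_of_add_eq_zero_left h3
  refine ⟨g.comp (LinearMap.codRestrict S _ hm), fun s => ?_⟩
  rw [LinearMap.comp_apply]
  congr 1
  apply Subtype.ext
  rw [LinearMap.codRestrict_apply, LinearMap.sub_apply, LinearMap.comp_apply]
  have : p.rangeRestrict (s : L) = 0 := by
    apply Subtype.ext
    change φ s + s = 0
    rw [(hS s).1 s.2]; abel
  rw [this]; simp

theorem UM.anti_even (h : UM b) (φ : L →ₗ[ℤ] L) (h2 : ∀ x, φ (φ x) = x) (hi : ∀ x y, b (φ x) (φ y) = b x y)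
    (e : L) (he : φ e = -e) (hev : ∀ s, φ s = -s → 2 ∣ b e s) : ∃ z, e = z - φ z := by
  have hadj : ∀ x y, b (φ x) y = b x (φ y) := fun x y => by rw [← hi, h2]
  let S : Submodule ℤ L := LinearMap.ker (φ + LinearMap.id)
  have hS : ∀ x, x ∈ S ↔ φ x = -x := fun x => by
    rw [LinearMap.mem_ker]; exact add_eq_zero_iff_eq_neg
  let g : S →ₗ[ℤ] ℤ :=
    { toFun := fun u => b e u / 2
      map_add' := fun x y => by
        rw [Submodule.coe_add, map_add, Int.add_ediv_of_dvd_left (hev x ((hS x).1 x.2))]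
      map_smul' := fun c x => by
        simp only [Submodule.coe_smul, map_smul, smul_eq_mul, RingHom.id_apply]
        rw [Int.mul_ediv_assoc _ (hev x ((hS x).1 x.2))] }
  obtain ⟨F, hF⟩ := ext_anti φ S hS g
  obtain ⟨z, hz⟩ := h.unim F
  refine ⟨z, h.ext _ _ fun u => ?_⟩
  have hu : φ (u - φ u) = -(u - φ u) := by rw [map_sub, h2]; abel
  have h3 : b z (u - φ u) = b e (u - φ u) / 2 := by
    rw [hz]; exact hF ⟨_, (hS _).2 hu⟩
  have h4 := hev _ hu
  have h5 : b e (φ u) = - b e u := by rw [← hadj, he]; simp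
  rw [map_sub b, LinearMap.sub_apply, hadj]
  simp only [map_sub, h5] at h3 h4
  omega

theorem UM.dichotomy (h : UM b) (hev : EvenL b) (hr : finrank ℤ L = 24) (hn2 : ∀ x, b x x ≠ 2)
    (φ : L →ₗ[ℤ] L) (h2 : ∀ x, φ (φ x) = x) (hi : ∀ x y, b (φ x) (φ y) = b x y)
    (s t : L) (hs : φ s = -s) (ht : φ t = t) : (∃ z, s = z - φ z) ∨ (∃ z, t = z + φ z) := by
  classical
  have hadj : ∀ x y, b (φ x) y = b x (φ y) := fun x y => by rw [← hi, h2]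
  have hmin : ∀ x, x ≠ 0 → 4 ≤ b x x := by
    intro x hx
    have := h.pos x hx
    have := hn2 x
    obtain ⟨c, hc⟩ := hev x
    omega
  let A4 := (h.finite hev 4).toFinset
  let A6 := (h.finite hev 6).toFinset
  let X := (h.finite hev 8).toFinset
  have hA4 : ∀ x, x ∈ A4 ↔ b x x = 4 := fun x => by simp [A4]
  have hA6 : ∀ x, x ∈ A6 ↔ b x x = 6 := fun x => by simp [A6]
  have hX : ∀ x, x ∈ X ↔ b x x = 8 := fun x => by simp [X]
  obtain ⟨c1, c2, c3⟩ := h.count24 hev hr hn2 A4 A6 X hA4 hA6 hX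
  have hdisj : Disjoint A4 A6 := by
    rw [Finset.disjoint_left]; intro x hx hx'; rw [hA4] at hx; rw [hA6] at hx'; omega
  have main : ∀ y z, s + t - y = (2:ℤ) • z → (φ y = y ∨ φ y = -y) → (∃ z, s = z - φ z) ∨ (∃ z, t = z + φ z) := by
    intro y z hz hy
    have hz' := congrArg φ hz
    rw [map_sub, map_add, map_smul, hs, ht] at hz'
    rcases hy with hy | hy
    · left
      refine ⟨z, two_cancel ?_⟩
      rw [hy] at hz'
      linear_combination (norm := module) hz - hz'
    · right
      refine ⟨z, two_cancel ?_⟩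
      rw [hy] at hz'
      linear_combination (norm := module) hz + hz'
  have hcong : ∀ y z, s + t - y = (2:ℤ) • z → y - φ y = (2:ℤ) • (s - z + φ z) := by
    intro y z hz
    have hz' := congrArg φ hz
    rw [map_sub, map_add, map_smul, hs, ht] at hz'
    linear_combination (norm := module) hz' - hz
  rcases h.short_rep hr 4 (by norm_num) hmin (A4 ∪ A6) X (by
    intro x
    rw [Finset.mem_union, hA4, hA6]
    by_cases hx : x = 0
    · subst hx; simp
    have := hmin x hx
    obtain ⟨c, hc⟩ := hev x
    omega) (by intro x; rw [hX]; norm_num) (by rw [Finset.card_union_of_disjoint hdisj, c1, c2, c3]; norm_num) (s + t)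
    with ⟨z, hz⟩ | ⟨y, hy0, hy, z, hz⟩ | ⟨H, hc, hH, ho, hex⟩
  · exact main 0 z (by rw [sub_zero, hz]) (Or.inl (map_zero _))
  · refine main y z hz ?_
    by_contra hcon
    push Not at hcon
    have := (h.short_pair 4 hmin y (φ y) _ (hcong y z hz) (by omega) (by rw [hi]; omega) (fun e => hcon.1 e.symm)
      (fun e => hcon.2 (neg_eq_iff_eq_neg.1 e.symm))).1
    omega
  · by_contra hno
    have hno1 : ¬ ∃ z, s = z - φ z := fun hh => hno (Or.inl hh)
    have hnf : ∀ g ∈ H, φ g ≠ g ∧ φ g ≠ -g := by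
      intro g hg
      obtain ⟨z, hz⟩ := (hH g hg).2
      exact ⟨fun e => hno (main g z hz (Or.inl e)), fun e => hno (main g z hz (Or.inr e))⟩
    obtain ⟨f, hf⟩ : H.Nonempty := by rw [← Finset.card_ne_zero, hc]; norm_num
    obtain ⟨zf, hzf⟩ := (hH f hf).2
    have hef := hcong f zf hzf
    obtain ⟨s', hs', hodd⟩ : ∃ s', φ s' = -s' ∧ ¬ 2 ∣ b (s - zf + φ zf) s' := by
      by_contra hcon
      push Not at hcon
      obtain ⟨z, hz⟩ := h.anti_even φ h2 hi (s - zf + φ zf) (by rw [map_add, map_sub, h2, hs]; abel) hcon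
      refine hno1 ⟨z + zf, ?_⟩
      rw [map_add]
      linear_combination (norm := module) hz
    have hfo : ¬ 2 ∣ b f s' := by
      have h3 := congrArg (fun v => b v s') hef
      simp only [map_sub b, map_smul b, LinearMap.sub_apply, LinearMap.smul_apply, smul_eq_mul, hadj f s', hs', map_neg] at h3
      omega
    have hgo : ∀ g ∈ H, ∃ c, b s' g = 2 * c + 1 := by
      intro g hg
      obtain ⟨zg, hzg⟩ := (hH g hg).2
      have h3 := congrArg (b s') (hzg)
      have h4 := congrArg (b s') (hzf)
      simp only [map_sub, map_smul, smul_eq_mul] at h3 h4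
      rw [h.symm] at hfo
      exact ⟨(b s' g - 1) / 2, by omega⟩
    have ha : ∀ g ∈ H, ∃ a, b s' g * b s' g = 1 + 8 * a := by
      intro g hg
      obtain ⟨c, hc⟩ := hgo g hg
      obtain ⟨d, hd⟩ := Int.even_mul_succ_self c
      exact ⟨d, by rw [hc]; linear_combination 4 * hd⟩
    let a : L → ℤ := fun g => (b s' g * b s' g - 1) / 8
    have ha' : ∀ g ∈ H, b s' g * b s' g = 1 + 8 * a g := by
      intro g hg
      obtain ⟨d, hd⟩ := ha g hg
      simp only [a]; omega
    have hpar := h.parseval H 8 (by norm_num) (fun g hg => by rw [(hH g hg).1]; norm_num) ho (by omega) s' s'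
    rw [Finset.sum_congr rfl ha', Finset.sum_add_distrib, ← Finset.mul_sum, Finset.sum_const, hc] at hpar
    have haφ : ∀ g, a (φ g) = a g := by
      intro g; simp only [a]; rw [← hadj, hs']; simp
    have han : ∀ g, a (-g) = a g := by intro g; simp [a]
    let τ : L → L := fun g => if φ g ∈ H then φ g else -φ g
    have hneg : ∀ g ∈ H, -g ∉ H := by
      intro g hg hg'
      have h8 := (hH g hg).1
      have hne : g ≠ -g := by
        intro e
        have : g = 0 := two_cancel (by rw [two_smul]; nth_rewrite 2 [e]; simp)
        rw [this] at h8; simp at h8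
      have := ho g hg _ hg' hne
      simp at this; omega
    have hτH : ∀ g ∈ H, τ g ∈ H := by
      intro g hg
      simp only [τ]
      split_ifs with hh
      · exact hh
      · obtain ⟨z, hz⟩ := (hH g hg).2
        have hz2 := hcong g z hz
        exact (hex (φ g) (by rw [hi]; exact (hH g hg).1) ⟨s + φ z, by linear_combination (norm := module) hz + hz2⟩).resolve_left hh
    have hττ : ∀ g ∈ H, τ (τ g) = g := by
      intro g hg
      by_cases hh : φ g ∈ H
      · have e : τ g = φ g := if_pos hh
        rw [e]; simp only [τ, h2, hg, if_true]
      · have e : τ g = -φ g := if_neg hh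
        rw [e]; simp only [τ, map_neg, h2, hneg g hg, if_false, neg_neg]
    have hsum : ∑ g ∈ H, ((a g : ℤ) : ZMod 2) = 0 := by
      refine Finset.sum_involution (fun g _ => τ g) ?_ ?_ hτH hττ
      · intro g hg
        have : a (τ g) = a g := by
          simp only [τ]; split_ifs
          · exact haφ g
          · rw [han, haφ]
        rw [this]; exact CharTwo.add_self_eq_zero _
      · intro g hg _ e
        simp only [τ] at e
        split_ifs at e
        · exact (hnf g hg).1 e
        · exact (hnf g hg).2 (neg_eq_iff_eq_neg.1 e)
    rw [← Int.cast_sum, ZMod.intCast_eq_zero_iff_even] at hsum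
    obtain ⟨d, hd⟩ := hsum
    obtain ⟨d', hd'⟩ := hev s'
    rw [hd, hd'] at hpar
    simp at hpar
    omega

theorem inv_rank (φ : L →ₗ[ℤ] L) (h2 : ∀ x, φ (φ x) = x) (S T : Submodule ℤ L)
    (hS : ∀ x, x ∈ S ↔ φ x = -x) (hT : ∀ x, x ∈ T ↔ φ x = x) : finrank ℤ S + finrank ℤ T = finrank ℤ L := by
  let p : L →ₗ[ℤ] L := φ + LinearMap.id
  have hp : ∀ x, p x = φ x + x := fun x => rfl
  have h1 := Submodule.finrank_quotient_add_finrank (LinearMap.ker p)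
  rw [p.quotKerEquivRange.finrank_eq] at h1
  have h3 : LinearMap.ker p = S := by
    ext x; rw [LinearMap.mem_ker, hS]; exact add_eq_zero_iff_eq_neg
  have h4 : finrank ℤ p.range = finrank ℤ T := by
    apply le_antisymm
    · apply Submodule.finrank_mono
      rintro _ ⟨x, rfl⟩
      rw [hT, hp, map_add, h2, add_comm]
    · let f : T →ₗ[ℤ] p.range := p.rangeRestrict.comp T.subtype
      refine LinearMap.finrank_le_finrank_of_injective (f := f) ?_
      intro x y hxy
      have e : p x = p y := congrArg Subtype.val hxy
      rw [hp, hp, (hT x).1 x.2, (hT y).1 y.2, ← two_smul ℤ, ← two_smul ℤ] at e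
      exact Subtype.ext (two_cancel e)
  rw [h3, h4] at h1
  omega

theorem inv_count (φ : L →ₗ[ℤ] L) (h2 : ∀ x, φ (φ x) = x) (S T : Submodule ℤ L)
    (hS : ∀ x, x ∈ S ↔ φ x = -x) (hT : ∀ x, x ∈ T ↔ φ x = x) (hTI : ∀ t ∈ T, ∃ z, t = z + φ z) :
    finrank ℤ T ≤ finrank ℤ S ∧ (finrank ℤ T = finrank ℤ S → ∀ s ∈ S, ∃ z, s = z - φ z) := by
  let B := Module.finBasis ℤ T
  choose z hz using fun i => hTI (B i) (B i).2
  obtain ⟨π, hπ⟩ := mod2_map (N := S) rfl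
  have hzS : ∀ x, x - φ x ∈ S := fun x => by rw [hS, map_sub, h2]; abel
  let u : (Fin (finrank ℤ T) → ZMod 2) → L := fun c => ∑ i, ((c i).val : ℤ) • z i
  let F : (Fin (finrank ℤ T) → ZMod 2) → (Fin (finrank ℤ S) → ZMod 2) := fun c => π ⟨_, hzS (u c)⟩
  have hF : Function.Injective F := by
    intro c c' hcc
    obtain ⟨s, hs⟩ := (hπ _ _).1 hcc
    have hs1 := congrArg Subtype.val hs
    simp only [Submodule.coe_sub, Submodule.coe_smul] at hs1
    let v := u c - u c'
    have hv : v = ∑ i, (((c i).val : ℤ) - ((c' i).val : ℤ)) • z i := by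
      simp only [v, u, sub_smul, Finset.sum_sub_distrib]
    have hv1 : v - φ v = (2:ℤ) • (s : L) := by
      simp only [v, map_sub]; rw [← hs1]; abel
    have hvT : v - s ∈ T := by
      rw [hT, map_sub, (hS s).1 s.2]
      linear_combination (norm := module) -hv1
    have hsum : (∑ i, (((c i).val : ℤ) - ((c' i).val : ℤ)) • B i) = (2:ℤ) • (⟨_, hvT⟩ : T) := by
      apply Subtype.ext
      have e1 : ((∑ i, (((c i).val : ℤ) - ((c' i).val : ℤ)) • B i : T) : L) = v + φ v := by
        rw [hv, map_sum, ← Finset.sum_add_distrib, Submodule.coe_sum]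
        refine Finset.sum_congr rfl fun i _ => ?_
        rw [Submodule.coe_smul, map_smul, ← smul_add, ← hz]
      rw [e1, Submodule.coe_smul]
      linear_combination (norm := module) -hv1
    funext i
    have h5 := congrArg (fun t => B.repr t i) hsum
    simp only [map_smul, Finsupp.smul_apply, B.repr_sum_self] at h5
    have h6 : (((c i).val : ℤ) : ZMod 2) = (((c' i).val : ℤ) : ZMod 2) := by
      rw [ZMod.intCast_eq_intCast_iff_dvd_sub]
      rw [smul_eq_mul] at h5
      push_cast
      omega
    simpa using h6
  have hcard := Fintype.card_le_of_injective F hF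
  simp only [Fintype.card_fun, ZMod.card, Fintype.card_fin] at hcard
  refine ⟨(Nat.pow_le_pow_iff_right (by norm_num)).1 hcard, fun he s hs => ?_⟩
  have hbij : Function.Bijective F := by
    rw [Fintype.bijective_iff_injective_and_card]
    exact ⟨hF, by simp [he]⟩
  obtain ⟨c, hc⟩ := hbij.2 (π ⟨s, hs⟩)
  obtain ⟨y, hy⟩ := (hπ _ _).1 hc
  have hy1 := congrArg Subtype.val hy
  simp only [Submodule.coe_sub, Submodule.coe_smul] at hy1
  refine ⟨u c - y, ?_⟩
  rw [map_sub, (hS y).1 y.2]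
  linear_combination (norm := module) -hy1

theorem UM.halfForm (h : UM b) (hmin : ∀ x, x ≠ 0 → 4 ≤ b x x)
    (φ : L →ₗ[ℤ] L) (h2 : ∀ x, φ (φ x) = x) (hi : ∀ x y, b (φ x) (φ y) = b x y) (S : Submodule ℤ L)
    (hS : ∀ x, x ∈ S ↔ φ x = -x) (hSI : ∀ s ∈ S, ∃ z, s = z - φ z) :
    ∃ b' : S →ₗ[ℤ] S →ₗ[ℤ] ℤ, UM b' ∧ (∀ x, x ≠ 0 → 2 ≤ b' x x) ∧ ∀ x y : S, 2 * b' x y = b x y := by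
  have hadj : ∀ x y, b (φ x) y = b x (φ y) := fun x y => by rw [← hi, h2]
  obtain ⟨b', hb'⟩ := divForm b S 2 (by norm_num) (by
    intro x hx y hy
    obtain ⟨z, rfl⟩ := hSI x hx
    rw [map_sub b, LinearMap.sub_apply, hadj, (hS y).1 hy, map_neg]
    exact ⟨b z y, by ring⟩)
  refine ⟨b', ⟨?_, ?_, ?_⟩, ?_, hb'⟩
  · intro x y
    have h1 := hb' x y
    have h3 := hb' y x
    rw [h.symm] at h1; omega
  · intro x hx
    have h1 := hb' x x
    have h3 := h.pos x (by simpa using hx)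
    omega
  · intro g
    have hm : ∀ x, (LinearMap.id - φ : L →ₗ[ℤ] L) x ∈ S := by
      intro x; rw [hS]; simp only [LinearMap.sub_apply, LinearMap.id_apply, map_sub, h2]; abel
    obtain ⟨p, hp⟩ := h.unim (g.comp (LinearMap.codRestrict S _ hm))
    have hp' : ∀ x, b p x = g ⟨_, hm x⟩ := hp
    have hpS : p ∈ S := by
      rw [hS]
      refine h.ext _ _ fun u => ?_
      have e : ∀ x (y : S), (LinearMap.id - φ : L →ₗ[ℤ] L) x = y → b p x = g y := by
        intro x y hxy; rw [hp']; congr 1; exact Subtype.ext hxy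
      have e1 : b p (u + φ u) = g 0 := e _ _ (by simp [h2]; abel)
      rw [map_zero, map_add] at e1
      rw [hadj, map_neg b, LinearMap.neg_apply]
      omega
    refine ⟨⟨p, hpS⟩, fun s => ?_⟩
    have h1 := hb' ⟨p, hpS⟩ s
    have e2 : (⟨_, hm s⟩ : S) = (2:ℤ) • s := by
      apply Subtype.ext
      simp only [LinearMap.sub_apply, LinearMap.id_apply, (hS s).1 s.2, Submodule.coe_smul]
      rw [two_smul]; abel
    simp only [hp', e2, map_smul, smul_eq_mul] at h1
    omega
  · intro x hx
    have h1 := hb' x x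
    have h3 := hmin x (by simpa using hx)
    omega

end Inv


/-- the coinvariant lattice of an involution of the Leech lattice has
rank 8, 12, 16 or 24, and is `E8(-2)`, `D12^+(-2)` or the whole Leech lattice in the
cases of rank 8, 12 and 24 respectively. -/
theorem stmt10
    (Λ : Type*) [AddCommGroup Λ] [Module.Free ℤ Λ] [Module.Finite ℤ Λ]
    (bΛ : Λ →ₗ[ℤ] Λ →ₗ[ℤ] ℤ)
    (hsymm : ∀ x y : Λ, bΛ x y = bΛ y x)
    (heven : ∀ x : Λ, Even (bΛ x x))
    (hneg : ∀ x : Λ, x ≠ 0 → bΛ x x < 0)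
    (hrank : finrank ℤ Λ = 24)
    (hunimodular : Function.Bijective bΛ)
    (hnoroot : ∀ x : Λ, bΛ x x ≠ -2)
    (φ : Λ ≃ₗ[ℤ] Λ)
    (hiso : ∀ x y : Λ, bΛ (φ x) (φ y) = bΛ x y)
    (hord : orderOf φ = 2) :
    (finrank ℤ (orthSub bΛ (fixSub φ)) = 8 ∨
     finrank ℤ (orthSub bΛ (fixSub φ)) = 12 ∨
     finrank ℤ (orthSub bΛ (fixSub φ)) = 16 ∨
     finrank ℤ (orthSub bΛ (fixSub φ)) = 24) ∧
    (finrank ℤ (orthSub bΛ (fixSub φ)) = 8 →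
      ∃ e : ↥(orthSub bΛ (fixSub φ)) ≃ₗ[ℤ] (Fin 8 → ℤ),
        ∀ x y : ↥(orthSub bΛ (fixSub φ)),
          bΛ (x : Λ) (y : Λ) = -2 * ((e x) ⬝ᵥ (E8M *ᵥ (e y)))) ∧
    (finrank ℤ (orthSub bΛ (fixSub φ)) = 12 →
      ∃ e : ↥(orthSub bΛ (fixSub φ)) ≃ₗ[ℤ] ↥D12plus,
        ∀ x y : ↥(orthSub bΛ (fixSub φ)),
          (bΛ (x : Λ) (y : Λ) : ℚ) =
            -2 * ∑ i, (e x : Fin 12 → ℚ) i * (e y : Fin 12 → ℚ) i) ∧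
    (finrank ℤ (orthSub bΛ (fixSub φ)) = 24 →
      orthSub bΛ (fixSub φ) = ⊤) := by
  have h2 : ∀ x, φ (φ x) = x := by
    intro x
    have := pow_orderOf_eq_one φ
    rw [hord, pow_two] at this
    exact LinearEquiv.congr_fun this x
  have hne1 : ∃ x, φ x ≠ x := by
    by_contra hcon
    push Not at hcon
    have : φ = 1 := LinearEquiv.ext hcon
    rw [this, orderOf_one] at hord
    omega
  let b : Λ →ₗ[ℤ] Λ →ₗ[ℤ] ℤ := -bΛ
  have hb : ∀ x y, b x y = - bΛ x y := fun x y => rfl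
  have h : UM b := by
    refine ⟨fun x y => by rw [hb, hb, hsymm], fun x hx => by rw [hb]; have := hneg x hx; omega, fun f => ?_⟩
    obtain ⟨y, hy⟩ := hunimodular.2 (-f)
    exact ⟨y, fun x => by rw [hb, hy]; simp⟩
  have hev : EvenL b := fun x => by rw [hb]; exact (heven x).neg
  have hn2 : ∀ x, b x x ≠ 2 := fun x e => hnoroot x (by rw [hb] at e; omega)
  have hmin : ∀ x, x ≠ 0 → 4 ≤ b x x := by
    intro x hx
    have := h.pos x hx
    have := hn2 x
    obtain ⟨c, hc⟩ := hev x
    omega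
  let ψ : Λ →ₗ[ℤ] Λ := φ.toLinearMap
  have hψ2 : ∀ x, ψ (ψ x) = x := h2
  have hψi : ∀ x y, b (ψ x) (ψ y) = b x y := fun x y => by rw [hb, hb]; exact congrArg _ (hiso x y)
  have hT : ∀ x, x ∈ fixSub φ ↔ ψ x = x := by
    intro x
    change φ x - x = 0 ↔ _
    exact sub_eq_zero
  have hS : ∀ x, x ∈ orthSub bΛ (fixSub φ) ↔ ψ x = -x := by
    intro x
    change (∀ y ∈ fixSub φ, bΛ x y = 0) ↔ _
    constructor
    · intro hx
      refine h.ext _ _ fun u => ?_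
      have h3 := hx (u + ψ u) (by rw [hT, map_add, hψ2, add_comm])
      rw [map_add] at h3
      have h4 := hψi x (ψ u)
      rw [hψ2, hb x] at h4
      have h5 : b (-x) u = bΛ x u := (hb (-x) u).trans (by rw [map_neg bΛ x, LinearMap.neg_apply, neg_neg])
      rw [h5]
      omega
    · intro hx y hy
      have h3 := hψi x y
      have h5 : b (-x) y = bΛ x y := (hb (-x) y).trans (by rw [map_neg bΛ x, LinearMap.neg_apply, neg_neg])
      rw [(hT y).1 hy, hx, h5, hb] at h3
      omega
  generalize hSdef : orthSub bΛ (fixSub φ) = S at *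
  generalize fixSub φ = T at *
  have hrk := inv_rank ψ hψ2 S T hS hT
  rw [hrank] at hrk
  -- first case
  have caseS : (∀ s ∈ S, ∃ z, s = z - ψ z) → 1 ≤ finrank ℤ S → finrank ℤ S ≤ 12 →
      (finrank ℤ S = 8 ∧ ∃ e : S ≃ₗ[ℤ] (Fin 8 → ℤ), ∀ x y : S, bΛ (x : Λ) (y : Λ) = -2 * ((e x) ⬝ᵥ (E8M *ᵥ (e y)))) ∨
      (finrank ℤ S = 12 ∧ ∃ e : S ≃ₗ[ℤ] D12plus, ∀ x y : S, (bΛ (x : Λ) (y : Λ) : ℚ) =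
            -2 * ∑ i, (e x : Fin 12 → ℚ) i * (e y : Fin 12 → ℚ) i) := by
    intro hSI h1 h12
    obtain ⟨b', hu, hm, hbb⟩ := h.halfForm hmin ψ hψ2 hψi S hS hSI
    rcases hu.Mthm hm h1 h12 with ⟨hr, he⟩ | ⟨hr, w, K, hK, hK4, hKn⟩
    · left
      obtain ⟨e, hee⟩ := hu.isoE8 he hr
      refine ⟨hr, e, fun x y => ?_⟩
      have h3 := hbb x y
      rw [hb] at h3
      rw [← hee]; omega
    · right
      obtain ⟨g, hh, z, G⟩ := hu.frame12 hm hr w K hK hK4 hKn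
      obtain ⟨e, hee⟩ := hu.isoD12 g hh z G
      refine ⟨hr, e, fun x y => ?_⟩
      have h3 := hbb x y
      rw [hb] at h3
      have h4 : bΛ (x : Λ) (y : Λ) = -2 * b' x y := by omega
      rw [← hee, h4]; push_cast; ring
  have hSpos : 1 ≤ finrank ℤ S := by
    obtain ⟨x, hx⟩ := hne1
    rw [Nat.one_le_iff_ne_zero, ne_eq, Submodule.finrank_eq_zero]
    intro e
    have h3 : x - ψ x ∈ S := by rw [hS, map_sub, hψ2]; abel
    rw [e, Submodule.mem_bot, sub_eq_zero] at h3
    exact hx h3.symm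
  have concl : ((finrank ℤ S = 8 ∧ ∃ e : S ≃ₗ[ℤ] (Fin 8 → ℤ), ∀ x y : S, bΛ (x : Λ) (y : Λ) = -2 * ((e x) ⬝ᵥ (E8M *ᵥ (e y)))) ∨
      (finrank ℤ S = 12 ∧ ∃ e : S ≃ₗ[ℤ] D12plus, ∀ x y : S, (bΛ (x : Λ) (y : Λ) : ℚ) =
            -2 * ∑ i, (e x : Fin 12 → ℚ) i * (e y : Fin 12 → ℚ) i)) ∨ finrank ℤ S = 16 ∨ finrank ℤ S = 24 := by
    have hdich : (∀ s ∈ S, ∃ z, s = z - ψ z) ∨ (∀ t ∈ T, ∃ z, t = z + ψ z) := by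
      by_contra hcon
      push Not at hcon
      obtain ⟨⟨s, hs, hs'⟩, ⟨t, ht, ht'⟩⟩ := hcon
      rcases h.dichotomy hev hrank hn2 ψ hψ2 hψi s t ((hS s).1 hs) ((hT t).1 ht) with ⟨z, hz⟩ | ⟨z, hz⟩
      · exact hs' z hz
      · exact ht' z hz
    have hS' : ∀ x, x ∈ S ↔ (-ψ) x = x := by
      intro x; rw [hS, LinearMap.neg_apply, neg_eq_iff_eq_neg]
    have hT' : ∀ x, x ∈ T ↔ (-ψ) x = -x := by
      intro x; rw [hT, LinearMap.neg_apply, neg_inj]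
    have hψ2' : ∀ x, (-ψ) ((-ψ) x) = x := fun x => by simp [hψ2]
    have hψi' : ∀ x y, b ((-ψ) x) ((-ψ) y) = b x y := fun x y => by
      simp only [LinearMap.neg_apply, map_neg, neg_neg]; exact hψi x y
    rcases hdich with hSI | hTI
    · left
      have h3 := (inv_count (-ψ) hψ2' T S hT' hS' (fun s hs => by
        obtain ⟨z, hz⟩ := hSI s hs
        exact ⟨z, by rw [hz, LinearMap.neg_apply, sub_eq_add_neg]⟩)).1
      exact caseS hSI hSpos (by omega)
    · obtain ⟨h3, h4⟩ := inv_count ψ hψ2 S T hS hT hTI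
      by_cases hT0 : finrank ℤ T = 0
      · right; right; omega
      · obtain ⟨b', hu, hm, hbb⟩ := h.halfForm hmin (-ψ) hψ2' hψi' T hT' (fun t ht => by
          obtain ⟨z, hz⟩ := hTI t ht
          exact ⟨z, by rw [LinearMap.neg_apply, sub_neg_eq_add]; exact hz⟩)
        rcases hu.Mthm hm (by omega) (by omega) with ⟨hr, -⟩ | ⟨hr, -⟩
        · right; left; omega
        · left
          exact caseS (h4 (by omega)) hSpos (by omega)
  refine ⟨?_, ?_, ?_, ?_⟩
  · rcases concl with (⟨h3, -⟩ | ⟨h3, -⟩) | h3 | h3 <;> omega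
  · intro h8
    rcases concl with (⟨h3, h4⟩ | ⟨h3, -⟩) | h3 | h3
    · exact h4
    all_goals omega
  · intro h12
    rcases concl with (⟨h3, -⟩ | ⟨h3, h4⟩) | h3 | h3
    · omega
    · exact h4
    all_goals omega
  · intro h24
    have hT0 : finrank ℤ T = 0 := by omega
    rw [Submodule.finrank_eq_zero] at hT0
    rw [eq_top_iff]
    intro x _
    have h3 : x + ψ x ∈ T := by rw [hT, map_add, hψ2, add_comm]
    rw [hT0, Submodule.mem_bot] at h3
    rw [hS]
    exact eq_neg_of_add_eq_zero_right h3
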